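/- Suppose r = [m, 2] (i.e., k = 2 and m_2 = 2) with m ≥ 2, and let s, s′ be distinct rational numbers in I_1(r;n) ∪ I_2(r;n) such that u_s is conjugate in Heck(r;n) to u_{s′} or to u_{s′}^{−1}. Then neither s nor s′ belongs to I_1(r;n) ∖ I_1(r); that is, both s and s′ lie in I_2(r;n) ∖ I_2(r). -/

import Mathlib

/- Formalization of statements from "Homotopically equivalent simple loops on
2-bridge spheres in Heckoid orbifolds for 2-bridge links (II)" by Lee-Sakuma.

We work in the free group `F` on two generators `a = gen 0`, `b = gen 1`.
For a rational `s` (in lowest terms `q/p`, with `0 ≤ s ≤ 1`), `uWord s` is the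
word `u_s = a b^{ε₁} a^{ε₂} ⋯ b^{ε_{2p-1}}` with `ε_i = (-1)^⌊i·s⌋`.
`CS s` is (a linear representative of) the cyclic sequence of lengths of
maximal constant-sign runs of exponents of `u_s`; since `u_s` begins with a
positive letter and (for `0 < s ≤ 1`) ends with a negative letter, the linear
run-length sequence represents the cyclic one.  `CyclicContains L T` says the
cyclic sequence represented by `L` contains `T` as a block of consecutive
terms.  `cfQ [m₁,…,m_k]` is the continued fraction `1/(m₁+1/(m₂+⋯+1/m_k))`.
`memI1 M n s` / `memI2 M n s` express `s ∈ I₁(r;n)` / `s ∈ I₂(r;n)` where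
`r = cfQ M`, and `memI1hat` / `memI2hat` express `s ∈ I₁(r)` / `s ∈ I₂(r)`.
The Heckoid group `Heck(r;n) = ⟨a,b | u_r^n⟩` is the quotient of `F` by the
normal closure `heckN r n` of `u_r^n`, with quotient map `heckQ r n`. -/

namespace Heckoid

abbrev F : Type := FreeGroup (Fin 2)

/-- The generators: `gen 0 = a`, `gen 1 = b` (and `gen i` depends on parity). -/
def gen (i : ℕ) : F := FreeGroup.of ⟨i % 2, Nat.mod_lt _ (by norm_num)⟩

/-- The word `u_s = a b^{ε₁} a^{ε₂} b^{ε₃} ⋯ a^{ε_{2p-2}} b^{ε_{2p-1}}`,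
where `s = q/p` in lowest terms and `ε_i = (-1)^⌊iq/p⌋`. -/
def uWord (s : ℚ) : F :=
  ((List.range (2 * s.den)).map
    (fun i => gen i ^ ((-1 : ℤ) ^ (⌊(i : ℚ) * s⌋.toNat)))).prod

/-- The sequence of exponent signs `ε₀, ε₁, …, ε_{2p-1}` of `u_s`. -/
def signList (s : ℚ) : List ℤ :=
  (List.range (2 * s.den)).map (fun i => (-1 : ℤ) ^ (⌊(i : ℚ) * s⌋.toNat))

/-- Lengths of the maximal runs of equal consecutive entries. -/
def runLengths {α : Type} [BEq α] (l : List α) : List ℕ :=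
  (l.splitBy (· == ·)).map List.length

/-- `CS s = CS(u_s)`: the cyclic sequence of lengths of maximal constant-sign
runs of `u_s`, represented by a list. -/
def CS (s : ℚ) : List ℕ := runLengths (signList s)

/-- The cyclic sequence represented by `L` contains `T` as a block of
consecutive terms. -/
def CyclicContains (L T : List ℕ) : Prop := ∃ k, T <+: L.rotate k

/-- The continued fraction `[m₁, m₂, …, m_k] = 1/(m₁+1/(m₂+⋯+1/m_k))`. -/
def cfQ : List ℕ → ℚ
  | [] => 0
  | a :: l => 1 / ((a : ℚ) + cfQ l)

/-- `d⟨T, T'⟩`: `d` consecutive repetitions of the concatenation of `T` and `T'`. -/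
def rep2 (d : ℕ) (T T' : List ℕ) : List ℕ := (List.replicate d (T ++ T')).flatten

/-- `s ∈ I₁(r;n)` where `r = cfQ M`:  `[0, [m₁,…,m_{k-1},m_k-1,2]]` for `k` even,
`[0, [m₁,…,m_k,2n-2])` for `k` odd. -/
def memI1 (M : List ℕ) (n : ℕ) (s : ℚ) : Prop :=
  if Even M.length then 0 ≤ s ∧ s ≤ cfQ (M.dropLast ++ [M.getLast! - 1, 2])
  else 0 ≤ s ∧ s < cfQ (M ++ [2 * n - 2])

/-- `s ∈ I₂(r;n)` where `r = cfQ M`: `([m₁,…,m_k,2n-2], 1]` for `k` even,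
`[[m₁,…,m_{k-1},m_k-1,2], 1]` for `k` odd. -/
def memI2 (M : List ℕ) (n : ℕ) (s : ℚ) : Prop :=
  if Even M.length then cfQ (M ++ [2 * n - 2]) < s ∧ s ≤ 1
  else cfQ (M.dropLast ++ [M.getLast! - 1, 2]) ≤ s ∧ s ≤ 1

/-- `s ∈ I₁(r)` where `r = cfQ M`. -/
def memI1hat (M : List ℕ) (s : ℚ) : Prop :=
  if Even M.length then 0 ≤ s ∧ s ≤ cfQ (M.dropLast ++ [M.getLast! - 1])
  else 0 ≤ s ∧ s ≤ cfQ M.dropLast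

/-- `s ∈ I₂(r)` where `r = cfQ M`. -/
def memI2hat (M : List ℕ) (s : ℚ) : Prop :=
  if Even M.length then cfQ M.dropLast ≤ s ∧ s ≤ 1
  else cfQ (M.dropLast ++ [M.getLast! - 1]) ≤ s ∧ s ≤ 1

/-- The normal closure of `u_r^n`, so that `Heck(r;n) = F ⧸ heckN r n`. -/
abbrev heckN (r : ℚ) (n : ℕ) : Subgroup F := Subgroup.normalClosure {uWord r ^ n}

/-- The quotient map `F → Heck(r;n) = ⟨a, b | u_r^n⟩`. -/
def heckQ (r : ℚ) (n : ℕ) : F →* F ⧸ heckN r n := QuotientGroup.mk' (heckN r n)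

/-! ### Words of lines of rational slope -/

/-- The automorphism of `F` exchanging the two generators. -/
def swapGen : MulAut F := FreeGroup.freeGroupCongr (Equiv.swap 0 1)

/-- The automorphism of `F` inverting both generators. -/
def invGen : MulAut F where
  toFun := FreeGroup.lift fun i => (FreeGroup.of i)⁻¹
  invFun := FreeGroup.lift fun i => (FreeGroup.of i)⁻¹
  left_inv x := by
    have : (FreeGroup.lift fun i => (FreeGroup.of i : F)⁻¹).comp
        (FreeGroup.lift fun i => (FreeGroup.of i : F)⁻¹) = MonoidHom.id F := by
      ext i; simp
    exact DFunLike.congr_fun this x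
  right_inv x := by
    have : (FreeGroup.lift fun i => (FreeGroup.of i : F)⁻¹).comp
        (FreeGroup.lift fun i => (FreeGroup.of i : F)⁻¹) = MonoidHom.id F := by
      ext i; simp
    exact DFunLike.congr_fun this x
  map_mul' := map_mul _

/-- The holomorph of `F`. -/
abbrev Hol : Type := F ⋊[MonoidHom.id (MulAut F)] MulAut F

/-- The `i`-th letter with sign `(-1) ^ j`. -/
def letter (i j : ℕ) : F := gen i ^ ((-1 : ℤ) ^ j)

lemma swapGen_gen (i : ℕ) : swapGen (gen i) = gen (i + 1) := by
  have h : i % 2 = 0 ∨ i % 2 = 1 := by omega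
  unfold swapGen gen
  rcases h with h | h
  · have h' : (i + 1) % 2 = 1 := by omega
    simp [h, h']
  · have h' : (i + 1) % 2 = 0 := by omega
    simp [h, h']

lemma invGen_gen (i : ℕ) : invGen (gen i) = (gen i)⁻¹ := by
  simp [invGen, gen]

lemma swapGen_letter (i j : ℕ) : swapGen (letter i j) = letter (i + 1) j := by
  simp [letter, swapGen_gen]

lemma invGen_letter (i j : ℕ) : invGen (letter i j) = letter i (j + 1) := by
  simp [letter, invGen_gen, pow_succ]

lemma twist_letter (p q i j : ℕ) :
    (swapGen ^ p * invGen ^ q) (letter i j) = letter (i + p) (j + q) := by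
  have h1 : ∀ q j, (invGen ^ q) (letter i j) = letter i (j + q) := by
    intro q
    induction q with
    | zero => intro j; simp
    | succ q ih =>
      intro j
      rw [pow_succ, MulAut.mul_apply, invGen_letter, ih]
      congr 1; omega
  have h2 : ∀ p i j, (swapGen ^ p) (letter i j) = letter (i + p) j := by
    intro p
    induction p with
    | zero => intro i j; simp
    | succ p ih =>
      intro i j
      rw [pow_succ, MulAut.mul_apply, swapGen_letter, ih]
      congr 1; omega
  rw [MulAut.mul_apply, h1, h2]

lemma letter_congr {i j i' j' : ℕ} (hi : i % 2 = i' % 2) (hj : j % 2 = j' % 2) :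
    letter i j = letter i' j' := by
  have h1 : gen i = gen i' := by simp only [gen, hi]
  have h2 : ((-1 : ℤ)) ^ j = (-1) ^ j' := by
    rw [← Nat.div_add_mod j 2, ← Nat.div_add_mod j' 2, hj, pow_add, pow_add, pow_mul, pow_mul]
    simp
  rw [letter, letter, h1, h2]

lemma mulAut_ext_letter {f g : MulAut F} (h : ∀ i, f (letter i 0) = g (letter i 0)) : f = g := by
  have h' : (f : F →* F) = (g : F →* F) := by
    refine FreeGroup.ext_hom _ _ fun i => ?_
    have := h i
    have e : letter i 0 = FreeGroup.of i := by
      simp only [letter, gen, pow_zero, zpow_one]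
      congr 1
      ext
      simp only
      omega
    rw [e] at this
    exact this
  ext x
  exact DFunLike.congr_fun h' x

lemma twist_congr {p q p' q' : ℕ} (hp : p % 2 = p' % 2) (hq : q % 2 = q' % 2) :
    swapGen ^ p * invGen ^ q = swapGen ^ p' * invGen ^ q' := by
  refine mulAut_ext_letter fun i => ?_
  rw [twist_letter, twist_letter]
  exact letter_congr (by omega) (by omega)

lemma twist_mul (p q p' q' : ℕ) :
    (swapGen ^ p * invGen ^ q) * (swapGen ^ p' * invGen ^ q') =
      swapGen ^ (p + p') * invGen ^ (q + q') := by
  refine mulAut_ext_letter fun i => ?_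
  rw [MulAut.mul_apply, twist_letter, twist_letter, twist_letter]
  exact letter_congr (by omega) (by omega)

lemma twist_inv (p q : ℕ) :
    (swapGen ^ p * invGen ^ q)⁻¹ = swapGen ^ p * invGen ^ q := by
  rw [inv_eq_iff_mul_eq_one, twist_mul, twist_congr (p' := 0) (q' := 0) (by omega) (by omega)]
  simp

/-- The word read along half a line of slope `q / p`. -/
def halfWord (p q : ℕ) : F := ((List.range p).map fun i => letter i (i * q / p)).prod

/-- The half-line word with its twist, an element whose square is the full word. -/
def glide (p q : ℕ) : Hol := ⟨halfWord p q, swapGen ^ p * invGen ^ q⟩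

lemma glide_mul_of_floor {p q p₁ q₁ p₂ q₂ : ℕ} (hp : p = p₁ + p₂) (hq : q = q₁ + q₂)
    (h₁ : ∀ i < p₁, i * q / p = i * q₁ / p₁)
    (h₂ : ∀ i < p₂, (p₁ + i) * q / p = q₁ + i * q₂ / p₂) :
    glide p q = glide p₁ q₁ * glide p₂ q₂ := by
  subst hp
  refine SemidirectProduct.ext ?_ ?_
  · simp only [glide, SemidirectProduct.mul_left, MonoidHom.id_apply, halfWord]
    rw [List.range_add, List.map_append, List.prod_append, map_list_prod]
    congr 2
    · refine List.map_congr_left fun i hi => ?_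
      rw [h₁ i (List.mem_range.1 hi)]
    · rw [List.map_map, List.map_map]
      refine List.map_congr_left fun i hi => ?_
      simp only [Function.comp]
      rw [h₂ i (List.mem_range.1 hi), twist_letter]
      exact letter_congr (by omega) (by omega)
  · simp only [glide, SemidirectProduct.mul_right]
    rw [twist_mul, hq]

lemma glide_add {p₁ q₁ p₂ q₂ : ℕ} (h : p₁ * q₂ = p₂ * q₁ + 1) :
    glide (p₁ + p₂) (q₁ + q₂) = glide p₁ q₁ * glide p₂ q₂ := by
  refine glide_mul_of_floor rfl rfl (fun i hi => ?_) fun i hi => ?_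
  · have hp : 0 < p₁ := by omega
    have e := Nat.div_add_mod (i * q₁) p₁
    have l := Nat.mod_lt (i * q₁) hp
    set d := i * q₁ / p₁
    set e' := i * q₁ % p₁
    refine Nat.div_eq_of_lt_le ?_ ?_
    · nlinarith
    · have : p₁ * (i * (q₁ + q₂)) < p₁ * ((d + 1) * (p₁ + p₂)) := by
        have e1 : p₁ * (i * (q₁ + q₂)) = (i * q₁) * (p₁ + p₂) + i := by
          linear_combination i * h
        rw [e1, ← e]
        nlinarith
      exact lt_of_mul_lt_mul_left' this
  · have hp : 0 < p₂ := by omega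
    have e := Nat.div_add_mod (i * q₂) p₂
    have l := Nat.mod_lt (i * q₂) hp
    set d := i * q₂ / p₂
    set e' := i * q₂ % p₂
    have hp₁ : 0 < p₁ := Nat.pos_of_ne_zero (by rintro rfl; simp at h)
    have e1 : (p₁ + i) * (q₁ + q₂) = q₁ * (p₁ + p₂) + (1 + i * (q₁ + q₂)) := by
      linear_combination h
    have e2 : p₂ * (1 + i * (q₁ + q₂)) + i = (p₂ * d + e') * (p₁ + p₂) + p₂ := by
      rw [e]
      zify at h ⊢
      linear_combination -i * h
    rw [e1, Nat.add_comm (q₁ * (p₁ + p₂)), Nat.add_mul_div_right _ _ (by omega), Nat.add_comm q₁ d]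
    congr 1
    refine Nat.div_eq_of_lt_le ?_ ?_
    · refine le_of_mul_le_mul_left (a := p₂) ?_ hp
      nlinarith
    · refine lt_of_mul_lt_mul_left (a := p₂) ?_ (Nat.zero_le _)
      nlinarith

lemma glide_double (p q : ℕ) (hp : 0 < p) : glide (2 * p) (2 * q) = glide p q * glide p q := by
  have e : ∀ i, i * (2 * q) / (2 * p) = i * q / p := fun i => by
    rw [show i * (2 * q) = 2 * (i * q) by ring, Nat.mul_div_mul_left _ _ (by norm_num)]
  refine glide_mul_of_floor (by ring) (by ring) (fun i _ => e i) fun i _ => ?_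
  rw [e, add_mul, Nat.add_comm, Nat.mul_comm p, Nat.add_mul_div_right _ _ hp, Nat.add_comm]

lemma inl_uWord (s : ℚ) (hs : 0 ≤ s) :
    (SemidirectProduct.inl (uWord s) : Hol) =
      glide s.den s.num.toNat * glide s.den s.num.toNat := by
  rw [← glide_double _ _ s.den_pos]
  refine SemidirectProduct.ext ?_ ?_
  · simp only [SemidirectProduct.left_inl, glide, halfWord, uWord]
    congr 1
    refine List.map_congr_left fun i _ => ?_
    have e : i * (2 * s.num.toNat) / (2 * s.den) = ⌊(i : ℚ) * s⌋.toNat := by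
      rw [show i * (2 * s.num.toNat) = 2 * (i * s.num.toNat) by ring,
        Nat.mul_div_mul_left _ _ (by norm_num)]
      have hn : ((s.num.toNat : ℕ) : ℤ) = s.num := Int.toNat_of_nonneg (Rat.num_nonneg.2 hs)
      have : (i : ℚ) * s = ((i * s.num.toNat : ℕ) : ℚ) / (s.den : ℚ) := by
        conv_lhs => rw [← Rat.num_div_den s, ← hn]
        push_cast
        ring
      rw [this, Int.floor_toNat, Nat.floor_div_eq_div]
    rw [letter, e]
  · simp only [SemidirectProduct.right_inl, glide]
    rw [twist_congr (p' := 0) (q' := 0) (by omega) (by omega)]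
    simp

/-! ### The hyperelliptic involution -/

/-- `h` inverts `g₁` and `g₂`, and `g₁ h g₂ = a`. -/
structure IsFlip {G : Type*} [Group G] (a g₁ g₂ h : G) : Prop where
  sq : h * h = 1
  conj_fst : h * g₁ * h = g₁⁻¹
  conj_snd : h * g₂ * h = g₂⁻¹
  prod : g₁ * h * g₂ = a

namespace IsFlip

variable {G : Type*} [Group G] {a g₁ g₂ h : G}

lemma rules (H : IsFlip a g₁ g₂ h) :
    h⁻¹ = h ∧ h * h = 1 ∧ (∀ x, h * (h * x) = x) ∧ h * g₁ = g₁⁻¹ * h ∧ h * g₂ = g₂⁻¹ * h ∧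
      h * g₁⁻¹ = g₁ * h ∧ h * g₂⁻¹ = g₂ * h ∧ (∀ x, h * (g₁ * x) = g₁⁻¹ * (h * x)) ∧
      (∀ x, h * (g₂ * x) = g₂⁻¹ * (h * x)) ∧ (∀ x, h * (g₁⁻¹ * x) = g₁ * (h * x)) ∧
      ∀ x, h * (g₂⁻¹ * x) = g₂ * (h * x) := by
  have hh : ∀ x, h * (h * x) = x := fun x => by rw [← mul_assoc, H.sq, one_mul]
  have h₁ : h * g₁ = g₁⁻¹ * h := by rw [← H.conj_fst, mul_assoc, H.sq, mul_one]
  have h₂ : h * g₂ = g₂⁻¹ * h := by rw [← H.conj_snd, mul_assoc, H.sq, mul_one]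
  have h₃ : h * g₁⁻¹ = g₁ * h := by rw [← H.conj_fst, mul_assoc, hh]
  have h₄ : h * g₂⁻¹ = g₂ * h := by rw [← H.conj_snd, mul_assoc, hh]
  refine ⟨inv_eq_of_mul_eq_one_left H.sq, H.sq, hh, h₁, h₂, h₃, h₄, ?_, ?_, ?_, ?_⟩ <;>
    intro x <;> simp only [← mul_assoc, h₁, h₂, h₃, h₄]

lemma left (H : IsFlip a g₁ g₂ h) : IsFlip a g₁ (g₁ * g₂) (g₁ * h) := by
  constructor <;> simp [mul_assoc, H.rules, ← H.prod]

lemma right (H : IsFlip a g₁ g₂ h) : IsFlip a (g₁ * g₂) g₂ (h * g₂) := by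
  constructor <;> simp [mul_assoc, H.rules, ← H.prod]

lemma fst_mul_fst (H : IsFlip a g₁ g₂ h) : a * (g₁⁻¹ * a * g₁) = g₁ * g₁ := by
  simp [mul_assoc, H.rules, ← H.prod]

lemma conj_mul_conj (H : IsFlip a g₁ g₂ h) :
    (g₁⁻¹ * a * g₁) * (h * a * h⁻¹) = (g₂ * g₂)⁻¹ := by
  simp [mul_assoc, H.rules, ← H.prod]

lemma mul_conj (H : IsFlip a g₁ g₂ h) :
    a * (h * a * h⁻¹) = (g₁ * g₂⁻¹) * (g₁ * g₂⁻¹) := by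
  simp [mul_assoc, H.rules, ← H.prod]

lemma mul_mul_mul (H : IsFlip a g₁ g₂ h) :
    a * (g₁⁻¹ * a * g₁) * (h * a * h⁻¹) * (g₁⁻¹ * a * g₁)⁻¹ = (g₁ * g₂) * (g₁ * g₂) := by
  simp [mul_assoc, H.rules, ← H.prod]

lemma mul_mul (H : IsFlip a g₁ g₂ h) :
    a * (g₁⁻¹ * a * g₁) * (h * a * h⁻¹) = (g₂ * a * g₂⁻¹)⁻¹ := by
  simp [mul_assoc, H.rules, ← H.prod]

lemma conj_sq_inv (H : IsFlip a g₁ g₂ h) :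
    (g₁ * (g₁ * g₂)⁻¹) * (g₁ * (g₁ * g₂)⁻¹) = a * (g₂ * g₂) * a⁻¹ := by
  simp [mul_assoc, H.rules, ← H.prod]

end IsFlip

lemma exists_isFlip : ∀ {p₁ q₁ p₂ q₂ : ℕ}, p₁ * q₂ = p₂ * q₁ + 1 →
    ∃ h, IsFlip (SemidirectProduct.inl (gen 0)) (glide p₁ q₁) (glide p₂ q₂) h := by
  suffices ∀ N p₁ q₁ p₂ q₂ : ℕ, p₁ + q₁ + p₂ + q₂ ≤ N → p₁ * q₂ = p₂ * q₁ + 1 →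
      ∃ h, IsFlip (SemidirectProduct.inl (gen 0)) (glide p₁ q₁) (glide p₂ q₂) h from
    fun {_ _ _ _} h => this _ _ _ _ _ le_rfl h
  intro N
  induction N with
  | zero => intro p₁ q₁ p₂ q₂ hN h; exfalso; obtain rfl : p₁ = 0 := by omega
            simp at h
  | succ N ih =>
    intro p₁ q₁ p₂ q₂ hN h
    have hp₁ : 0 < p₁ := Nat.pos_of_ne_zero (by rintro rfl; simp at h)
    have hq₂ : 0 < q₂ := Nat.pos_of_ne_zero (by rintro rfl; simp at h)
    by_cases h₁ : p₁ ≤ p₂ ∧ q₁ ≤ q₂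
    · obtain ⟨⟨p, rfl⟩, ⟨q, rfl⟩⟩ := And.imp exists_add_of_le exists_add_of_le h₁
      have h' : p₁ * q = p * q₁ + 1 := by linarith
      obtain ⟨f, hf⟩ := ih p₁ q₁ p q (by omega) h'
      exact ⟨_, glide_add h' ▸ hf.left⟩
    by_cases h₂ : p₂ ≤ p₁ ∧ q₂ ≤ q₁
    · obtain ⟨⟨p, rfl⟩, ⟨q, rfl⟩⟩ := And.imp exists_add_of_le exists_add_of_le h₂
      have h' : p * q₂ = p₂ * q + 1 := by linarith
      obtain ⟨f, hf⟩ := ih p q p₂ q₂ (by omega) h'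
      refine ⟨f * glide p₂ q₂, ?_⟩
      rw [add_comm p₂, add_comm q₂, glide_add h']
      exact hf.right
    have hroot : p₁ = 1 ∧ q₁ = 0 ∧ p₂ = 0 ∧ q₂ = 1 := by
      rcases Nat.lt_or_ge p₂ p₁ with hp | hp
      · have hq : q₁ < q₂ := by omega
        have : (p₂ + 1) * (q₁ + 1) ≤ p₁ * q₂ := Nat.mul_le_mul hp hq
        have e : p₂ = 0 ∧ q₁ = 0 := by constructor <;> nlinarith
        obtain ⟨rfl, rfl⟩ := e
        simp at h
        exact ⟨h.1, rfl, rfl, h.2⟩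
      · have hq : q₂ < q₁ := by omega
        have : p₁ * q₂ ≤ p₂ * q₁ := Nat.mul_le_mul hp hq.le
        omega
    obtain ⟨rfl, rfl, rfl, rfl⟩ := hroot
    refine ⟨⟨1, swapGen * invGen⟩, ?_⟩
    have hi : swapGen⁻¹ = swapGen := by simpa using twist_inv 1 0
    have hs : swapGen * swapGen = 1 := inv_eq_iff_mul_eq_one.1 hi
    have hj : invGen⁻¹ = invGen := by simpa using twist_inv 0 1
    have ht : invGen * invGen = 1 := inv_eq_iff_mul_eq_one.1 hj
    have hc : invGen * swapGen = swapGen * invGen := by simpa using twist_mul 0 1 1 0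
    have hs' : ∀ x, swapGen * (swapGen * x) = x := fun x => by rw [← mul_assoc, hs, one_mul]
    have hc' : ∀ x, invGen * (swapGen * x) = swapGen * (invGen * x) := fun x => by
      rw [← mul_assoc, hc, mul_assoc]
    constructor <;> refine SemidirectProduct.ext ?_ ?_ <;>
      simp [glide, halfWord, letter, invGen_gen, swapGen_gen, hi, hs, hj, ht, hc, hs', hc',
        mul_assoc]

section

/-! ### Traces -/

open Matrix

/-- The trace of an element of `SL₂(ℂ)`. -/
def str (g : Matrix.SpecialLinearGroup (Fin 2) ℂ) : ℂ := g.1.trace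

lemma str_mul_comm (g h : Matrix.SpecialLinearGroup (Fin 2) ℂ) : str (g * h) = str (h * g) := by
  simp only [str, Matrix.SpecialLinearGroup.coe_mul]
  exact Matrix.trace_mul_comm _ _

lemma str_conj (g h : Matrix.SpecialLinearGroup (Fin 2) ℂ) : str (g * h * g⁻¹) = str h := by
  rw [str_mul_comm, inv_mul_cancel_left]

lemma str_mul_add (g h : Matrix.SpecialLinearGroup (Fin 2) ℂ) :
    str (g * h) + str (g * h⁻¹) = str g * str h := by
  simp only [str, Matrix.SpecialLinearGroup.coe_mul, Matrix.SpecialLinearGroup.coe_inv,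
    Matrix.adjugate_fin_two, Matrix.trace_fin_two, Matrix.mul_apply, Fin.sum_univ_two,
    Matrix.of_apply, Matrix.cons_val', Matrix.cons_val_zero, Matrix.cons_val_one,
    Matrix.cons_val_fin_one]
  ring

lemma str_inv (g : Matrix.SpecialLinearGroup (Fin 2) ℂ) : str g⁻¹ = str g := by
  simp [str, Matrix.SpecialLinearGroup.coe_inv, Matrix.adjugate_fin_two, Matrix.trace_fin_two,
    add_comm]

lemma str_fricke (a b c : Matrix.SpecialLinearGroup (Fin 2) ℂ) :
    str (a * b * c * b⁻¹) + str (a * c) + str (a * b) * str (b * c) =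
      str a * str c + str b * str (a * b * c) := by
  have h₁ := str_mul_add (a * b * c) b
  have h₂ := str_mul_add (a * b) (c * b)
  have h₃ := str_mul_add a c
  rw [_root_.mul_inv_rev, ← mul_assoc, ← mul_assoc, mul_inv_cancel_right, str_mul_comm c b] at h₂
  linear_combination h₁ - h₂ + h₃

variable (ρ : F →* Matrix.SpecialLinearGroup (Fin 2) ℂ)

/-- The trace of the square of an element of the holomorph. -/
def sqTrace (g : Hol) : ℂ := str (ρ (g * g).left)

/-- The trace of the word of slope `q / p`. -/
def slopeTrace (p q : ℕ) : ℂ := sqTrace ρ (glide p q)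

lemma exists_conj_inl (g : Hol) {p q : ℕ} (hg : g.right = swapGen ^ p * invGen ^ q) :
    ∃ w, g * SemidirectProduct.inl (gen 0) * g⁻¹ = SemidirectProduct.inl w ∧
      str (ρ w) = str (ρ (gen p)) := by
  refine ⟨g.left * g.right (gen 0) * g.left⁻¹, ?_, ?_⟩
  · refine SemidirectProduct.ext ?_ ?_ <;> simp [mul_assoc]
  · rw [map_mul, map_mul, map_inv, str_conj, hg]
    have := twist_letter p q 0 0
    simp only [letter, pow_zero, zpow_one, zero_add] at this
    rw [this]
    rcases neg_one_pow_eq_or ℤ q with h | h <;> simp [h, str_inv]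

lemma left_eq_of_eq_inl {g : Hol} {w : F} (h : g = SemidirectProduct.inl w) : g.left = w := by
  rw [h, SemidirectProduct.left_inl]

lemma sqTrace_add {g₁ g₂ h : Hol} (H : IsFlip (SemidirectProduct.inl (gen 0)) g₁ g₂ h)
    {p₁ q₁ p₂ q₂ : ℕ} (h₁ : g₁.right = swapGen ^ p₁ * invGen ^ q₁)
    (h₂ : g₂.right = swapGen ^ p₂ * invGen ^ q₂) :
    sqTrace ρ (g₁ * g₂) + sqTrace ρ (g₁ * g₂⁻¹) + sqTrace ρ g₁ * sqTrace ρ g₂ =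
      str (ρ (gen 0)) * str (ρ (gen (p₁ + p₂))) + str (ρ (gen p₁)) * str (ρ (gen p₂)) := by
  have hh : h.right = swapGen ^ (p₁ + p₂) * invGen ^ (q₁ + q₂) := by
    have := congrArg SemidirectProduct.right H.prod
    simp only [SemidirectProduct.mul_right, SemidirectProduct.right_inl, h₁, h₂] at this
    rw [mul_eq_one_iff_eq_inv, twist_inv, ← eq_inv_mul_iff_mul_eq, twist_inv, twist_mul] at this
    exact this
  have h₁' : g₁⁻¹.right = swapGen ^ p₁ * invGen ^ q₁ := by
    rw [SemidirectProduct.inv_right, h₁, twist_inv]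
  obtain ⟨b, hb, tb⟩ := exists_conj_inl ρ g₁⁻¹ h₁'
  obtain ⟨c, hc, tc⟩ := exists_conj_inl ρ h hh
  obtain ⟨d, hd, td⟩ := exists_conj_inl ρ g₂ h₂
  rw [inv_inv] at hb
  have e₁ := H.fst_mul_fst
  have e₂ := H.conj_mul_conj
  have e₃ := H.mul_conj
  have e₄ := H.mul_mul_mul
  have e₅ := H.mul_mul
  rw [hb] at e₁ e₂ e₄ e₅
  rw [hc] at e₂ e₃ e₄ e₅
  rw [hd] at e₅
  simp only [← map_mul, ← map_inv] at e₁ e₃ e₄ e₅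
  rw [eq_comm, inv_eq_iff_eq_inv, ← map_mul, ← map_inv] at e₂
  have e₅' := SemidirectProduct.inl_injective e₅
  have key := str_fricke (ρ (gen 0)) (ρ b) (ρ c)
  simp only [← map_mul, ← map_inv] at key
  rw [congrArg (fun x => str (ρ x)) e₅', map_inv ρ d, str_inv, td, tb, tc] at key
  simp only [sqTrace, left_eq_of_eq_inl e₁.symm, left_eq_of_eq_inl e₂, left_eq_of_eq_inl e₃.symm,
    left_eq_of_eq_inl e₄.symm]
  rw [map_inv, str_inv]
  exact key

lemma slopeTrace_left {p₁ q₁ p₂ q₂ : ℕ} (h : p₁ * q₂ = p₂ * q₁ + 1) :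
    slopeTrace ρ (2 * p₁ + p₂) (2 * q₁ + q₂) + slopeTrace ρ p₂ q₂ +
        slopeTrace ρ p₁ q₁ * slopeTrace ρ (p₁ + p₂) (q₁ + q₂) =
      str (ρ (gen 0)) * str (ρ (gen (2 * p₁ + p₂))) +
        str (ρ (gen p₁)) * str (ρ (gen (p₁ + p₂))) := by
  obtain ⟨f, hf⟩ := exists_isFlip h
  have key := sqTrace_add ρ (p₁ := p₁) (q₁ := q₁) (p₂ := p₁ + p₂) (q₂ := q₁ + q₂) hf.left rfl
    (by rw [← glide_add h]; rfl)
  have e₁ : sqTrace ρ (glide p₁ q₁ * (glide p₁ q₁ * glide p₂ q₂)⁻¹) = slopeTrace ρ p₂ q₂ := by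
    rw [slopeTrace, sqTrace, hf.conj_sq_inv, sqTrace]
    have : ∀ x : Hol, x.right = 1 →
        (SemidirectProduct.inl (gen 0) * x * (SemidirectProduct.inl (gen 0))⁻¹ : Hol).left =
          gen 0 * x.left * (gen 0)⁻¹ := by
      intro x hx
      simp [hx]
    rw [this, map_mul, map_mul, map_inv, str_conj]
    simp only [glide, SemidirectProduct.mul_right, twist_mul]
    rw [twist_congr (p' := 0) (q' := 0) (by omega) (by omega)]
    simp
  have e₂ := glide_add (p₁ := p₁) (q₁ := q₁) (p₂ := p₁ + p₂) (q₂ := q₁ + q₂) (by linarith)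
  rw [e₁, ← glide_add h, ← e₂, ← add_assoc, ← add_assoc, ← two_mul, ← two_mul] at key
  exact key

lemma slopeTrace_right {p₁ q₁ p₂ q₂ : ℕ} (h : p₁ * q₂ = p₂ * q₁ + 1) :
    slopeTrace ρ (p₁ + 2 * p₂) (q₁ + 2 * q₂) + slopeTrace ρ p₁ q₁ +
        slopeTrace ρ p₂ q₂ * slopeTrace ρ (p₁ + p₂) (q₁ + q₂) =
      str (ρ (gen 0)) * str (ρ (gen (p₁ + 2 * p₂))) +
        str (ρ (gen (p₁ + p₂))) * str (ρ (gen p₂)) := by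
  obtain ⟨f, hf⟩ := exists_isFlip h
  have key := sqTrace_add ρ (p₁ := p₁ + p₂) (q₁ := q₁ + q₂) (p₂ := p₂) (q₂ := q₂) hf.right
    (by rw [← glide_add h]; rfl) rfl
  have e₂ := glide_add (p₁ := p₁ + p₂) (q₁ := q₁ + q₂) (p₂ := p₂) (q₂ := q₂) (by linarith)
  rw [mul_inv_cancel_right, ← glide_add h, ← e₂, add_assoc p₁, add_assoc q₁, ← two_mul p₂,
    ← two_mul q₂] at key
  rw [← key]
  simp only [slopeTrace]
  ring

lemma slopeTrace_uWord (s : ℚ) (hs : 0 ≤ s) :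
    str (ρ (uWord s)) = slopeTrace ρ s.den s.num.toNat := by
  rw [slopeTrace, sqTrace, ← inl_uWord s hs, SemidirectProduct.left_inl]

end

/-! ### Representations of the Heckoid group in `PSL₂(ℂ)` -/

/-- The subgroup `{1, -1}` of `SL₂(ℂ)`. -/
def signs : Subgroup (Matrix.SpecialLinearGroup (Fin 2) ℂ) where
  carrier := {g | g = 1 ∨ g = -1}
  one_mem' := Or.inl rfl
  mul_mem' := by
    rintro a b (rfl | rfl) (rfl | rfl) <;> simp
  inv_mem' := by
    rintro a (rfl | rfl)
    · simp
    · right; exact inv_eq_of_mul_eq_one_left (by simp)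

instance : signs.Normal where
  conj_mem := by
    rintro a (rfl | rfl) g
    · left; simp
    · right; simp

lemma str_neg (g : Matrix.SpecialLinearGroup (Fin 2) ℂ) : str (-g) = -str g := by
  simp [str]

lemma pow_eq_neg_one {g : Matrix.SpecialLinearGroup (Fin 2) ℂ} {n : ℕ} (hn : 2 ≤ n)
    (hg : str g = 2 * Real.cos (Real.pi / n)) : g ^ n = -1 := by
  set θ := Real.pi / n with hθ
  have hn0 : (0 : ℝ) < n := by positivity
  have hsin : Real.sin θ ≠ 0 := by
    refine (Real.sin_pos_of_pos_of_lt_pi (by positivity) ?_).ne'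
    rw [hθ, div_lt_iff₀ hn0]
    have : (2 : ℝ) ≤ n := by exact_mod_cast hn
    nlinarith [Real.pi_pos]
  have hsq : g.1 * g.1 = (2 * (Real.cos θ : ℂ)) • g.1 - 1 := by
    have hd := Matrix.SpecialLinearGroup.det_coe g
    rw [Matrix.det_fin_two] at hd
    rw [← hg, str, Matrix.trace_fin_two]
    ext i j
    fin_cases i <;> fin_cases j <;>
      simp [Matrix.mul_apply, Fin.sum_univ_two] <;> first
        | linear_combination hd
        | linear_combination -hd
        | ring1
  have key : ∀ k : ℕ, (Real.sin θ : ℂ) • g.1 ^ (k + 1) =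
      (Real.sin ((k + 1) * θ) : ℂ) • g.1 - (Real.sin (k * θ) : ℂ) • 1 := by
    intro k
    induction k with
    | zero => simp
    | succ k ih =>
      rw [pow_succ, ← Matrix.smul_mul, ih, Matrix.sub_mul, Matrix.smul_mul, hsq]
      have : Real.sin ((k + 1 + 1) * θ) =
          2 * Real.cos θ * Real.sin ((k + 1) * θ) - Real.sin (k * θ) := by
        have h1 : ((k : ℝ) + 1 + 1) * θ = (k + 1) * θ + θ := by ring
        have h2 : (k : ℝ) * θ = (k + 1) * θ - θ := by ring
        rw [h1, h2, Real.sin_add, Real.sin_sub]; ring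
      push_cast [this]
      ext i j
      simp
      ring
  obtain ⟨k, rfl⟩ : ∃ k, n = k + 1 := ⟨n - 1, by omega⟩
  have h1 : ((k : ℝ) + 1) * θ = Real.pi := by
    rw [hθ]; push_cast at hn0 ⊢; field_simp
  have h2 : (k : ℝ) * θ = Real.pi - θ := by linarith
  have := key k
  rw [h1, h2, Real.sin_pi, Real.sin_pi_sub] at this
  ext i j
  have h3 := congrFun (congrFun this i) j
  have h4 : (Real.sin θ : ℂ) ≠ 0 := by exact_mod_cast hsin
  simp only [Matrix.smul_apply, Matrix.sub_apply, smul_eq_mul, Complex.ofReal_zero, zero_mul,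
    zero_sub] at h3
  rw [← mul_neg] at h3
  have h5 := mul_left_cancel₀ h4 h3
  simpa using h5

lemma str_eq_or_of_isConj (ρ : F →* Matrix.SpecialLinearGroup (Fin 2) ℂ) {r : ℚ} {n : ℕ}
    (hr : ρ (uWord r) ^ n = -1) {u v : F}
    (h : IsConj (heckQ r n u) (heckQ r n v) ∨ IsConj (heckQ r n u) (heckQ r n v)⁻¹) :
    str (ρ u) = str (ρ v) ∨ str (ρ u) = -str (ρ v) := by
  have hN : heckN r n ≤ signs.comap ρ := by
    refine Subgroup.normalClosure_le_normal ?_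
    rintro _ rfl
    right
    rw [map_pow, hr]
  have main : ∀ v, IsConj (heckQ r n u) (heckQ r n v) →
      str (ρ u) = str (ρ v) ∨ str (ρ u) = -str (ρ v) := by
    intro v h
    obtain ⟨c, hc⟩ := isConj_iff.1 h
    obtain ⟨w, rfl⟩ := QuotientGroup.mk'_surjective _ c
    have hc' : heckQ r n (w * u * w⁻¹) = heckQ r n v := by
      rw [map_mul, map_mul, map_inv]; exact hc
    have := hN (QuotientGroup.eq.1 hc')
    have e := str_conj (ρ w) (ρ u)
    rw [← map_inv, ← map_mul, ← map_mul] at e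
    rcases this with h | h
    · rw [map_mul, map_inv, inv_mul_eq_one] at h
      left; rw [← e, h]
    · rw [map_mul, map_inv, inv_mul_eq_iff_eq_mul, mul_neg_one] at h
      right; rw [← e, h, str_neg, neg_neg]
  rcases h with h | h
  · exact main v h
  · rw [← map_inv] at h
    have := main _ h
    rwa [map_inv, str_inv] at this

/-- The representation sending the generators to matrices with traces `x` and `y` whose product
has trace `-(τ + τ⁻¹)`. -/
noncomputable def rep (x y : ℂ) {τ : ℂ} (hτ : τ ≠ 0) : F →* Matrix.SpecialLinearGroup (Fin 2) ℂ :=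
  FreeGroup.lift ![⟨!![x, -1; 1, 0], by simp [Matrix.det_fin_two]⟩,
    ⟨!![0, -τ; τ⁻¹, y], by simp [Matrix.det_fin_two, hτ]⟩]

section rep

variable (x y : ℂ) {τ : ℂ} (hτ : τ ≠ 0)

lemma str_rep_gen (i : ℕ) : str (rep x y hτ (gen i)) = if Even i then x else y := by
  rcases Nat.even_or_odd i with h | h
  · have h' := Nat.even_iff.1 h
    simp [str, rep, gen, h, h', Matrix.trace_fin_two]
  · have h' := Nat.odd_iff.1 h
    simp [str, rep, gen, Nat.not_even_iff_odd.2 h, h', Matrix.trace_fin_two]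

lemma str_rep_mul : str (rep x y hτ (gen 0 * gen 1)) = -(τ + τ⁻¹) := by
  have h₀ : (rep x y hτ (gen 0)).1 = !![x, -1; 1, 0] := by simp [rep, gen]
  have h₁ : (rep x y hτ (gen 1)).1 = !![0, -τ; τ⁻¹, y] := by simp [rep, gen]
  rw [map_mul, str, Matrix.SpecialLinearGroup.coe_mul, h₀, h₁]
  simp [Matrix.trace_fin_two]

lemma slopeTrace_zero_one : slopeTrace (rep x y hτ) 0 1 = 2 := by
  simp [slopeTrace, sqTrace, glide, halfWord, str]

lemma slopeTrace_one_zero : slopeTrace (rep x y hτ) 1 0 = -(τ + τ⁻¹) := by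
  rw [← str_rep_mul x y hτ]
  simp [slopeTrace, sqTrace, glide, halfWord, letter, swapGen_gen]

lemma slopeTrace_one_one : slopeTrace (rep x y hτ) 1 1 = x * y + (τ + τ⁻¹) := by
  have h := str_mul_add (rep x y hτ (gen 0)) (rep x y hτ (gen 1))
  rw [← map_mul, str_rep_mul, str_rep_gen, str_rep_gen] at h
  have : slopeTrace (rep x y hτ) 1 1 = str (rep x y hτ (gen 0) * (rep x y hτ (gen 1))⁻¹) := by
    simp [slopeTrace, sqTrace, glide, halfWord, letter, swapGen_gen, invGen_gen]
  simp at h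
  rw [this]
  linear_combination h

end rep

/-- `τ ^ p + τ ^ (-p)`. -/
noncomputable def tw (τ : ℂ) (p : ℕ) : ℂ := τ ^ p + (τ⁻¹) ^ p

lemma tw_mul {τ : ℂ} (hτ : τ ≠ 0) (p : ℕ) : tw τ 1 * tw τ (p + 1) = tw τ (p + 2) + tw τ p := by
  have := mul_inv_cancel₀ hτ
  simp only [tw]
  linear_combination (τ ^ p + τ⁻¹ ^ p) * this

/-- The trace of the word of slope `1 / o`, where `{o, e} = {m, m + 1}`. -/
noncomputable def pivot (o e : ℕ) (c τ K : ℂ) : ℂ :=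
  (2 * (tw τ o - tw τ 1) + (c + tw τ 1) / K) / (2 - tw τ e)

/-- The inhomogeneous terms of the trace recursion. -/
noncomputable def source (o e : ℕ) (c τ K : ℂ) (p : ℕ) : ℂ :=
  if Even p then 4 - tw τ 1 * pivot o e c τ K + K * (tw τ 1 * tw τ o - 4)
  else 2 * pivot o e c τ K - 2 * tw τ 1 - 2 * K * (tw τ o - tw τ 1)

/-- `φ p q` behaves like the trace of the word of slope `q / p` under a representation of the
Heckoid group of slope `2 / (2 m + 1)` and index `n`, where `{o, e} = {m, m + 1}`. -/
structure IsTraceFun (o e n : ℕ) (τ K : ℂ) (φ : ℕ → ℕ → ℂ) : Prop where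
  left : ∀ {p₁ q₁ p₂ q₂ : ℕ}, p₁ * q₂ = p₂ * q₁ + 1 →
    φ (2 * p₁ + p₂) (2 * q₁ + q₂) = source o e (2 * Real.cos (Real.pi / n)) τ K p₂ - φ p₂ q₂ -
      φ p₁ q₁ * φ (p₁ + p₂) (q₁ + q₂)
  right : ∀ {p₁ q₁ p₂ q₂ : ℕ}, p₁ * q₂ = p₂ * q₁ + 1 →
    φ (p₁ + 2 * p₂) (q₁ + 2 * q₂) = source o e (2 * Real.cos (Real.pi / n)) τ K p₁ - φ p₁ q₁ -
      φ p₂ q₂ * φ (p₁ + p₂) (q₁ + q₂)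
  infinity : φ 1 0 = -tw τ 1
  integral : ∀ p, φ p 1 = if Even p then 2 + K * (tw τ p - 2)
    else pivot o e (2 * Real.cos (Real.pi / n)) τ K + K * (tw τ p - tw τ o)
  relator : φ (o + e) 2 = 2 * Real.cos (Real.pi / n)

lemma exists_isTraceFun {o e n : ℕ} (hn : 2 ≤ n) (ho : Odd o) (he : Even e)
    (hoe : e = o + 1 ∨ o = e + 1) {τ K : ℂ} (hτ : τ ≠ 0) (hK : K ≠ 0) (hT : tw τ e ≠ 2) :
    ∃ φ, IsTraceFun o e n τ K φ ∧ ∀ s s' : ℚ, 0 ≤ s → 0 ≤ s' →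
      (IsConj (heckQ (2 / (o + e)) n (uWord s)) (heckQ (2 / (o + e)) n (uWord s')) ∨
        IsConj (heckQ (2 / (o + e)) n (uWord s)) (heckQ (2 / (o + e)) n (uWord s'))⁻¹) →
      φ s.den s.num.toNat = φ s'.den s'.num.toNat ∨
        φ s.den s.num.toNat = -φ s'.den s'.num.toNat := by
  set c : ℂ := 2 * Real.cos (Real.pi / n) with hc
  set f := pivot o e c τ K with hf
  set C := source o e c τ K with hC
  have hT' : 2 - tw τ e ≠ 0 := sub_ne_zero.2 hT.symm
  have hf' : f * (2 - tw τ e) * K = 2 * (tw τ o - tw τ 1) * K + (c + tw τ 1) := by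
    rw [hf, pivot]; field_simp
  obtain ⟨u, hu⟩ := IsAlgClosed.exists_pow_nat_eq (C 0 + C 1) (n := 2) (by norm_num)
  obtain ⟨v, hv⟩ := IsAlgClosed.exists_pow_nat_eq (C 0 - C 1) (n := 2) (by norm_num)
  set x := (u + v) / 2 with hx
  set y := (u - v) / 2 with hy
  have hxy : x * x + y * y = C 0 := by rw [hx, hy]; linear_combination (hu + hv) / 2
  have hxy' : 2 * (x * y) = C 1 := by rw [hx, hy]; linear_combination (hu - hv) / 2
  have hC0 : ∀ p, Even p → C p = 4 - tw τ 1 * f + K * (tw τ 1 * tw τ o - 4) := fun p hp => by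
    simp only [hC, source, hp, if_true, hf]
  have hC1 : ∀ p, ¬ Even p → C p = 2 * f - 2 * tw τ 1 - 2 * K * (tw τ o - tw τ 1) := fun p hp => by
    simp only [hC, source, hp, if_false, hf]
  have hCC : ∀ p, C p = if Even p then C 0 else C 1 := fun p => by
    split_ifs with h
    · rw [hC0 p h, hC0 0 (by simp)]
    · rw [hC1 p h, hC1 1 (by simp)]
  set ρ := rep x y hτ
  have hroot : slopeTrace ρ 1 0 = -tw τ 1 := by rw [slopeTrace_one_zero, tw, pow_one, pow_one]
  have hleft : ∀ {p₁ q₁ p₂ q₂ : ℕ}, p₁ * q₂ = p₂ * q₁ + 1 →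
      slopeTrace ρ (2 * p₁ + p₂) (2 * q₁ + q₂) = C p₂ - slopeTrace ρ p₂ q₂ -
        slopeTrace ρ p₁ q₁ * slopeTrace ρ (p₁ + p₂) (q₁ + q₂) := by
    intro p₁ q₁ p₂ q₂ h
    have key := slopeTrace_left ρ h
    have hpar : Even p₂ → ¬ Even p₁ := fun h₂ h₁ => by
      have : Even (p₁ * q₂) := h₁.mul_right _
      rw [h, Nat.even_add_one] at this
      exact this (h₂.mul_right _)
    suffices h' : str (ρ (gen 0)) * str (ρ (gen (2 * p₁ + p₂))) +
        str (ρ (gen p₁)) * str (ρ (gen (p₁ + p₂))) = C p₂ by linear_combination key + h'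
    rw [hCC, ← hxy, ← hxy']
    simp only [ρ, str_rep_gen]
    by_cases h₁ : Even p₁ <;> by_cases h₂ : Even p₂ <;>
      simp [h₁, h₂, Nat.even_add] at hpar ⊢ <;> ring
  have hright : ∀ {p₁ q₁ p₂ q₂ : ℕ}, p₁ * q₂ = p₂ * q₁ + 1 →
      slopeTrace ρ (p₁ + 2 * p₂) (q₁ + 2 * q₂) = C p₁ - slopeTrace ρ p₁ q₁ -
        slopeTrace ρ p₂ q₂ * slopeTrace ρ (p₁ + p₂) (q₁ + q₂) := by
    intro p₁ q₁ p₂ q₂ h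
    have key := slopeTrace_right ρ h
    have hpar : Even p₂ → ¬ Even p₁ := fun h₂ h₁ => by
      have : Even (p₁ * q₂) := h₁.mul_right _
      rw [h, Nat.even_add_one] at this
      exact this (h₂.mul_right _)
    suffices h' : str (ρ (gen 0)) * str (ρ (gen (p₁ + 2 * p₂))) +
        str (ρ (gen (p₁ + p₂))) * str (ρ (gen p₂)) = C p₁ by linear_combination key + h'
    rw [hCC, ← hxy, ← hxy']
    simp only [ρ, str_rep_gen]
    by_cases h₁ : Even p₁ <;> by_cases h₂ : Even p₂ <;>
      simp [h₁, h₂, Nat.even_add] at hpar ⊢ <;> ring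
  have hint : ∀ p, slopeTrace ρ p 1 =
      if Even p then 2 + K * (tw τ p - 2) else f + K * (tw τ p - tw τ o) := by
    intro p
    induction p using Nat.twoStepInduction with
    | zero => rw [slopeTrace_zero_one]; simp [tw]; norm_num
    | one =>
      have e : tw τ 1 = τ + τ⁻¹ := by simp [tw]
      have := hC1 1 (by simp)
      rw [slopeTrace_one_one, ← e]
      simp
      linear_combination (hxy' + this) / 2
    | more p ih₁ ih₂ =>
      have := hleft (p₁ := 1) (q₁ := 0) (p₂ := p) (q₂ := 1) (by ring)
      rw [show p + 2 = 2 * 1 + p by ring]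
      simp only [mul_zero, zero_add] at this
      have ht := tw_mul hτ p
      rw [this, add_comm 1 p, ih₁, ih₂, hroot]
      rw [show 2 * 1 + p = p + 2 by ring]
      by_cases hp : Even p
      · have hp' : ¬ Even (p + 1) := by rwa [Nat.even_add_one, not_not]
        have hp'' : Even (p + 2) := by rwa [Nat.even_add_one]
        rw [if_pos hp, if_neg hp', if_pos hp'', hC0 p hp]
        linear_combination K * ht
      · have hp' : Even (p + 1) := by rwa [Nat.even_add_one]
        have hp'' : ¬ Even (p + 2) := by rwa [Nat.even_add_one, not_not]
        rw [if_neg hp, if_pos hp', if_neg hp'', hC1 p hp]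
        linear_combination K * ht
  have hrel : slopeTrace ρ (o + e) 2 = c := by
    have ho' : ¬ Even o := Nat.not_even_iff_odd.2 ho
    have ho'' := hint o
    have he'' := hint e
    have h1 := hC1 1 (by simp)
    rw [if_neg ho', sub_self, mul_zero, add_zero] at ho''
    rw [if_pos he] at he''
    rcases hoe with h | h
    · have := hright (p₁ := 1) (q₁ := 0) (p₂ := o) (q₂ := 1) (by ring)
      rw [show o + e = 1 + 2 * o by omega]
      simp only [mul_one, zero_add] at this
      rw [this, hroot, show 1 + o = e by omega, ho'', he'']
      linear_combination h1 + hf'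
    · have := hright (p₁ := 1) (q₁ := 0) (p₂ := e) (q₂ := 1) (by ring)
      rw [show o + e = 1 + 2 * e by omega]
      simp only [mul_one, zero_add] at this
      rw [this, hroot, show 1 + e = o by omega, ho'', he'']
      linear_combination h1 + hf'
  refine ⟨slopeTrace ρ, ⟨hleft, hright, hroot, hint, hrel⟩, fun s s' hs hs' h => ?_⟩
  rw [← slopeTrace_uWord ρ s hs, ← slopeTrace_uWord ρ s' hs']
  refine str_eq_or_of_isConj ρ ?_ h
  refine pow_eq_neg_one hn ?_
  rw [slopeTrace_uWord ρ _ (by positivity), ← hc, ← hrel]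
  have hodd : Odd (o + e) := ho.add_even he
  have hcop : Nat.Coprime 2 (o + e) := Nat.coprime_two_left.2 hodd
  have hcast : (2 / (o + e) : ℚ) = ((2 : ℤ) : ℚ) / ((o + e : ℕ) : ℤ) := by push_cast; rfl
  have hpos : 0 < ((o + e : ℕ) : ℤ) := by exact_mod_cast hodd.pos
  congr 1
  · have := Rat.den_div_eq_of_coprime hpos (a := 2) hcop
    rw [hcast]
    exact_mod_cast this
  · have := Rat.num_div_eq_of_coprime hpos (a := 2) hcop
    rw [hcast, this]
    rfl

section

open Filter Topology

/-! ### Leading terms -/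

/-- The comparison function `e ^ (g t) t ^ h`. -/
noncomputable def scale (g h : ℤ) (t : ℝ) : ℂ := ((Real.exp (g * t) * t ^ h : ℝ) : ℂ)

/-- `x t ~ a e ^ (g t) t ^ h` as `t → ∞`; the coefficient `a` is allowed to vanish. -/
def Lead (g h : ℤ) (a : ℂ) (x : ℝ → ℂ) : Prop :=
  Tendsto (fun t => x t / scale g h t) atTop (𝓝 a)

lemma scale_ne_zero (g h : ℤ) {t : ℝ} (ht : 0 < t) : scale g h t ≠ 0 := by
  unfold scale
  exact_mod_cast (by positivity : Real.exp (g * t) * t ^ h ≠ 0)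

lemma scale_add (g h g' h' : ℤ) {t : ℝ} (ht : 0 < t) :
    scale (g + g') (h + h') t = scale g h t * scale g' h' t := by
  unfold scale
  rw [← Complex.ofReal_mul]
  congr 1
  rw [Int.cast_add, add_mul, Real.exp_add, zpow_add₀ ht.ne']
  ring

lemma tendsto_scale {g h : ℤ} (hgh : g < 0 ∨ g = 0 ∧ h < 0) :
    Tendsto (scale g h) atTop (𝓝 0) := by
  unfold scale
  rw [← Complex.ofReal_zero]
  refine (Complex.continuous_ofReal.tendsto 0).comp ?_
  rcases hgh with hg | ⟨rfl, hh⟩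
  · have h₁ := tendsto_rpow_mul_exp_neg_mul_atTop_nhds_zero (h : ℝ) (-g : ℝ)
      (by exact_mod_cast (by omega : 0 < -g))
    refine h₁.congr' ?_
    filter_upwards [eventually_gt_atTop 0] with t ht
    rw [Real.rpow_intCast, mul_comm]
    congr 2
    ring
  · simp only [Int.cast_zero, zero_mul, Real.exp_zero, one_mul]
    have := tendsto_rpow_neg_atTop (y := (-h : ℝ)) (by exact_mod_cast (by omega : 0 < -h))
    refine this.congr' ?_
    filter_upwards [eventually_gt_atTop 0] with t ht
    rw [neg_neg, Real.rpow_intCast]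

namespace Lead

variable {g h g' h' : ℤ} {a a' : ℂ} {x y : ℝ → ℂ}

lemma congr (hx : Lead g h a x) (hxy : ∀ᶠ t in atTop, x t = y t) : Lead g h a y :=
  Tendsto.congr' (hxy.mono fun t ht => by rw [ht]) hx

lemma cast (hx : Lead g h a x) (hg : g = g') (hh : h = h') (ha : a = a') : Lead g' h' a' x := by
  subst hg hh ha; exact hx

lemma const (a : ℂ) : Lead 0 0 a fun _ => a := by
  simp [Lead, scale]

lemma add (hx : Lead g h a x) (hy : Lead g h a' y) : Lead g h (a + a') fun t => x t + y t := by
  simpa only [Lead, add_div] using Tendsto.add hx hy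

lemma sub (hx : Lead g h a x) (hy : Lead g h a' y) : Lead g h (a - a') fun t => x t - y t := by
  simpa only [Lead, sub_div] using Tendsto.sub hx hy

lemma neg (hx : Lead g h a x) : Lead g h (-a) fun t => -x t := by
  simpa only [Lead, neg_div] using Tendsto.neg hx

lemma mul (hx : Lead g h a x) (hy : Lead g' h' a' y) :
    Lead (g + g') (h + h') (a * a') fun t => x t * y t := by
  refine Tendsto.congr' ?_ (Tendsto.mul hx hy)
  filter_upwards [eventually_gt_atTop 0] with t ht
  rw [scale_add _ _ _ _ ht, mul_div_mul_comm]

lemma const_mul (b : ℂ) (hx : Lead g h a x) : Lead g h (b * a) fun t => b * x t :=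
  ((const b).mul hx).cast (by ring) (by ring) rfl

lemma inv (hx : Lead g h a x) (ha : a ≠ 0) : Lead (-g) (-h) a⁻¹ fun t => (x t)⁻¹ := by
  refine Tendsto.congr' ?_ (Tendsto.inv₀ hx ha)
  filter_upwards [eventually_gt_atTop 0] with t ht
  have e : scale g h t * scale (-g) (-h) t = 1 := by
    rw [← scale_add _ _ _ _ ht]; simp [scale]
  rw [inv_div, eq_inv_of_mul_eq_one_left e]
  field_simp

lemma div (hx : Lead g h a x) (hy : Lead g' h' a' y) (ha : a' ≠ 0) :
    Lead (g - g') (h - h') (a / a') fun t => x t / y t := by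
  simpa only [div_eq_mul_inv, sub_eq_add_neg] using hx.mul (hy.inv ha)

lemma weaken (hx : Lead g h a x) (hlt : g < g' ∨ g = g' ∧ h < h') : Lead g' h' 0 x := by
  have h₁ : Tendsto (scale (g - g') (h - h')) atTop (𝓝 0) := tendsto_scale (by omega)
  have h₂ := Tendsto.mul hx h₁
  rw [mul_zero] at h₂
  refine Tendsto.congr' ?_ h₂
  filter_upwards [eventually_gt_atTop 0] with t ht
  have e := scale_add (g - g') (h - h') g' h' ht
  rw [sub_add_cancel, sub_add_cancel] at e
  have h₃ := scale_ne_zero g' h' ht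
  have h₄ := scale_ne_zero (g - g') (h - h') ht
  rw [e]
  field_simp

lemma add_small (hx : Lead g h a x) (hy : Lead g h 0 y) : Lead g h a fun t => x t + y t :=
  (hx.add hy).cast rfl rfl (add_zero a)

lemma small_add (hx : Lead g h 0 x) (hy : Lead g h a y) : Lead g h a fun t => x t + y t :=
  (hx.add hy).cast rfl rfl (zero_add a)

lemma sub_small (hx : Lead g h a x) (hy : Lead g h 0 y) : Lead g h a fun t => x t - y t :=
  (hx.sub hy).cast rfl rfl (sub_zero a)

lemma eventually_ne_zero (hx : Lead g h a x) (ha : a ≠ 0) : ∀ᶠ t in atTop, x t ≠ 0 := by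
  filter_upwards [Tendsto.eventually_ne hx ha] with t ht h0
  rw [h0, zero_div] at ht
  exact ht rfl

lemma norm_eq (hx : Lead g h a x) (hy : Lead g h a' y)
    (hxy : ∀ᶠ t in atTop, x t = y t ∨ x t = -y t) : ‖a‖ = ‖a'‖ := by
  refine tendsto_nhds_unique (Tendsto.norm hx) ((Tendsto.norm hy).congr' ?_)
  filter_upwards [hxy] with t ht
  rcases ht with ht | ht <;> simp [ht]

lemma eq_zero_of_lt (hx : Lead g h a x) (hy : Lead g' h' a' y)
    (hxy : ∀ᶠ t in atTop, x t = y t ∨ x t = -y t) (hlt : g' < g ∨ g' = g ∧ h' < h) : a = 0 := by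
  simpa using hx.norm_eq (hy.weaken hlt) hxy

lemma eq_of_eq_or_neg (hx : Lead g h a x) (ha : a ≠ 0) (hy : Lead g' h' a' y) (ha' : a' ≠ 0)
    (hxy : ∀ᶠ t in atTop, x t = y t ∨ x t = -y t) : g = g' ∧ h = h' ∧ ‖a‖ = ‖a'‖ := by
  have h₁ : ¬ (g' < g ∨ g' = g ∧ h' < h) := fun hlt => ha (hx.eq_zero_of_lt hy hxy hlt)
  have h₂ : ¬ (g < g' ∨ g = g' ∧ h < h') := fun hlt => ha' (hy.eq_zero_of_lt hx
    (hxy.mono fun t ht => ht.imp Eq.symm fun e => by rw [e, neg_neg]) hlt)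
  obtain ⟨rfl, rfl⟩ : g = g' ∧ h = h' := by omega
  exact ⟨rfl, rfl, hx.norm_eq hy hxy⟩

end Lead

/-! ### Propagation along cones -/

section cone

variable {o e n : ℕ} {τ K : ℝ → ℂ} {φ : ℝ → ℕ → ℕ → ℂ}

/-- The source terms are negligible with respect to `e ^ (g t) t ^ h`. -/
def SmallSource (o e n : ℕ) (τ K : ℝ → ℂ) (g h : ℤ) : Prop :=
  ∀ p, Lead g h 0 fun t => source o e (2 * Real.cos (Real.pi / n)) (τ t) (K t) p

lemma SmallSource.mono {g h g' h' : ℤ} (H : SmallSource o e n τ K g h)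
    (hle : g < g' ∨ g = g' ∧ h ≤ h') : SmallSource o e n τ K g' h' := fun p => by
  rcases (by omega : (g < g' ∨ g = g' ∧ h < h') ∨ (g = g' ∧ h = h')) with h' | ⟨rfl, rfl⟩
  · exact (H p).weaken h'
  · exact H p

lemma exists_lead_of_mediant (H : ∀ᶠ t in atTop, IsTraceFun o e n (τ t) (K t) (φ t)) :
    ∀ {i j : ℕ}, i.Coprime j → 1 ≤ i → 1 ≤ j → ∀ {p₁ q₁ p₂ q₂ : ℕ} {g₁ h₁ g₂ h₂ : ℤ} {a₁ a₂ a : ℂ},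
    p₁ * q₂ = p₂ * q₁ + 1 → (0 < g₁ ∨ 0 = g₁ ∧ 0 < h₁) → (0 < g₂ ∨ 0 = g₂ ∧ 0 < h₂) →
    Lead g₁ h₁ a₁ (fun t => φ t p₁ q₁) → Lead g₂ h₂ a₂ (fun t => φ t p₂ q₂) →
    Lead (g₁ + g₂) (h₁ + h₂) a (fun t => φ t (p₁ + p₂) (q₁ + q₂)) → ‖a‖ = ‖a₁‖ * ‖a₂‖ →
    SmallSource o e n τ K (g₁ + g₂) (h₁ + h₂) →
    ∃ b, ‖b‖ = ‖a₁‖ ^ i * ‖a₂‖ ^ j ∧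
      Lead (i * g₁ + j * g₂) (i * h₁ + j * h₂) b
        fun t => φ t (i * p₁ + j * p₂) (i * q₁ + j * q₂) := by
  suffices ∀ N i j : ℕ, i + j ≤ N → i.Coprime j → 1 ≤ i → 1 ≤ j →
      ∀ {p₁ q₁ p₂ q₂ : ℕ} {g₁ h₁ g₂ h₂ : ℤ} {a₁ a₂ a : ℂ},
      p₁ * q₂ = p₂ * q₁ + 1 → (0 < g₁ ∨ 0 = g₁ ∧ 0 < h₁) → (0 < g₂ ∨ 0 = g₂ ∧ 0 < h₂) →
      Lead g₁ h₁ a₁ (fun t => φ t p₁ q₁) → Lead g₂ h₂ a₂ (fun t => φ t p₂ q₂) →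
      Lead (g₁ + g₂) (h₁ + h₂) a (fun t => φ t (p₁ + p₂) (q₁ + q₂)) → ‖a‖ = ‖a₁‖ * ‖a₂‖ →
      SmallSource o e n τ K (g₁ + g₂) (h₁ + h₂) →
      ∃ b, ‖b‖ = ‖a₁‖ ^ i * ‖a₂‖ ^ j ∧
        Lead (i * g₁ + j * g₂) (i * h₁ + j * h₂) b
          fun t => φ t (i * p₁ + j * p₂) (i * q₁ + j * q₂) from
    fun {i j} hij hi hj => this _ i j le_rfl hij hi hj
  intro N
  induction N with
  | zero => intro i j hN _ hi; omega
  | succ N ih =>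
    intro i j hN hij hi hj p₁ q₁ p₂ q₂ g₁ h₁ g₂ h₂ a₁ a₂ a hd hγ₁ hγ₂ L₁ L₂ L hn hC
    rcases lt_trichotomy i j with hlt | rfl | hlt
    · obtain ⟨k, rfl⟩ := exists_add_of_le hlt.le
      have hd' : (p₁ + p₂) * q₂ = p₂ * (q₁ + q₂) + 1 := by linarith
      have L' : Lead (g₁ + g₂ + g₂) (h₁ + h₂ + h₂) (-(a₂ * a))
          fun t => φ t (p₁ + p₂ + p₂) (q₁ + q₂ + q₂) := by
        have h := (((hC p₁).weaken (g' := g₂ + (g₁ + g₂)) (h' := h₂ + (h₁ + h₂))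
          (by omega)).sub (L₁.weaken (by omega))).sub (L₂.mul L)
        refine (h.cast (by ring) (by ring) (by ring)).congr (H.mono fun t ht => ?_)
        rw [← ht.right hd]
        congr 1 <;> ring
      obtain ⟨b, hb, Lb⟩ := ih i k (by omega) (by simpa using hij) hi (by omega) hd' (by omega) hγ₂
        L L₂ L' (by rw [norm_neg, norm_mul, mul_comm]) (hC.mono (by omega))
      refine ⟨b, by rw [hb, hn]; ring, ?_⟩
      have e₁ : ∀ u v : ℕ, i * (u + v) + k * v = i * u + (i + k) * v := fun u v => by ring
      have e₂ : ∀ u v : ℤ, i * (u + v) + k * v = i * u + (i + k : ℕ) * v := fun u v => by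
        push_cast; ring
      rw [e₁, e₁, e₂, e₂] at Lb
      exact Lb
    · obtain rfl : i = 1 := by simpa using hij
      exact ⟨a, by simpa using hn, by simpa using L⟩
    · obtain ⟨k, rfl⟩ := exists_add_of_le hlt.le
      have hd' : p₁ * (q₁ + q₂) = (p₁ + p₂) * q₁ + 1 := by linarith
      have L' : Lead (g₁ + (g₁ + g₂)) (h₁ + (h₁ + h₂)) (-(a₁ * a))
          fun t => φ t (p₁ + (p₁ + p₂)) (q₁ + (q₁ + q₂)) := by
        have h := (((hC p₂).weaken (g' := g₁ + (g₁ + g₂)) (h' := h₁ + (h₁ + h₂))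
          (by omega)).sub (L₂.weaken (by omega))).sub (L₁.mul L)
        refine (h.cast (by ring) (by ring) (by ring)).congr (H.mono fun t ht => ?_)
        rw [← ht.left hd]
        congr 1 <;> ring
      obtain ⟨b, hb, Lb⟩ := ih k j (by omega)
        (by simpa [Nat.coprime_add_self_left, add_comm] using hij)
        (by omega) hj hd' hγ₁ (by omega) L₁ L L'
        (by rw [norm_neg, norm_mul]) (hC.mono (by omega))
      refine ⟨b, by rw [hb, hn]; ring, ?_⟩
      have e₁ : ∀ u v : ℕ, k * u + j * (u + v) = (j + k) * u + j * v := fun u v => by ring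
      have e₂ : ∀ u v : ℤ, k * u + j * (u + v) = (j + k : ℕ) * u + j * v := fun u v => by
        push_cast; ring
      rw [e₁, e₁, e₂, e₂] at Lb
      exact Lb

end cone

/-! ### Families of trace functions -/

/-- The conjugacy of two simple loops, as seen by the traces: `φ P q = ± φ P' q'` for some
trace function with prescribed parameters. -/
def TraceEq (o e n P q P' q' : ℕ) : Prop :=
  ∀ τ K : ℂ, τ ≠ 0 → K ≠ 0 → tw τ e ≠ 2 →
    ∃ φ, IsTraceFun o e n τ K φ ∧ (φ P q = φ P' q' ∨ φ P q = -φ P' q')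

lemma TraceEq.symm {o e n P q P' q' : ℕ} (h : TraceEq o e n P q P' q') :
    TraceEq o e n P' q' P q := fun τ K hτ hK hT => by
  obtain ⟨φ, hφ, h'⟩ := h τ K hτ hK hT
  exact ⟨φ, hφ, h'.imp Eq.symm fun e => by rw [e, neg_neg]⟩

/-- A one-parameter family of trace functions. -/
def Fam (o e n : ℕ) (τ K : ℝ → ℂ) (φ : ℝ → ℕ → ℕ → ℂ) : Prop :=
  ∀ᶠ t in atTop, IsTraceFun o e n (τ t) (K t) (φ t)

lemma TraceEq.exists_fam {o e n P q P' q' : ℕ} (h : TraceEq o e n P q P' q') {τ K : ℝ → ℂ}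
    (hτ : ∀ᶠ t in atTop, τ t ≠ 0) (hK : ∀ᶠ t in atTop, K t ≠ 0)
    (hT : ∀ᶠ t in atTop, tw (τ t) e ≠ 2) :
    ∃ φ, Fam o e n τ K φ ∧ ∀ᶠ t in atTop, φ t P q = φ t P' q' ∨ φ t P q = -φ t P' q' := by
  choose! φ hφ using fun (t : ℝ) (ht : τ t ≠ 0 ∧ K t ≠ 0 ∧ tw (τ t) e ≠ 2) =>
    h (τ t) (K t) ht.1 ht.2.1 ht.2.2
  refine ⟨φ, ?_, ?_⟩ <;> filter_upwards [hτ, hK, hT] with t h₁ h₂ h₃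
  exacts [(hφ t ⟨h₁, h₂, h₃⟩).1, (hφ t ⟨h₁, h₂, h₃⟩).2]

/-- `x` has a leading term of the given order whose coefficient has norm `ν`. -/
def HasLead (g h : ℤ) (ν : ℝ) (x : ℝ → ℂ) : Prop := ∃ b, ‖b‖ = ν ∧ Lead g h b x

lemma Lead.hasLead {g h : ℤ} {a : ℂ} {x : ℝ → ℂ} (hx : Lead g h a x) : HasLead g h ‖a‖ x :=
  ⟨a, rfl, hx⟩

namespace HasLead

variable {g h g' h' : ℤ} {ν ν' : ℝ} {x y : ℝ → ℂ}

lemma eq_of_eq_or_neg (hx : HasLead g h ν x) (hν : ν ≠ 0) (hy : HasLead g' h' ν' y) (hν' : ν' ≠ 0)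
    (hxy : ∀ᶠ t in atTop, x t = y t ∨ x t = -y t) : g = g' ∧ h = h' ∧ ν = ν' := by
  obtain ⟨a, rfl, ha⟩ := hx
  obtain ⟨a', rfl, ha'⟩ := hy
  exact ha.eq_of_eq_or_neg (norm_ne_zero_iff.1 hν) ha' (norm_ne_zero_iff.1 hν') hxy

lemma lead_zero (hx : HasLead g h 0 x) : Lead g h 0 x := by
  obtain ⟨a, ha, hx⟩ := hx
  rwa [norm_eq_zero.1 ha] at hx

lemma cast (hx : HasLead g h ν x) (hg : g = g') (hh : h = h') (hν : ν = ν') :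
    HasLead g' h' ν' x := by
  subst hg hh hν; exact hx

end HasLead

lemma source_of_even {o e : ℕ} {c τ K : ℂ} {p : ℕ} (hp : Even p) :
    source o e c τ K p = source o e c τ K 0 := by simp [source, hp]

lemma source_of_odd {o e : ℕ} {c τ K : ℂ} {p : ℕ} (hp : Odd p) :
    source o e c τ K p = source o e c τ K 1 := by
  simp [source, Nat.not_even_iff_odd.2 hp]

/-- `2 cos (π / n)`. -/
noncomputable def relTrace (n : ℕ) : ℂ := 2 * Real.cos (Real.pi / n)

section

variable {o e n : ℕ} {τ K : ℝ → ℂ} {g h : ℤ} {a a₀ a₁ a₂ : ℂ}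

lemma smallSource_of_lead (h₀ : Lead g h 0 fun t => source o e (relTrace n) (τ t) (K t) 0)
    (h₁ : Lead g h 0 fun t => source o e (relTrace n) (τ t) (K t) 1) :
    SmallSource o e n τ K g h := fun p => by
  rcases Nat.even_or_odd p with hp | hp
  · simp only [source_of_even hp]
    exact h₀
  · simp only [source_of_odd hp]
    exact h₁

end

/-- The sequence `0, 0, 1, -c, …` with `t_k + c t_{k+1} + t_{k+2}` alternately `1` and `0`. -/
def hat (c : ℂ) : ℕ → ℂ
  | 0 => 0
  | 1 => 0
  | k + 2 => (if Even k then 1 else 0) - c * hat c (k + 1) - hat c k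

lemma hat_formula {n : ℕ} (hn : 2 ≤ n) (k : ℕ) :
    hat (relTrace n) (2 * k) =
        (Real.sin (k * (Real.pi / n)) ^ 2 / Real.sin (Real.pi / n) ^ 2 : ℝ) ∧
      hat (relTrace n) (2 * k + 1) = (-(Real.sin ((k + 1 : ℕ) * (Real.pi / n)) *
        Real.sin (k * (Real.pi / n))) / Real.sin (Real.pi / n) ^ 2 : ℝ) := by
  have hs : Real.sin (Real.pi / n) ≠ 0 := by
    refine (Real.sin_pos_of_pos_of_lt_pi (by positivity) ?_).ne'
    exact div_lt_self Real.pi_pos (by exact_mod_cast hn)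
  have hcs := Real.sin_sq_add_cos_sq (Real.pi / n)
  have hadd : ∀ j : ℕ, Real.sin ((j + 1 : ℕ) * (Real.pi / n)) =
      Real.sin (j * (Real.pi / n)) * Real.cos (Real.pi / n) +
        Real.cos (j * (Real.pi / n)) * Real.sin (Real.pi / n) := fun j => by
    rw [← Real.sin_add]; congr 1; push_cast; ring
  have hadd' : ∀ j : ℕ, Real.cos ((j + 1 : ℕ) * (Real.pi / n)) =
      Real.cos (j * (Real.pi / n)) * Real.cos (Real.pi / n) -
        Real.sin (j * (Real.pi / n)) * Real.sin (Real.pi / n) := fun j => by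
    rw [← Real.cos_add]; congr 1; push_cast; ring
  induction k with
  | zero => simp [hat]
  | succ k ih =>
    have h₁ : hat (relTrace n) (2 * (k + 1)) =
        (Real.sin ((k + 1 : ℕ) * (Real.pi / n)) ^ 2 / Real.sin (Real.pi / n) ^ 2 : ℝ) := by
      rw [show 2 * (k + 1) = 2 * k + 2 by ring, hat, if_pos (even_two_mul k), ih.1, ih.2, relTrace]
      norm_cast
      have := Real.sin_sq_add_cos_sq (k * (Real.pi / n))
      rw [hadd]
      generalize Real.sin (k * (Real.pi / n)) = S at *
      generalize Real.cos (k * (Real.pi / n)) = C at *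
      field_simp
      linear_combination (-Real.sin (Real.pi / n) ^ 2) * this +
        S ^ 2 * hcs
    refine ⟨h₁, ?_⟩
    rw [show 2 * (k + 1) + 1 = (2 * k + 1) + 2 by ring, hat,
      if_neg (by simp), show 2 * k + 1 + 1 = 2 * (k + 1) by ring,
      h₁, ih.2, relTrace]
    norm_cast
    rw [hadd (k + 1), hadd', hadd]
    generalize Real.sin (k * (Real.pi / n)) = S at *
    generalize Real.cos (k * (Real.pi / n)) = C at *
    field_simp
    linear_combination (-(S * Real.cos (Real.pi / n) + C * Real.sin (Real.pi / n)) * S) * hcs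

lemma hat_ne_zero {n k : ℕ} (hk : 2 ≤ k) (hkn : k + 2 ≤ 2 * n) : hat (relTrace n) k ≠ 0 := by
  have hn : 2 ≤ n := by omega
  have hs : ∀ j : ℕ, 1 ≤ j → j < n → Real.sin (j * (Real.pi / n)) ≠ 0 := fun j h₁ h₂ => by
    refine (Real.sin_pos_of_pos_of_lt_pi (by positivity) ?_).ne'
    rw [← mul_div_assoc, div_lt_iff₀ (by positivity), mul_comm]
    exact mul_lt_mul_of_pos_left (by exact_mod_cast h₂) Real.pi_pos
  have h₁ : Real.sin (Real.pi / n) ≠ 0 := by simpa using hs 1 le_rfl (by omega)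
  rcases Nat.even_or_odd' k with ⟨j, rfl | rfl⟩
  · rw [(hat_formula hn j).1]
    have := hs j (by omega) (by omega)
    exact Complex.ofReal_ne_zero.2 (by positivity)
  · rw [(hat_formula hn j).2]
    refine Complex.ofReal_ne_zero.2
      (div_ne_zero (neg_ne_zero.2 (mul_ne_zero ?_ ?_)) (by positivity))
    · exact hs _ (by omega) (by omega)
    · exact hs _ (by omega) (by omega)

lemma hat_im {n : ℕ} (hn : 2 ≤ n) (k : ℕ) : ((hat (relTrace n) k).re : ℂ) = hat (relTrace n) k := by
  rcases Nat.even_or_odd' k with ⟨j, rfl | rfl⟩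
  · rw [(hat_formula hn j).1, Complex.ofReal_re]
  · rw [(hat_formula hn j).2, Complex.ofReal_re]

lemma lead_hat {c : ℂ} {x S : ℕ → ℝ → ℂ} {g h : ℤ} {a : ℂ} {k : ℕ}
    (hx : ∀ j, ∀ᶠ t in atTop, x (j + 2) t = S j t - x j t - c * x (j + 1) t)
    (hS : ∀ j, Lead g h (a * if Even (j + k) then 1 else 0) (S j))
    (h₀ : Lead g h (a * hat c k) (x 0)) (h₁ : Lead g h (a * hat c (k + 1)) (x 1)) (j : ℕ) :
    Lead g h (a * hat c (j + k)) (x j) := by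
  induction j using Nat.twoStepInduction with
  | zero => simpa using h₀
  | one => simpa [add_comm] using h₁
  | more j ih₁ ih₂ =>
    refine (((hS j).sub ih₁).sub (ih₂.const_mul c)).congr ((hx j).mono fun t ht => ht.symm)
      |>.cast rfl rfl ?_
    rw [show j + 2 + k = j + k + 2 by ring, show j + 1 + k = j + k + 1 by ring, hat]
    ring

namespace Fam

variable {o e n : ℕ} {τ K : ℝ → ℂ} {φ : ℝ → ℕ → ℕ → ℂ} {g h : ℤ} {a a₀ a₁ a₂ : ℂ}

lemma lead_infinity (H : Fam o e n τ K φ) (hT : Lead g h a fun t => tw (τ t) 1) :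
    Lead g h (-a) fun t => φ t 1 0 :=
  hT.neg.congr (H.mono fun _ ht => ht.infinity.symm)

lemma lead_even (H : Fam o e n τ K φ) {p : ℕ} (hp : Even p)
    (hT : Lead g h a fun t => 2 + K t * (tw (τ t) p - 2)) : Lead g h a fun t => φ t p 1 :=
  hT.congr (H.mono fun t ht => by rw [ht.integral, if_pos hp])

lemma lead_odd (H : Fam o e n τ K φ) {p : ℕ} (hp : Odd p)
    (hT : Lead g h a fun t =>
      pivot o e (relTrace n) (τ t) (K t) + K t * (tw (τ t) p - tw (τ t) o)) :
    Lead g h a fun t => φ t p 1 :=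
  hT.congr (H.mono fun t ht => by rw [ht.integral, if_neg (Nat.not_even_iff_odd.2 hp)]; rfl)

lemma lead_pivot (H : Fam o e n τ K φ) (ho : Odd o)
    (hT : Lead g h a fun t => pivot o e (relTrace n) (τ t) (K t)) : Lead g h a fun t => φ t o 1 :=
  hT.congr (H.mono fun t ht => by
    rw [ht.integral, if_neg (Nat.not_even_iff_odd.2 ho), sub_self, mul_zero, add_zero]; rfl)

lemma lead_relator (H : Fam o e n τ K φ) : Lead 0 0 (relTrace n) fun t => φ t (o + e) 2 :=
  (Lead.const _).congr (H.mono fun _ ht => ht.relator.symm)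

lemma lead_left (H : Fam o e n τ K φ) {p₁ q₁ p₂ q₂ P Q : ℕ} (hd : p₁ * q₂ = p₂ * q₁ + 1)
    (hP : P = 2 * p₁ + p₂) (hQ : Q = 2 * q₁ + q₂)
    (h₀ : Lead g h a₀ fun t => source o e (relTrace n) (τ t) (K t) p₂)
    (h₁ : Lead g h a₁ fun t => φ t p₂ q₂)
    (h₂ : Lead g h a₂ fun t => φ t p₁ q₁ * φ t (p₁ + p₂) (q₁ + q₂)) :
    Lead g h (a₀ - a₁ - a₂) fun t => φ t P Q := by
  subst hP hQ
  exact ((h₀.sub h₁).sub h₂).congr (H.mono fun t ht => (ht.left hd).symm)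

lemma lead_right (H : Fam o e n τ K φ) {p₁ q₁ p₂ q₂ P Q : ℕ} (hd : p₁ * q₂ = p₂ * q₁ + 1)
    (hP : P = p₁ + 2 * p₂) (hQ : Q = q₁ + 2 * q₂)
    (h₀ : Lead g h a₀ fun t => source o e (relTrace n) (τ t) (K t) p₁)
    (h₁ : Lead g h a₁ fun t => φ t p₁ q₁)
    (h₂ : Lead g h a₂ fun t => φ t p₂ q₂ * φ t (p₁ + p₂) (q₁ + q₂)) :
    Lead g h (a₀ - a₁ - a₂) fun t => φ t P Q := by
  subst hP hQ
  exact ((h₀.sub h₁).sub h₂).congr (H.mono fun t ht => (ht.right hd).symm)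

variable {g₁ h₁ g₂ h₂ : ℤ}

lemma cone (H : Fam o e n τ K φ) {i j p₁ q₁ p₂ q₂ P Q : ℕ} (hij : i.Coprime j)
    (hP : P = i * p₁ + j * p₂) (hQ : Q = i * q₁ + j * q₂)
    (hd : p₁ * q₂ = p₂ * q₁ + 1) (hγ₁ : 0 < g₁ ∨ 0 = g₁ ∧ 0 < h₁) (hγ₂ : 0 < g₂ ∨ 0 = g₂ ∧ 0 < h₂)
    (L₁ : Lead g₁ h₁ a₁ fun t => φ t p₁ q₁) (L₂ : Lead g₂ h₂ a₂ fun t => φ t p₂ q₂)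
    (L : Lead (g₁ + g₂) (h₁ + h₂) (-(a₁ * a₂)) fun t => φ t (p₁ + p₂) (q₁ + q₂))
    (hC : SmallSource o e n τ K (g₁ + g₂) (h₁ + h₂)) :
    HasLead (i * g₁ + j * g₂) (i * h₁ + j * h₂) (‖a₁‖ ^ i * ‖a₂‖ ^ j) fun t => φ t P Q := by
  subst hP hQ
  rcases Nat.eq_zero_or_pos i with rfl | hi
  · obtain rfl : j = 1 := by simpa using hij
    simpa using L₂.hasLead
  rcases Nat.eq_zero_or_pos j with rfl | hj
  · obtain rfl : i = 1 := by simpa using hij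
    simpa using L₁.hasLead
  exact exists_lead_of_mediant H hij hi hj hd hγ₁ hγ₂ L₁ L₂ L (by rw [norm_neg, norm_mul]) hC

/-- The cone spanned by two consecutive integral slopes. -/
lemma cone_integral (H : Fam o e n τ K φ) {i j p P Q : ℕ} (hij : i.Coprime j)
    (hP : P = i * (p + 1) + j * p) (hQ : Q = i + j)
    (hγ₁ : 0 < g₁ ∨ 0 = g₁ ∧ 0 < h₁) (hγ₂ : 0 < g₂ ∨ 0 = g₂ ∧ 0 < h₂)
    (L₁ : Lead g₁ h₁ a₁ fun t => φ t (p + 1) 1) (L₂ : Lead g₂ h₂ a₂ fun t => φ t p 1)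
    (L₀ : Lead (g₁ + g₂) (h₁ + h₂) 0 fun t => tw (τ t) 1)
    (hC : SmallSource o e n τ K (g₁ + g₂) (h₁ + h₂)) :
    HasLead (i * g₁ + j * g₂) (i * h₁ + j * h₂) (‖a₁‖ ^ i * ‖a₂‖ ^ j) fun t => φ t P Q := by
  refine H.cone hij hP (by omega) (by ring) hγ₁ hγ₂ L₁ L₂ ?_ hC
  refine (H.lead_right (p₁ := 1) (q₁ := 0) (p₂ := p) (q₂ := 1) (by ring) (by ring) (by ring) (hC 1)
    (H.lead_infinity L₀) (a₂ := a₁ * a₂) ?_).cast rfl rfl (by ring)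
  simpa only [add_comm 1 p, zero_add] using (L₂.mul L₁).cast (by ring) (by ring) (by ring)

end Fam

/-! ### The slopes accumulating to the slope of the relator -/

section relator

variable {o e n m : ℕ} {τ K : ℝ → ℂ} {φ : ℝ → ℕ → ℕ → ℂ} {g h : ℤ} {a a₀ a₁ a₂ : ℂ}

/-- The denominator of the slope with continued fraction `[m, 2, l]`; its numerator is
`2 * l + 1`. -/
def den (m l : ℕ) : ℕ := m + l * (2 * m + 1)

lemma den_parity (m l : ℕ) : Even (den m l) ↔ Even (m + l) := by
  simp [den, Nat.even_add, Nat.even_mul]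

namespace IsTraceFun

variable {τ K : ℂ} {φ : ℕ → ℕ → ℂ}

lemma den_add_two (H : IsTraceFun o e n τ K φ) (hm : o + e = 2 * m + 1) (l : ℕ) :
    φ (den m (l + 2)) (2 * (l + 2) + 1) =
      source o e (relTrace n) τ K (m + l) - φ (den m l) (2 * l + 1) -
        relTrace n * φ (den m (l + 1)) (2 * (l + 1) + 1) := by
  have hr := H.relator
  rw [hm] at hr
  have key := H.left (p₁ := 2 * m + 1) (q₁ := 2) (p₂ := den m l) (q₂ := 2 * l + 1)
    (by unfold den; ring)
  rw [show den m (l + 2) = 2 * (2 * m + 1) + den m l by unfold den; ring,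
    show den m (l + 1) = 2 * m + 1 + den m l by unfold den; ring,
    show 2 * (l + 2) + 1 = 2 * 2 + (2 * l + 1) by ring,
    show 2 * (l + 1) + 1 = 2 + (2 * l + 1) by ring, key, hr]
  have : source o e (relTrace n) τ K (den m l) = source o e (relTrace n) τ K (m + l) := by
    simp only [source, den_parity]
  rw [← this]
  rfl

lemma den_one (H : IsTraceFun o e n τ K φ) (hm : o + e = 2 * m + 1) :
    φ (den m 1) 3 =
      source o e (relTrace n) τ K (m + 1) - φ (m + 1) 1 - relTrace n * φ m 1 := by
  have hr := H.relator
  rw [hm] at hr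
  have key := H.right (p₁ := m + 1) (q₁ := 1) (p₂ := m) (q₂ := 1) (by ring)
  rw [show m + 1 + m = 2 * m + 1 by ring, show 1 + 1 = 2 by rfl, hr] at key
  rw [show den m 1 = m + 1 + 2 * m by unfold den; ring, key]
  simp only [relTrace]
  ring

/-- The slope `3 / (3 m + 2)`. -/
lemma three (H : IsTraceFun o e n τ K φ) (hm : o + e = 2 * m + 1) :
    φ (3 * m + 2) 3 =
      source o e (relTrace n) τ K m - φ m 1 - relTrace n * φ (m + 1) 1 := by
  have hr := H.relator
  rw [hm] at hr
  have key := H.left (p₁ := m + 1) (q₁ := 1) (p₂ := m) (q₂ := 1) (by ring)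
  rw [show m + 1 + m = 2 * m + 1 by ring, show 1 + 1 = 2 by rfl, hr] at key
  rw [show 3 * m + 2 = 2 * (m + 1) + m by ring, key]
  simp only [relTrace]
  ring

end IsTraceFun

namespace Fam

lemma lead_den_one (H : Fam o e n τ K φ) (hm : o + e = 2 * m + 1)
    (h₀ : Lead g h a₀ fun t => source o e (relTrace n) (τ t) (K t) (m + 1))
    (h₁ : Lead g h a₁ fun t => φ t (m + 1) 1) (h₂ : Lead g h a₂ fun t => φ t m 1) :
    Lead g h (a₀ - a₁ - relTrace n * a₂) fun t => φ t (den m 1) 3 :=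
  ((h₀.sub h₁).sub (h₂.const_mul _)).congr (H.mono fun _ ht => (ht.den_one hm).symm)

lemma lead_three (H : Fam o e n τ K φ) (hm : o + e = 2 * m + 1)
    (h₀ : Lead g h a₀ fun t => source o e (relTrace n) (τ t) (K t) m)
    (h₁ : Lead g h a₁ fun t => φ t m 1) (h₂ : Lead g h a₂ fun t => φ t (m + 1) 1) :
    Lead g h (a₀ - a₁ - relTrace n * a₂) fun t => φ t (3 * m + 2) 3 :=
  ((h₀.sub h₁).sub (h₂.const_mul _)).congr (H.mono fun _ ht => (ht.three hm).symm)

lemma lead_den_two (H : Fam o e n τ K φ) (hm : o + e = 2 * m + 1)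
    (h₀ : Lead g h a₀ fun t => source o e (relTrace n) (τ t) (K t) m)
    (h₁ : Lead g h a₁ fun t => φ t m 1) (h₂ : Lead g h a₂ fun t => φ t (den m 1) 3) :
    Lead g h (a₀ - a₁ - relTrace n * a₂) fun t => φ t (den m 2) 5 :=
  ((h₀.sub h₁).sub (h₂.const_mul _)).congr (H.mono fun t ht => by
    simpa [den] using (ht.den_add_two hm 0).symm)

lemma lead_den (H : Fam o e n τ K φ) (hm : o + e = 2 * m + 1) {k l : ℕ} (hk : Even (m + l + k))
    (hE : Lead g h a fun t => source o e (relTrace n) (τ t) (K t) 0)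
    (hO : Lead g h 0 fun t => source o e (relTrace n) (τ t) (K t) 1)
    (h₀ : Lead g h (a * hat (relTrace n) k) fun t => φ t (den m l) (2 * l + 1))
    (h₁ : Lead g h (a * hat (relTrace n) (k + 1)) fun t => φ t (den m (l + 1)) (2 * (l + 1) + 1))
    (j : ℕ) : Lead g h (a * hat (relTrace n) (j + k))
      fun t => φ t (den m (l + j)) (2 * (l + j) + 1) := by
  refine lead_hat (x := fun j t => φ t (den m (l + j)) (2 * (l + j) + 1))
    (S := fun j t => source o e (relTrace n) (τ t) (K t) (m + (l + j)))
    (fun j => H.mono fun t ht => ht.den_add_two hm (l + j)) (fun j => ?_) h₀ h₁ j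
  have : Even (m + (l + j)) ↔ Even (j + k) := by
    rw [← add_assoc]; simp only [Nat.even_add] at hk ⊢; tauto
  by_cases hj : Even (j + k)
  · simpa only [source_of_even (this.2 hj), hj, if_true, mul_one] using hE
  · simpa only [source_of_odd (Nat.not_even_iff_odd.1 fun h => hj (this.1 h)), hj, if_false,
      mul_zero] using hO

/-- The cone spanned by two consecutive slopes `[m, 2, l]`, `[m, 2, l + 1]`. -/
lemma cone_den (H : Fam o e n τ K φ) (hm : o + e = 2 * m + 1) {i j l P Q : ℕ} (hij : i.Coprime j)
    (hP : P = i * den m (l + 1) + j * den m l) (hQ : Q = i * (2 * (l + 1) + 1) + j * (2 * l + 1))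
    {g₁ h₁ g₂ h₂ : ℤ}
    (hγ₁ : 0 < g₁ ∨ 0 = g₁ ∧ 0 < h₁) (hγ₂ : 0 < g₂ ∨ 0 = g₂ ∧ 0 < h₂)
    (L₁ : Lead g₁ h₁ a₁ fun t => φ t (den m (l + 1)) (2 * (l + 1) + 1))
    (L₂ : Lead g₂ h₂ a₂ fun t => φ t (den m l) (2 * l + 1))
    (hC : SmallSource o e n τ K (g₁ + g₂) (h₁ + h₂)) :
    HasLead (i * g₁ + j * g₂) (i * h₁ + j * h₂) (‖a₁‖ ^ i * ‖a₂‖ ^ j) fun t => φ t P Q := by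
  refine H.cone hij hP hQ (by unfold den; ring) hγ₁ hγ₂ L₁ L₂ ?_ hC
  refine (H.lead_right (p₁ := 2 * m + 1) (q₁ := 2) (p₂ := den m l) (q₂ := 2 * l + 1)
    (by unfold den; ring) (by unfold den; ring) (by ring) (hC _)
    (a₁ := 0) (a₂ := a₁ * a₂) ?_ ?_).cast rfl rfl (by ring)
  · have := H.lead_relator
    rw [hm] at this
    exact this.weaken (by omega)
  · rw [show 2 * m + 1 + den m l = den m (l + 1) by unfold den; ring,
      show 2 + (2 * l + 1) = 2 * (l + 1) + 1 by ring]
    exact (L₂.mul L₁).cast (by ring) (by ring) (by ring)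

/-- The cone spanned by `1 / (m + 1)` and `3 / (3 m + 2)`. -/
lemma cone_three (H : Fam o e n τ K φ) (hm : o + e = 2 * m + 1) {i j P Q : ℕ} (hij : i.Coprime j)
    (hP : P = i * (m + 1) + j * (3 * m + 2)) (hQ : Q = i + j * 3) {g₁ h₁ g₂ h₂ : ℤ}
    (hγ₁ : 0 < g₁ ∨ 0 = g₁ ∧ 0 < h₁) (hγ₂ : 0 < g₂ ∨ 0 = g₂ ∧ 0 < h₂)
    (L₁ : Lead g₁ h₁ a₁ fun t => φ t (m + 1) 1) (L₂ : Lead g₂ h₂ a₂ fun t => φ t (3 * m + 2) 3)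
    (hC : SmallSource o e n τ K (g₁ + g₂) (h₁ + h₂)) :
    HasLead (i * g₁ + j * g₂) (i * h₁ + j * h₂) (‖a₁‖ ^ i * ‖a₂‖ ^ j) fun t => φ t P Q := by
  refine H.cone hij hP (by omega) (by ring) hγ₁ hγ₂ L₁ L₂ ?_ hC
  refine (H.lead_left (p₁ := m + 1) (q₁ := 1) (p₂ := 2 * m + 1) (q₂ := 2)
    (by ring) (by ring) (by ring) (hC _) (a₁ := 0) (a₂ := a₁ * a₂) ?_ ?_).cast rfl rfl (by ring)
  · have := H.lead_relator
    rw [hm] at this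
    exact this.weaken (by omega)
  · rw [show m + 1 + (2 * m + 1) = 3 * m + 2 by ring, show 1 + 2 = 3 by rfl]
    exact L₁.mul L₂

end Fam

/-- The sequence of traces along the slopes `[m, 2, l]` is periodic. -/
lemma periodic_of_recurrence {n : ℕ} (hn : 2 ≤ n) {x C : ℕ → ℂ} (hC : ∀ j, C (j + 2) = C j)
    (hx : ∀ j, x (j + 2) = C j - x j - relTrace n * x (j + 1)) : x (2 * n) = x 0 := by
  set θ := Real.pi / n with hθ
  have hs : Real.sin θ ≠ 0 := by
    refine (Real.sin_pos_of_pos_of_lt_pi (by positivity) ?_).ne'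
    exact div_lt_self Real.pi_pos (by exact_mod_cast hn)
  have hs' : (Real.sin θ : ℂ) ≠ 0 := Complex.ofReal_ne_zero.2 hs
  have hcs : (Real.sin θ : ℂ) ^ 2 + (Real.cos θ : ℂ) ^ 2 = 1 := by
    exact_mod_cast Real.sin_sq_add_cos_sq θ
  set y : ℕ → ℂ := fun j => (2 * C j - relTrace n * C (j + 1)) / (4 * Real.sin θ ^ 2) with hy
  have hr : relTrace n = 2 * Real.cos θ := rfl
  have hw : ∀ j, x (j + 2) - y (j + 2) =
      -(x j - y j) - relTrace n * (x (j + 1) - y (j + 1)) := fun j => by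
    have : y (j + 2) + relTrace n * y (j + 1) + y j = C j := by
      simp only [hy, hC, hr, show j + 2 + 1 = (j + 1) + 2 by ring, show j + 1 + 1 = j + 2 by ring]
      field_simp
      linear_combination (-4 * C j) * hcs
    rw [hx]
    clear_value y
    linear_combination -this
  have hadd : ∀ j : ℕ, (Real.sin ((j + 2 : ℕ) * θ) : ℂ) =
      2 * Real.cos θ * Real.sin ((j + 1 : ℕ) * θ) - Real.sin (j * θ) := fun j => by
    have h₁ := Real.sin_add ((j + 1 : ℕ) * θ) θ
    have h₂ := Real.sin_sub ((j + 1 : ℕ) * θ) θ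
    rw [show ((j + 1 : ℕ) : ℝ) * θ + θ = (j + 2 : ℕ) * θ by push_cast; ring] at h₁
    rw [show ((j + 1 : ℕ) : ℝ) * θ - θ = j * θ by push_cast; ring] at h₂
    rw [h₁]
    norm_cast
    rw [h₂]
    ring
  have key : ∀ j : ℕ, (x (j + 1) - y (j + 1)) * Real.sin θ * (-1) ^ (j + 1) =
      -((x 1 - y 1) * Real.sin ((j + 1 : ℕ) * θ)) - (x 0 - y 0) * Real.sin (j * θ) := by
    intro j
    induction j using Nat.twoStepInduction with
    | zero => simp
    | one =>
      have h := hw 0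
      have h' := hadd 0
      simp only [zero_add, Nat.cast_one, one_mul, Nat.cast_zero, zero_mul, Real.sin_zero,
        Complex.ofReal_zero, sub_zero, Nat.reduceAdd] at h h' ⊢
      rw [h, h', hr]
      ring
    | more j ih₁ ih₂ =>
      have h := hw (j + 1)
      have h₁ := hadd j
      have h₂ := hadd (j + 1)
      rw [show j + 2 + 1 = j + 1 + 2 by ring, h, h₂, h₁, hr]
      rw [show j + 1 + 1 = j + 2 by ring] at ih₂ ⊢
      rw [h₁] at ih₂
      ring_nf at ih₁ ih₂ ⊢
      linear_combination (-1 : ℂ) * ih₁ + (2 * (Real.cos θ : ℂ)) * ih₂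
  have h2n : 2 * n = (2 * n - 1) + 1 := by omega
  have hy2 : ∀ j, y (2 * j) = y 0 := fun j => by
    have hC2 : ∀ i, C (2 * j + i) = C i := fun i => by
      induction j with
      | zero => simp
      | succ j ih => rw [show 2 * (j + 1) + i = 2 * j + i + 2 by ring, hC, ih]
    have h₀ := hC2 0
    simp only [hy, hC2 1, zero_add]
    rw [add_zero] at h₀
    rw [h₀]
  have hfin := key (2 * n - 1)
  have hn0 : (n : ℝ) ≠ 0 := by positivity
  rw [← h2n, hy2, show ((2 * n : ℕ) : ℝ) * θ = 2 * Real.pi by rw [hθ]; push_cast; field_simp,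
    show ((2 * n - 1 : ℕ) : ℝ) * θ = 2 * Real.pi - θ by
      rw [hθ, Nat.cast_sub (by omega)]; push_cast; field_simp,
    Real.sin_two_pi, Real.sin_two_pi_sub, Even.neg_one_pow (even_two_mul n)] at hfin
  have : (x (2 * n) - x 0) * Real.sin θ = 0 := by
    push_cast at hfin ⊢
    linear_combination hfin
  rcases mul_eq_zero.1 this with h | h
  · exact sub_eq_zero.1 h
  · exact absurd h hs'

lemma Fam.den_last (H : Fam o e n τ K φ) (hm : o + e = 2 * m + 1) (hn : 2 ≤ n) :
    ∀ᶠ t in atTop, φ t (den m (2 * n - 2)) (2 * (2 * n - 2) + 1) = φ t (3 * m + 2) 3 := by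
  filter_upwards [H] with t ht
  set x : ℕ → ℂ := fun j => if j = 0 then φ t (3 * m + 2) 3 else if j = 1 then φ t (m + 1) 1
    else φ t (den m (j - 2)) (2 * (j - 2) + 1) with hx
  have := periodic_of_recurrence hn (x := x)
    (C := fun j => source o e (relTrace n) (τ t) (K t) (m + j))
    (fun j => by simp only [source, ← add_assoc, Nat.even_add_one, not_not])
    (fun j => by
      rcases j with _ | _ | j
      · simp [hx, den, ht.three hm]; ring
      · simp [hx, ht.den_one hm]; simp [den]
      · have := ht.den_add_two hm j
        have e : source o e (relTrace n) (τ t) (K t) (m + (j + 2)) =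
            source o e (relTrace n) (τ t) (K t) (m + j) := by
          simp only [source, ← add_assoc, Nat.even_add_one, not_not]
        simp only [hx, e, show j + 2 + 2 ≠ 0 by omega, show j + 2 + 2 ≠ 1 by omega,
          show j + 2 ≠ 0 by omega, show j + 2 ≠ 1 by omega, show j + 2 + 1 ≠ 0 by omega,
          show j + 2 + 1 ≠ 1 by omega, if_false, show j + 2 + 2 - 2 = j + 2 by omega,
          show j + 2 - 2 = j by omega, show j + 2 + 1 - 2 = j + 1 by omega]
        exact this)
  simpa [hx, show n ≠ 0 by omega, show 2 * n ≠ 1 by omega] using this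

end relator

namespace Lead

lemma ofReal_self : Lead 0 1 1 fun t => (t : ℂ) := by
  refine tendsto_const_nhds.congr' ?_
  filter_upwards [eventually_gt_atTop 0] with t ht
  have : (t : ℂ) ≠ 0 := by exact_mod_cast ht.ne'
  simp [scale, this]

lemma exp_mul (g : ℤ) : Lead g 0 1 fun t => (Real.exp (g * t) : ℂ) := by
  refine tendsto_const_nhds.congr' ?_
  filter_upwards with t
  have : (Real.exp (g * t) : ℂ) ≠ 0 := by exact_mod_cast (Real.exp_pos _).ne'
  rw [scale, zpow_zero, mul_one, div_self this]

lemma exp : Lead 1 0 1 fun t => (Real.exp t : ℂ) := by simpa using exp_mul 1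

variable {g h : ℤ} {a : ℂ} {x : ℝ → ℂ}

lemma pow (hx : Lead g h a x) (p : ℕ) : Lead (p * g) (p * h) (a ^ p) fun t => x t ^ p := by
  induction p with
  | zero => simpa using const 1
  | succ p ih => exact (ih.mul hx).cast (by push_cast; ring) (by push_cast; ring) (by ring)

lemma tw (hx : Lead g h a x) (ha : a ≠ 0) (hγ : 0 < g ∨ 0 = g ∧ 0 < h) {p : ℕ} (hp : 1 ≤ p) :
    Lead (p * g) (p * h) (a ^ p) fun t => tw (x t) p := by
  have hp' : (0 : ℤ) < p := by exact_mod_cast hp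
  refine (hx.pow p).add_small (((hx.inv ha).pow p).weaken ?_)
  rcases hγ with h₁ | ⟨rfl, h₁⟩
  · exact Or.inl (by nlinarith)
  · exact Or.inr ⟨by ring, by nlinarith⟩

end Lead

/-! ### The valuation with `τ = t` and `K = e ^ t` -/

/-- Families with `τ = t` and `K = e ^ t`. -/
abbrev PolyFam (o e n : ℕ) (φ : ℝ → ℕ → ℕ → ℂ) : Prop :=
  Fam o e n (fun t => (t : ℂ)) (fun t => (Real.exp t : ℂ)) φ

namespace PolyFam

variable {o e n : ℕ} {φ : ℝ → ℕ → ℕ → ℂ}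

lemma tw_lead {p : ℕ} (hp : 1 ≤ p) : Lead 0 p 1 fun t => tw (t : ℂ) p :=
  (Lead.ofReal_self.tw one_ne_zero (by omega) hp).cast (by ring) (by ring) (by simp)

lemma pivot_lead (ho : 2 ≤ o) (he : 1 ≤ e) :
    Lead 0 (o - e) (-2) fun t => pivot o e (relTrace n) (t : ℂ) (Real.exp t : ℂ) := by
  have h₁ := ((tw_lead (p := o) (by omega)).sub_small
    ((tw_lead le_rfl).weaken (by omega))).const_mul 2
  have h₂ : Lead 0 1 1 fun t => relTrace n + tw (t : ℂ) 1 :=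
    ((Lead.const _).weaken (by omega)).small_add (tw_lead le_rfl)
  have h₃ := (h₂.div Lead.exp one_ne_zero).weaken (g' := 0) (h' := o) (by omega)
  have h₄ : Lead 0 e (-1) fun t => 2 - tw (t : ℂ) e :=
    (((Lead.const 2).weaken (by omega)).sub (tw_lead he)).cast rfl rfl (by ring)
  exact ((h₁.add_small h₃).div h₄ (by norm_num)).cast (by ring) rfl (by norm_num)

lemma source_zero (ho : 2 ≤ o) (he : 1 ≤ e) :
    Lead 1 (o + 1) 1 fun t => source o e (relTrace n) (t : ℂ) (Real.exp t : ℂ) 0 := by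
  simp only [source, Even.zero, if_true]
  have h₁ := (tw_lead le_rfl).mul (pivot_lead (n := n) ho he)
  have h₂ := ((tw_lead le_rfl).mul (tw_lead (p := o) (by omega))).sub_small
    ((Lead.const 4).weaken (by omega))
  exact ((((Lead.const 4).weaken (by omega)).sub (h₁.weaken (by omega))).add
    (Lead.exp.mul h₂)).cast (by ring) (by push_cast; ring) (by norm_num)

lemma source_one (ho : 2 ≤ o) (he : 1 ≤ e) :
    Lead 1 o (-2) fun t => source o e (relTrace n) (t : ℂ) (Real.exp t : ℂ) 1 := by
  simp only [source, Nat.not_even_one, if_false]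
  have h₁ := (pivot_lead (n := n) ho he).const_mul 2
  have h₂ := (tw_lead le_rfl).const_mul 2
  have h₃ := (Lead.exp.const_mul 2).mul ((tw_lead (p := o) (by omega)).sub_small
    ((tw_lead le_rfl).weaken (by omega)))
  exact (((h₁.weaken (by omega)).sub (h₂.weaken (by omega))).sub h₃).cast
    (by ring) (by ring) (by norm_num)

lemma smallSource (ho : 2 ≤ o) (he : 1 ≤ e) {g h : ℤ} (hgh : 1 < g ∨ 1 = g ∧ (o : ℤ) + 1 < h) :
    SmallSource o e n (fun t => (t : ℂ)) (fun t => (Real.exp t : ℂ)) g h :=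
  smallSource_of_lead ((source_zero ho he).weaken hgh) ((source_one ho he).weaken (by omega))

lemma infinity (H : PolyFam o e n φ) : Lead 0 1 (-1) fun t => φ t 1 0 :=
  H.lead_infinity (tw_lead le_rfl)

lemma even (H : PolyFam o e n φ) {p : ℕ} (hp : Even p) (hp₁ : 1 ≤ p) :
    Lead 1 p 1 fun t => φ t p 1 := by
  refine H.lead_even hp ?_
  have h := Lead.exp.mul ((tw_lead hp₁).sub_small ((Lead.const 2).weaken (by omega)))
  exact (((Lead.const 2).weaken (by omega)).small_add (h.cast (by ring) (by ring) (by norm_num)))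

lemma odd_lt (H : PolyFam o e n φ) (ho : 2 ≤ o) (he : 1 ≤ e) {p : ℕ} (hp : Odd p) (hpo : p < o) :
    Lead 1 o (-1) fun t => φ t p 1 := by
  refine H.lead_odd hp ?_
  have h := Lead.exp.mul (((tw_lead hp.pos).weaken (g' := 0) (h' := o) (by omega)).sub
    (tw_lead (p := o) (by omega)))
  exact (((pivot_lead ho he).weaken (by omega)).small_add
    (h.cast (by ring) (by ring) (by norm_num)))

lemma odd_gt (H : PolyFam o e n φ) (ho : 2 ≤ o) (he : 1 ≤ e) {p : ℕ} (hp : Odd p) (hpo : o < p) :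
    Lead 1 p 1 fun t => φ t p 1 := by
  refine H.lead_odd hp ?_
  have h := Lead.exp.mul ((tw_lead hp.pos).sub_small
    ((tw_lead (p := o) (by omega)).weaken (by omega)))
  exact (((pivot_lead ho he).weaken (by omega)).small_add
    (h.cast (by ring) (by ring) (by norm_num)))

lemma pivot (H : PolyFam o e n φ) (ho : 2 ≤ o) (he : 1 ≤ e) (ho' : Odd o) :
    Lead 0 (o - e) (-2) fun t => φ t o 1 :=
  H.lead_pivot ho' (pivot_lead ho he)

/-- Integral slopes `1 / p` with `p > o`. -/
lemma gt (H : PolyFam o e n φ) (ho : 2 ≤ o) (he : 1 ≤ e) {p : ℕ} (hpo : o < p) :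
    Lead 1 p 1 fun t => φ t p 1 := by
  rcases Nat.even_or_odd p with hp | hp
  · exact H.even hp (by omega)
  · exact H.odd_gt ho he hp hpo

end PolyFam

lemma TraceEq.exists_polyFam {o e n P q P' q' : ℕ} (h : TraceEq o e n P q P' q') (he : 1 ≤ e) :
    ∃ φ, PolyFam o e n φ ∧ ∀ᶠ t in atTop, φ t P q = φ t P' q' ∨ φ t P q = -φ t P' q' := by
  refine h.exists_fam ?_ ?_ ?_
  · filter_upwards [eventually_gt_atTop 0] with t ht
    exact_mod_cast ht.ne'
  · filter_upwards with t
    exact_mod_cast (Real.exp_pos t).ne'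
  · have : Lead 0 e 1 fun t => tw (t : ℂ) e - 2 :=
      (PolyFam.tw_lead he).sub_small ((Lead.const 2).weaken (by omega))
    exact (this.eventually_ne_zero one_ne_zero).mono fun t ht => sub_ne_zero.1 ht

/-! ### Slopes greater than `1 / m` -/

/-- A slope in the cone spanned by the slopes `1 / P` and `1 / Q`, where `P` is even,
`Q` is odd and both are less than `o`. -/
structure IsLarge (o P Q i j p q : ℕ) : Prop where
  even : Even P
  odd : Odd Q
  pos : 1 ≤ P
  adj : P = Q + 1 ∨ Q = P + 1
  le : P + 1 ≤ o
  le' : Q + 2 ≤ o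
  coprime : i.Coprime j
  eq : p = i * P + j * Q
  eq' : q = i + j

/-- A variant of `Fam.cone_integral` for the cones in `IsLarge`. -/
lemma Fam.cone_large {o e n : ℕ} {τ K : ℝ → ℂ} {φ : ℝ → ℕ → ℕ → ℂ} (H : Fam o e n τ K φ)
    {P Q i j p q : ℕ} (hL : IsLarge o P Q i j p q) {g₁ h₁ g₂ h₂ : ℤ} {a₁ a₂ : ℂ}
    (hγ₁ : 0 < g₁ ∨ 0 = g₁ ∧ 0 < h₁) (hγ₂ : 0 < g₂ ∨ 0 = g₂ ∧ 0 < h₂)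
    (L₁ : Lead g₁ h₁ a₁ fun t => φ t P 1) (L₂ : Lead g₂ h₂ a₂ fun t => φ t Q 1)
    (L₀ : Lead (g₁ + g₂) (h₁ + h₂) 0 fun t => tw (τ t) 1)
    (hC : SmallSource o e n τ K (g₁ + g₂) (h₁ + h₂)) :
    HasLead (i * g₁ + j * g₂) (i * h₁ + j * h₂) (‖a₁‖ ^ i * ‖a₂‖ ^ j) fun t => φ t p q := by
  obtain ⟨-, -, -, hadj | hadj, -, -, hij, hp, hq⟩ := hL
  · subst hadj
    exact H.cone_integral hij hp hq hγ₁ hγ₂ L₁ L₂ L₀ hC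
  · subst hadj
    exact (H.cone_integral (i := j) (j := i) hij.symm (by rw [hp]; ring) (by rw [hq]; ring)
      hγ₂ hγ₁ L₂ L₁ (by rwa [add_comm g₂, add_comm h₂])
      (by rwa [add_comm g₂, add_comm h₂])).cast (by ring) (by ring) (by ring)

lemma PolyFam.large {o e n P Q i j p q : ℕ} {φ : ℝ → ℕ → ℕ → ℂ} (H : PolyFam o e n φ)
    (he : 1 ≤ e) (hL : IsLarge o P Q i j p q) :
    HasLead q (i * P + j * o) 1 fun t => φ t p q := by
  have ho : 2 ≤ o := by have := hL.le'; omega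
  have hP := hL.pos
  have h := H.cone_large hL (by omega) (by omega) (H.even hL.even hL.pos)
    (H.odd_lt ho he hL.odd (by have := hL.le'; omega)) ((tw_lead le_rfl).weaken (by omega))
    (smallSource ho he (by omega))
  refine h.cast ?_ rfl (by simp)
  rw [hL.eq']
  push_cast
  ring

/-! ### Normal forms for the slopes -/

/-- A slope in the cone spanned by the slopes `1 / (p + 1)` and `1 / p`. -/
structure IsBetween (p i j P q : ℕ) : Prop where
  coprime : i.Coprime j
  eq : P = i * (p + 1) + j * p
  eq' : q = i + j

/-- A slope in the cone spanned by the slopes `1 / (m + 1)` and `3 / (3 m + 2)`, the former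
excluded. -/
structure IsMiddle (m i j P q : ℕ) : Prop where
  coprime : i.Coprime j
  pos : 1 ≤ j
  eq : P = i * (m + 1) + j * (3 * m + 2)
  eq' : q = i + j * 3

/-- A slope in the cone spanned by the slopes `[m, 2, l + 1]` and `[m, 2, l]`, the former
excluded. -/
structure IsNear (m n l i j P q : ℕ) : Prop where
  coprime : i.Coprime j
  pos : 1 ≤ j
  pos' : l = 0 → 1 ≤ i
  le : l + 3 ≤ 2 * n
  eq : P = i * den m (l + 1) + j * den m l
  eq' : q = i * (2 * (l + 1) + 1) + j * (2 * l + 1)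

lemma exists_isBetween {P q : ℕ} (hPq : P.Coprime q) (hq : 1 ≤ q) :
    ∃ i j, 1 ≤ j ∧ IsBetween (P / q) i j P q := by
  have hlt : P % q < q := Nat.mod_lt _ hq
  have hdiv := Nat.div_add_mod P q
  refine ⟨P % q, q - P % q, by omega, ?_, ?_, by omega⟩
  · have h : (P % q).Coprime q := by
      rw [Nat.Coprime, ← Nat.gcd_rec, Nat.gcd_comm]
      exact hPq
    rwa [← Nat.coprime_add_self_right, Nat.sub_add_cancel hlt.le]
  · obtain ⟨k, hk⟩ := exists_add_of_le hlt.le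
    generalize P % q = r at *
    generalize P / q = d at *
    subst hk
    rw [Nat.add_sub_cancel_left]
    linarith

lemma PolyFam.small {o e n P q : ℕ} {φ : ℝ → ℕ → ℕ → ℂ} (H : PolyFam o e n φ) (ho : 2 ≤ o)
    (he : 1 ≤ e) (hPq : P.Coprime q) (hq : 1 ≤ q) (hle : (o + 1) * q ≤ P) :
    HasLead q P 1 fun t => φ t P q := by
  obtain ⟨i, j, -, hij, hP, hq'⟩ := exists_isBetween hPq hq
  have hp : o + 1 ≤ P / q := (Nat.le_div_iff_mul_le hq).2 hle
  refine (H.cone_integral hij hP hq' (by omega) (by omega) (H.gt ho he (by omega))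
    (H.gt ho he (by omega)) ((tw_lead le_rfl).weaken (by omega))
    (smallSource ho he (by omega))).cast ?_ ?_ (by simp)
  · conv_rhs => rw [hq']
    push_cast; ring
  · conv_rhs => rw [hP]
    push_cast; ring

/-! ### The valuation with `τ = e ^ t` and `K = e ^ (-m t) / t` -/

/-- Families with `τ = e ^ t` and `K = e ^ (-m t) / t`. -/
abbrev ExpFam (o e m n : ℕ) (φ : ℝ → ℕ → ℕ → ℂ) : Prop :=
  Fam o e n (fun t => (Real.exp t : ℂ)) (fun t => (Real.exp ((-m : ℤ) * t) : ℂ) * (t : ℂ)⁻¹) φ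

namespace ExpFam

variable {o e m n : ℕ} {φ : ℝ → ℕ → ℕ → ℂ}

lemma tw_lead {p : ℕ} (hp : 1 ≤ p) : Lead p 0 1 fun t => tw (Real.exp t : ℂ) p :=
  (Lead.exp.tw one_ne_zero (by omega) hp).cast (by ring) (by ring) (by simp)

lemma lead_K (m : ℕ) : Lead (-m) (-1) 1 fun t => (Real.exp ((-m : ℤ) * t) : ℂ) * (t : ℂ)⁻¹ :=
  ((Lead.exp_mul (-m)).mul (Lead.ofReal_self.inv one_ne_zero)).cast (by ring) (by ring) (by simp)

lemma pivot_lead (ho : 2 ≤ o) (he : 1 ≤ e) (hom : o ≤ m + 1) :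
    Lead (m + 1 - e) 1 (-1) fun t => pivot o e (relTrace n) (Real.exp t : ℂ)
      ((Real.exp ((-m : ℤ) * t) : ℂ) * (t : ℂ)⁻¹) := by
  have h₁ := ((tw_lead (p := o) (by omega)).sub_small
    ((tw_lead le_rfl).weaken (by omega))).const_mul 2
  have h₂ : Lead 1 0 1 fun t => relTrace n + tw (Real.exp t : ℂ) 1 :=
    ((Lead.const _).weaken (by omega)).small_add (tw_lead le_rfl)
  have h₃ := h₂.div (lead_K m) one_ne_zero
  have h₄ : Lead e 0 (-1) fun t => 2 - tw (Real.exp t : ℂ) e :=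
    (((Lead.const 2).weaken (by omega)).sub (tw_lead he)).cast rfl rfl (by ring)
  have h₅ := (h₁.weaken (g' := m + 1) (h' := 1) (by omega)).add (h₃.cast (by ring) (by ring) rfl)
  exact (h₅.div h₄ (by norm_num)).cast (by ring) (by ring) (by norm_num)

lemma source_zero (ho : 2 ≤ o) (he : 1 ≤ e) (hm : o + e = 2 * m + 1) (hem : e ≤ m + 1)
    (hom : o ≤ m + 1) :
    Lead (m + 2 - e) 1 1 fun t => source o e (relTrace n) (Real.exp t : ℂ)
      ((Real.exp ((-m : ℤ) * t) : ℂ) * (t : ℂ)⁻¹) 0 := by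
  simp only [source, Even.zero, if_true]
  have h₁ := (tw_lead le_rfl).mul (pivot_lead (n := n) ho he hom)
  have h₂ := (lead_K m).mul (((tw_lead le_rfl).mul (tw_lead (p := o) (by omega))).sub_small
    ((Lead.const 4).weaken (by omega)))
  exact ((((Lead.const 4).weaken (by omega)).sub h₁).add
    (h₂.weaken (by omega))).cast (by push_cast; ring) (by ring) (by norm_num)

lemma source_one_of_lt (hm : 2 ≤ m) :
    Lead 1 1 (-2) fun t => source (m + 1) m (relTrace n) (Real.exp t : ℂ)
      ((Real.exp ((-m : ℤ) * t) : ℂ) * (t : ℂ)⁻¹) 1 := by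
  simp only [source, Nat.not_even_one, if_false]
  have h₁ := (pivot_lead (o := m + 1) (e := m) (m := m) (n := n) (by omega) (by omega)
    (by omega)).const_mul 2
  have h₂ := (tw_lead le_rfl).const_mul 2
  have h₃ := ((lead_K m).const_mul 2).mul ((tw_lead (p := m + 1) (by omega)).sub_small
    ((tw_lead le_rfl).weaken (by omega)))
  exact (((h₁.cast (g' := 1) (h' := 1) (by ring) rfl rfl).sub
    (h₂.weaken (g' := 1) (h' := 1) (by omega))).sub
    (h₃.weaken (g' := 1) (h' := 1) (by omega))).cast rfl rfl (by norm_num)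

lemma source_one_of_gt (hm : 2 ≤ m) :
    Lead 1 0 (-2) fun t => source m (m + 1) (relTrace n) (Real.exp t : ℂ)
      ((Real.exp ((-m : ℤ) * t) : ℂ) * (t : ℂ)⁻¹) 1 := by
  simp only [source, Nat.not_even_one, if_false]
  have h₁ := (pivot_lead (o := m) (e := m + 1) (m := m) (n := n) (by omega) (by omega)
    (by omega)).const_mul 2
  have h₂ := (tw_lead le_rfl).const_mul 2
  have h₃ := ((lead_K m).const_mul 2).mul ((tw_lead (p := m) (by omega)).sub_small
    ((tw_lead le_rfl).weaken (by omega)))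
  exact (((h₁.weaken (by omega)).sub h₂).sub
    (h₃.weaken (by omega))).cast (by ring) (by ring) (by norm_num)

lemma pivot (H : ExpFam o e m n φ) (ho : 2 ≤ o) (he : 1 ≤ e) (hom : o ≤ m + 1) (ho' : Odd o) :
    Lead (m + 1 - e) 1 (-1) fun t => φ t o 1 :=
  H.lead_pivot ho' (pivot_lead ho he hom)

/-- Integral slopes `1 / p` with `p > max o m`. -/
lemma gt (H : ExpFam o e m n φ) (ho : 2 ≤ o) (he : 1 ≤ e) (hm : o + e = 2 * m + 1)
    (hom : o ≤ m + 1) {p : ℕ} (hpo : o < p) (hpm : m < p) :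
    Lead (p - m) (-1) 1 fun t => φ t p 1 := by
  rcases Nat.even_or_odd p with hp | hp
  · refine H.lead_even hp ?_
    have h := (lead_K m).mul ((tw_lead (p := p) (by omega)).sub_small
      ((Lead.const 2).weaken (by omega)))
    exact (((Lead.const 2).weaken (by omega)).small_add (h.cast (by ring) (by ring) (by norm_num)))
  · refine H.lead_odd hp ?_
    have h := (lead_K m).mul ((tw_lead (p := p) (by omega)).sub_small
      ((tw_lead (p := o) (by omega)).weaken (by omega)))
    exact (((pivot_lead ho he hom).weaken (by omega)).small_add
      (h.cast (by ring) (by ring) (by norm_num)))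

/-- Integral slopes `1 / p` with `p` even, `p ≤ m`. -/
lemma even_le (H : ExpFam o e m n φ) {p : ℕ} (hp : Even p) (hp₁ : 1 ≤ p) (hpm : p ≤ m) :
    Lead 0 0 2 fun t => φ t p 1 := by
  refine H.lead_even hp ?_
  have h := (lead_K m).mul ((tw_lead hp₁).sub_small ((Lead.const 2).weaken (by omega)))
  exact (Lead.const 2).add_small (h.weaken (by omega))

/-- Integral slopes `1 / p` with `p < o` odd. -/
lemma odd_lt (H : ExpFam o e m n φ) (ho : 2 ≤ o) (he : 1 ≤ e) (hom : o ≤ m + 1)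
    (hm : o + e = 2 * m + 1) {p : ℕ} (hp : Odd p) (hpo : p < o) :
    Lead (m + 1 - e) 1 (-1) fun t => φ t p 1 := by
  refine H.lead_odd hp ?_
  have h := (lead_K m).mul (((tw_lead hp.pos).weaken (g' := o) (h' := 0) (by omega)).sub
    (tw_lead (p := o) (by omega)))
  exact (pivot_lead ho he hom).add_small (h.weaken (by omega))

end ExpFam

lemma TraceEq.exists_expFam {o e n P q P' q' : ℕ} (h : TraceEq o e n P q P' q') (he : 1 ≤ e)
    (m : ℕ) : ∃ φ, ExpFam o e m n φ ∧
      ∀ᶠ t in atTop, φ t P q = φ t P' q' ∨ φ t P q = -φ t P' q' := by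
  refine h.exists_fam ?_ ?_ ?_
  · filter_upwards with t
    exact_mod_cast (Real.exp_pos t).ne'
  · exact (ExpFam.lead_K m).eventually_ne_zero one_ne_zero
  · have : Lead e 0 1 fun t => tw (Real.exp t : ℂ) e - 2 :=
      (ExpFam.tw_lead he).sub_small ((Lead.const 2).weaken (by omega))
    exact (this.eventually_ne_zero one_ne_zero).mono fun t ht => sub_ne_zero.1 ht

/-! ### The case of even `m` -/

lemma den_zero (m : ℕ) : den m 0 = m := by simp [den]

/-- The slopes of at most `3 / (3 m + 2)` for even `m`. -/
inductive IsLow (m : ℕ) : ℕ → ℕ → Prop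
  | infinity : IsLow m 1 0
  | small {P q : ℕ} (h : P.Coprime q) (hq : 1 ≤ q) (hle : (m + 2) * q ≤ P) : IsLow m P q
  | between {i j P q : ℕ} (hj : 1 ≤ j) (h : IsBetween (m + 1) i j P q) : IsLow m P q
  | middle {i j P q : ℕ} (h : IsMiddle m i j P q) : IsLow m P q

lemma two_pow_eq_one {k : ℕ} (h : (2 : ℝ) ^ k = 1) : k = 0 := by
  by_contra hk
  exact (one_lt_pow₀ (one_lt_two (α := ℝ)) hk).ne' h

lemma two_pow_injective {k l : ℕ} (h : (2 : ℝ) ^ k = 2 ^ l) : k = l :=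
  Nat.pow_right_injective le_rfl (by exact_mod_cast h)

namespace PolyFam

variable {m n : ℕ} {φ : ℝ → ℕ → ℕ → ℂ}

lemma succ (H : PolyFam (m + 1) m n φ) (hm : 2 ≤ m) (he : Even m) :
    Lead 0 1 (-2) fun t => φ t (m + 1) 1 :=
  (H.pivot (by omega) (by omega) he.add_one).cast rfl (by push_cast; ring) rfl

lemma lead_source (hm : 2 ≤ m) : Lead 1 (m + 2) 1
    fun t => source (m + 1) m (relTrace n) (t : ℂ) (Real.exp t : ℂ) 0 :=
  (source_zero (by omega) (by omega)).cast rfl (by push_cast; ring) rfl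

lemma lead_source' (hm : 2 ≤ m) : Lead 1 (m + 1) (-2)
    fun t => source (m + 1) m (relTrace n) (t : ℂ) (Real.exp t : ℂ) 1 :=
  (source_one (by omega) (by omega)).cast rfl (by push_cast; ring) rfl

lemma lead_source_self (hm : 2 ≤ m) (he : Even m) : Lead 1 (m + 2) 1
    fun t => source (m + 1) m (relTrace n) (t : ℂ) (Real.exp t : ℂ) m := by
  simp only [source_of_even he]
  exact lead_source hm

lemma lead_source_succ (hm : 2 ≤ m) (he : Even m) : Lead 1 (m + 1) (-2)
    fun t => source (m + 1) m (relTrace n) (t : ℂ) (Real.exp t : ℂ) (m + 1) := by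
  simp only [source_of_odd he.add_one]
  exact lead_source' hm

lemma three (H : PolyFam (m + 1) m n φ) (hm : 2 ≤ m) (he : Even m) :
    Lead 1 (m + 2) 1 fun t => φ t (3 * m + 2) 3 :=
  (H.lead_three (by ring) (lead_source_self hm he) ((H.even he (by omega)).weaken (by omega))
    ((H.succ hm he).weaken (by omega))).cast rfl rfl (by ring)

lemma between (H : PolyFam (m + 1) m n φ) (hm : 2 ≤ m) (he : Even m) {i j P q : ℕ}
    (h : IsBetween (m + 1) i j P q) :
    HasLead i ((m + 2) * i + j) (2 ^ j) fun t => φ t P q :=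
  (H.cone_integral h.coprime h.eq h.eq' (by omega) (by omega)
    (H.gt (by omega) (by omega) (by omega)) (H.succ hm he)
    ((tw_lead le_rfl).weaken (by omega))
    (smallSource (by omega) (by omega) (by omega))).cast (by ring) (by push_cast; ring) (by simp)

lemma middle (H : PolyFam (m + 1) m n φ) (hm : 2 ≤ m) (he : Even m) {i j P q : ℕ}
    (h : IsMiddle m i j P q) :
    HasLead j ((m + 2) * j + i) (2 ^ i) fun t => φ t P q :=
  (H.cone_three (by ring) h.coprime h.eq h.eq' (by omega) (by omega) (H.succ hm he) (H.three hm he)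
    (smallSource (by omega) (by omega) (by omega))).cast (by ring) (by ring) (by simp)

lemma den_zero (H : PolyFam (m + 1) m n φ) (hm : 2 ≤ m) (he : Even m) :
    Lead 1 m 1 fun t => φ t (den m 0) (2 * 0 + 1) := by
  simpa [Heckoid.den_zero] using H.even he (by omega)

lemma den_one (H : PolyFam (m + 1) m n φ) (hm : 2 ≤ m) (he : Even m) :
    Lead 1 (m + 1) (-2) fun t => φ t (den m 1) (2 * 1 + 1) :=
  (H.lead_den_one (by ring) (lead_source_succ hm he) ((H.succ hm he).weaken (by omega))
    ((H.even he (by omega)).weaken (by omega))).cast rfl rfl (by ring)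

lemma den (H : PolyFam (m + 1) m n φ) (hm : 2 ≤ m) (he : Even m) (l : ℕ) :
    Lead 1 (m + 2) (hat (relTrace n) l) fun t => φ t (den m l) (2 * l + 1) := by
  have := H.lead_den (l := 0) (k := 0) (by ring) (by simpa using he) (lead_source hm)
    ((lead_source' hm).weaken (by omega))
    (((H.den_zero hm he).weaken (by omega)).cast rfl rfl (by simp [hat]))
    (((H.den_one hm he).weaken (by omega)).cast rfl rfl (by simp [hat])) l
  simpa using this

lemma near_zero (H : PolyFam (m + 1) m n φ) (hm : 2 ≤ m) (he : Even m) {i j P q : ℕ}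
    (h : IsNear m n 0 i j P q) :
    HasLead (i + j) ((m + 1) * i + m * j) (2 ^ i) fun t => φ t P q :=
  (H.cone_den (by ring) h.coprime h.eq h.eq' (by omega) (by omega) (H.den_one hm he)
    (H.den_zero hm he) (smallSource (by omega) (by omega) (by omega))).cast
    (by ring) (by ring) (by simp)

lemma near_one (H : PolyFam (m + 1) m n φ) (hm : 2 ≤ m) (he : Even m) {i j P q : ℕ}
    (h : IsNear m n 1 i j P q) :
    HasLead (i + j) ((m + 2) * i + (m + 1) * j) (2 ^ j) fun t => φ t P q :=
  (H.cone_den (by ring) h.coprime h.eq h.eq' (by omega) (by omega) (H.den hm he 2)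
    (H.den_one hm he) (smallSource (by omega) (by omega) (by omega))).cast
    (by ring) (by ring) (by simp [hat])

lemma near (H : PolyFam (m + 1) m n φ) (hm : 2 ≤ m) (he : Even m) {l i j P q : ℕ}
    (h : IsNear m n l i j P q) :
    HasLead (i + j) ((m + 2) * (i + j))
      (‖hat (relTrace n) (l + 1)‖ ^ i * ‖hat (relTrace n) l‖ ^ j) fun t => φ t P q :=
  (H.cone_den (by ring) h.coprime h.eq h.eq' (by omega) (by omega) (H.den hm he (l + 1))
    (H.den hm he l) (smallSource (by omega) (by omega) (by omega))).cast
    (by ring) (by ring) rfl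

/-- The leading terms for the slopes in `IsLow`. -/
lemma low (H : PolyFam (m + 1) m n φ) (hm : 2 ≤ m) (he : Even m) {P q : ℕ} (h : IsLow m P q) :
    ∃ g h k : ℕ, HasLead g h (2 ^ k) (fun t => φ t P q) ∧
      (g = 0 ∧ P = 1 ∧ q = 0 ∧ h = 1 ∧ k = 0 ∨
        P.Coprime q ∧ 1 ≤ q ∧ (m + 2) * q ≤ P ∧ g = q ∧ h = P ∧ k = 0 ∨
        1 ≤ k ∧ h = (m + 2) * g + k ∧ IsBetween (m + 1) g k P q ∨
        h = (m + 2) * g + k ∧ IsMiddle m k g P q) := by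
  rcases h with _ | ⟨h, hq, hle⟩ | @⟨i, j, _, _, hj, h⟩ | @⟨i, j, _, _, h⟩
  · exact ⟨0, 1, 0, H.infinity.hasLead.cast (by simp) (by simp) (by simp), by simp⟩
  · exact ⟨q, P, 0, (H.small (by omega) (by omega) h hq hle).cast rfl rfl (by simp), by tauto⟩
  · exact ⟨i, (m + 2) * i + j, j, (H.between hm he h).cast rfl (by push_cast; ring) rfl, by tauto⟩
  · exact ⟨j, (m + 2) * j + i, i, (H.middle hm he h).cast rfl (by push_cast; ring) rfl, by tauto⟩

end PolyFam

namespace ExpFam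

variable {m n : ℕ} {φ : ℝ → ℕ → ℕ → ℂ}

lemma succ (H : ExpFam (m + 1) m m n φ) (hm : 2 ≤ m) (he : Even m) :
    Lead 1 1 (-1) fun t => φ t (m + 1) 1 :=
  (H.pivot (by omega) (by omega) le_rfl he.add_one).cast (by ring) rfl rfl

lemma lead_source (hm : 2 ≤ m) : Lead 2 1 1 fun t => source (m + 1) m (relTrace n)
    (Real.exp t : ℂ) ((Real.exp ((-m : ℤ) * t) : ℂ) * (t : ℂ)⁻¹) 0 :=
  (source_zero (by omega) (by omega) (by ring) (by omega) le_rfl).cast (by ring) rfl rfl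

lemma smallSource (hm : 2 ≤ m) {g h : ℤ} (hgh : 2 < g) : SmallSource (m + 1) m n
    (fun t => (Real.exp t : ℂ)) (fun t => (Real.exp ((-m : ℤ) * t) : ℂ) * (t : ℂ)⁻¹) g h :=
  smallSource_of_lead ((lead_source hm).weaken (by omega))
    ((source_one_of_lt hm).weaken (by omega))

lemma three (H : ExpFam (m + 1) m m n φ) (hm : 2 ≤ m) (he : Even m) :
    Lead 2 1 1 fun t => φ t (3 * m + 2) 3 :=
  (H.lead_three (by ring) (by simpa only [source_of_even he] using lead_source hm)
    ((H.even_le he (by omega) le_rfl).weaken (by omega))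
    ((H.succ hm he).weaken (by omega))).cast rfl rfl (by ring)

lemma between (H : ExpFam (m + 1) m m n φ) (hm : 2 ≤ m) (he : Even m) {i j P q : ℕ}
    (h : IsBetween (m + 1) i j P q) :
    HasLead (2 * i + j) (j - i) 1 fun t => φ t P q :=
  (H.cone_integral h.coprime h.eq h.eq' (by omega) (by omega)
    ((H.gt (by omega) (by omega) (by ring) le_rfl (by omega) (by omega)).cast (g' := 2)
      (by push_cast; ring) rfl rfl)
    (H.succ hm he) ((tw_lead le_rfl).weaken (by omega))
    (smallSource hm (by omega))).cast (by ring) (by ring) (by simp)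

lemma middle (H : ExpFam (m + 1) m m n φ) (hm : 2 ≤ m) (he : Even m) {i j P q : ℕ}
    (h : IsMiddle m i j P q) :
    HasLead (2 * j + i) (i + j) 1 fun t => φ t P q :=
  (H.cone_three (by ring) h.coprime h.eq h.eq' (by omega) (by omega) (H.succ hm he) (H.three hm he)
    (smallSource hm (by omega))).cast (by ring) (by ring) (by simp)

end ExpFam

lemma TraceEq.false_of_between_middle {m n i j P q P' q' : ℕ}
    (h : TraceEq (m + 1) m n P q P' q') (hm : 2 ≤ m) (he : Even m) (hi : 1 ≤ i)
    (hP : IsBetween (m + 1) i j P q) (hP' : IsMiddle m j i P' q') : False := by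
  obtain ⟨φ, H, hφ⟩ := h.exists_expFam (by omega) m
  obtain ⟨-, h₁, -⟩ := (H.between hm he hP).eq_of_eq_or_neg one_ne_zero (H.middle hm he hP')
    one_ne_zero hφ
  omega

lemma isBetween_self (p : ℕ) : IsBetween p 1 0 (p + 1) 1 := ⟨by simp, by ring, rfl⟩

/-- Two slopes in `IsLow` are distinguished by their traces. -/
theorem TraceEq.low_low {m n P q P' q' : ℕ} (h : TraceEq (m + 1) m n P q P' q')
    (hm : 2 ≤ m) (he : Even m) (hP : IsLow m P q) (hP' : IsLow m P' q') : P = P' ∧ q = q' := by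
  obtain ⟨φ, H, hφ⟩ := h.exists_polyFam (by omega)
  obtain ⟨g, d, k, L, hL⟩ := H.low hm he hP
  obtain ⟨g', d', k', L', hL'⟩ := H.low hm he hP'
  obtain ⟨hg, hd, hk⟩ := L.eq_of_eq_or_neg (by positivity) L' (by positivity) hφ
  obtain rfl : g = g' := by exact_mod_cast hg
  obtain rfl : d = d' := by exact_mod_cast hd
  obtain rfl := two_pow_injective hk
  have key : ∀ {P q P' q'}, TraceEq (m + 1) m n P q P' q' → P.Coprime q → 1 ≤ q → g = q →
      d = P → k = 0 → d = (m + 2) * g + k → IsMiddle m k g P' q' → False := by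
    rintro P q P' q' h - hq rfl rfl rfl h₁ hP'
    have hg : g = 1 := by simpa using hP'.coprime
    subst hg
    exact h.false_of_between_middle hm he le_rfl
      (by simpa [h₁] using isBetween_self (m + 1)) hP'
  rcases hL with hL | hL | hL | hL <;> rcases hL' with hL' | hL' | hL' | hL'
  · omega
  · omega
  · omega
  · have := hL'.2.pos
    omega
  · omega
  · omega
  · omega
  · exact (key h hL.1 hL.2.1 hL.2.2.2.1 hL.2.2.2.2.1 hL.2.2.2.2.2 hL'.1 hL'.2).elim
  · omega
  · omega
  · have h₁ := hL.2.2
    have h₂ := hL'.2.2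
    exact ⟨h₁.eq.trans h₂.eq.symm, h₁.eq'.trans h₂.eq'.symm⟩
  · exact (h.false_of_between_middle hm he hL'.2.pos hL.2.2 hL'.2).elim
  · have := hL.2.pos
    omega
  · exact (key h.symm hL'.1 hL'.2.1 hL'.2.2.2.1 hL'.2.2.2.2.1 hL'.2.2.2.2.2 hL.1 hL.2).elim
  · exact (h.symm.false_of_between_middle hm he hL.2.pos hL'.2.2 hL.2).elim
  · have h₁ := hL.2
    have h₂ := hL'.2
    exact ⟨h₁.eq.trans h₂.eq.symm, h₁.eq'.trans h₂.eq'.symm⟩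

/-- A slope greater than `1 / m` and a slope in `IsLow` are distinguished by their traces. -/
theorem TraceEq.large_low {m n i j R Q P q P' q' : ℕ} (h : TraceEq (m + 1) m n P q P' q')
    (hm : 2 ≤ m) (he : Even m) (hP : IsLarge (m + 1) R Q i j P q) (hP' : IsLow m P' q') :
    False := by
  obtain ⟨φ, H, hφ⟩ := h.exists_polyFam (by omega)
  obtain ⟨g, d, k, L', hL'⟩ := H.low hm he hP'
  obtain ⟨hg, hd, -⟩ := (H.large (by omega) hP).eq_of_eq_or_neg one_ne_zero L' (by positivity) hφ
  have hq : 1 ≤ q := by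
    by_contra! hq
    have := hP.coprime
    rw [show i = 0 by have := hP.eq'; omega, show j = 0 by have := hP.eq'; omega] at this
    simp at this
  obtain rfl : q = g := by exact_mod_cast hg
  have hd : i * R + j * (m + 1) = d := by exact_mod_cast hd
  have hle : d ≤ (m + 1) * q := by
    rw [← hd, hP.eq']
    have := Nat.mul_le_mul_left i (show R ≤ m + 1 by have := hP.le; omega)
    linarith
  rcases hL' with hL' | hL' | hL' | hL'
  · omega
  · obtain ⟨-, -, h₁, rfl, rfl, -⟩ := hL'
    nlinarith
  · have := hL'.2.1
    nlinarith
  · have := hL'.1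
    nlinarith

/-- A slope greater than `1 / m` and a slope in `IsNear` are distinguished by their traces. -/
theorem TraceEq.large_near {m n i j R Q l i' j' P q P' q' : ℕ}
    (h : TraceEq (m + 1) m n P q P' q') (hm : 2 ≤ m) (he : Even m)
    (hP : IsLarge (m + 1) R Q i j P q) (hP' : IsNear m n l i' j' P' q') : False := by
  obtain ⟨φ, H, hφ⟩ := h.exists_polyFam (by omega)
  have L := H.large (by omega) hP
  have hj := hP'.pos
  match l, hP' with
  | 0, hP' =>
    obtain ⟨-, -, h₁⟩ := L.eq_of_eq_or_neg one_ne_zero (H.near_zero hm he hP') (by positivity) hφ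
    have := two_pow_eq_one h₁.symm
    have := hP'.pos' rfl
    omega
  | 1, hP' =>
    obtain ⟨-, -, h₁⟩ := L.eq_of_eq_or_neg one_ne_zero (H.near_one hm he hP') (by positivity) hφ
    have := two_pow_eq_one h₁.symm
    omega
  | l + 2, hP' =>
    have hl := hP'.le
    have h₂ := hat_ne_zero (n := n) (k := l + 2) (by omega) (by omega)
    have h₃ := hat_ne_zero (n := n) (k := l + 2 + 1) (by omega) (by omega)
    obtain ⟨hg, hd, -⟩ := L.eq_of_eq_or_neg one_ne_zero (H.near hm he hP') (by positivity) hφ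
    have hg : q = i' + j' := by exact_mod_cast hg
    have hd : i * R + j * (m + 1) = (m + 2) * (i' + j') := by exact_mod_cast hd
    rw [← hg, hP.eq'] at hd
    have := Nat.mul_le_mul_left i (show R ≤ m + 1 by have := hP.le; omega)
    have := hP.eq'
    nlinarith

/-- A refinement of `PolyFam.den`. -/
lemma PolyFam.den_sub {m n : ℕ} {φ : ℝ → ℕ → ℕ → ℂ} (H : PolyFam (m + 1) m n φ) (hm : 2 ≤ m)
    (he : Even m) (l : ℕ) : Lead 1 (m + 1) (-2 * hat (relTrace n) (l + 1))
      fun t => φ t (Heckoid.den m l) (2 * l + 1) - hat (relTrace n) l *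
        source (m + 1) m (relTrace n) (t : ℂ) (Real.exp t : ℂ) 0 := by
  refine lead_hat (k := 1) (x := fun l t => φ t (Heckoid.den m l) (2 * l + 1) - hat (relTrace n) l *
        source (m + 1) m (relTrace n) (t : ℂ) (Real.exp t : ℂ) 0)
    (S := fun l t => if Even l then 0 else
      source (m + 1) m (relTrace n) (t : ℂ) (Real.exp t : ℂ) 1) (fun j => ?_) (fun j => ?_) ?_ ?_ l
  · refine H.mono fun t ht => ?_
    simp only [ht.den_add_two (by ring : m + 1 + m = 2 * m + 1), hat]
    by_cases hj : Even j
    · simp only [hj, if_true, source_of_even (he.add hj)]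
      ring
    · simp only [hj, if_false, source_of_odd (he.add_odd (Nat.not_even_iff_odd.1 hj))]
      ring
  · by_cases hj : Even j
    · simpa [hj, Nat.even_add_one] using Lead.const (0 : ℂ) |>.weaken (by omega)
    · simpa [hj, Nat.even_add_one] using lead_source' hm
  · simpa [hat, Heckoid.den_zero] using (H.even he (by omega)).weaken (by omega)
  · simpa [hat] using H.den_one hm he

lemma TraceEq.false_of_low_den {m n l P q : ℕ}
    (h : TraceEq (m + 1) m n P q (den m l) (2 * l + 1)) (hm : 2 ≤ m) (he : Even m)
    (hn : 2 ≤ n) (hl : 2 ≤ l) (hln : l + 3 ≤ 2 * n) (hat_norm : ‖hat (relTrace n) l‖ = 1)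
    (hP : P = m + 2 ∧ q = 1 ∨ P = 3 * m + 2 ∧ q = 3) : False := by
  obtain ⟨φ, H, hφ⟩ := h.exists_polyFam (by omega)
  have hsq : hat (relTrace n) l ^ 2 = 1 := by
    rw [← hat_im hn, Complex.norm_real, Real.norm_eq_abs] at hat_norm
    rw [← hat_im hn]
    exact_mod_cast (by rw [← sq_abs, hat_norm, one_pow] :
      (hat (relTrace n) l).re ^ 2 = 1)
  have h₁ : Lead 1 (m + 2) 1 fun t => φ t P q := by
    rcases hP with ⟨rfl, rfl⟩ | ⟨rfl, rfl⟩
    · exact (H.gt (by omega) (by omega) (by omega)).cast rfl (by push_cast; ring) rfl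
    · exact H.three hm he
  have h₂ : Lead 1 (m + 1) 0 fun t => φ t P q -
      source (m + 1) m (relTrace n) (t : ℂ) (Real.exp t : ℂ) 0 := by
    have hsucc := H.succ hm he
    have heven := (H.even he (by omega)).weaken (g' := 1) (h' := m + 1) (by omega)
    rcases hP with ⟨rfl, rfl⟩ | ⟨rfl, rfl⟩
    · refine ((heven.add ((H.infinity.mul hsucc).weaken (by omega))).neg.congr
        (H.mono fun t ht => ?_)).cast rfl rfl (by ring)
      have := ht.left (p₁ := 1) (q₁ := 0) (p₂ := m) (q₂ := 1) (by ring)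
      rw [show 2 * 1 + m = m + 2 by ring, show 2 * 0 + 1 = 1 from rfl,
        add_comm 1 m, source_of_even he] at this
      rw [this, relTrace]
      ring
    · refine ((heven.add ((hsucc.const_mul (relTrace n)).weaken (by omega))).neg.congr
        (H.mono fun t ht => ?_)).cast rfl rfl (by ring)
      simp only [ht.three (by ring : m + 1 + m = 2 * m + 1), source_of_even he]
      ring
  have h₃ := H.den_sub hm he l
  have h₄ := h₂.sub (h₃.const_mul (hat (relTrace n) l))
  have h₅ := h₁.add ((H.den hm he l).const_mul (hat (relTrace n) l))
  have h₆ := h₄.eventually_ne_zero (by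
    have := hat_ne_zero (n := n) (k := l + 1) (by omega) (by omega)
    have := hat_ne_zero (n := n) (k := l) (by omega) (by omega)
    simp [*])
  have h₇ := h₅.eventually_ne_zero (by rw [← pow_two, hsq]; norm_num)
  obtain ⟨t, h₆, h₇, h₈⟩ := (h₆.and (h₇.and hφ)).exists
  refine mul_ne_zero h₆ h₇ ?_
  have h₉ : φ t P q ^ 2 = φ t (den m l) (2 * l + 1) ^ 2 := by
    rcases h₈ with h₈ | h₈ <;> rw [h₈]
    ring
  linear_combination h₉ + (-φ t (den m l) (2 * l + 1) ^ 2 +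
    source (m + 1) m (relTrace n) (t : ℂ) (Real.exp t : ℂ) 0 *
      (φ t P q + hat (relTrace n) l * φ t (den m l) (2 * l + 1))) * hsq

/-- A slope in `IsLow` and a slope in `IsNear` are distinguished by their traces. -/
theorem TraceEq.low_near {m n l i j P q P' q' : ℕ} (h : TraceEq (m + 1) m n P q P' q')
    (hm : 2 ≤ m) (he : Even m) (hn : 2 ≤ n) (hP : IsLow m P q) (hP' : IsNear m n l i j P' q') :
    False := by
  obtain ⟨φ, H, hφ⟩ := h.exists_polyFam (by omega)
  obtain ⟨g, d, k, L, hL⟩ := H.low hm he hP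
  have hj := hP'.pos
  match l, hP' with
  | 0, hP' =>
    obtain ⟨hg, hd, hk⟩ := L.eq_of_eq_or_neg (by positivity) (H.near_zero hm he hP')
      (by positivity) hφ
    have hi := hP'.pos' rfl
    have hg : g = i + j := by exact_mod_cast hg
    have hd : d = (m + 1) * i + m * j := by exact_mod_cast hd
    have hk := two_pow_injective hk
    rcases hL with hL | hL | hL | hL
    · omega
    · omega
    · nlinarith [hL.2.1]
    · nlinarith [hL.1]
  | 1, hP' =>
    obtain ⟨hg, hd, hk⟩ := L.eq_of_eq_or_neg (by positivity) (H.near_one hm he hP')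
      (by positivity) hφ
    have hg : g = i + j := by exact_mod_cast hg
    have hd : d = (m + 2) * i + (m + 1) * j := by exact_mod_cast hd
    have hk := two_pow_injective hk
    rcases hL with hL | hL | hL | hL
    · omega
    · omega
    · nlinarith [hL.2.1]
    · nlinarith [hL.1]
  | l + 2, hP' =>
    have hl := hP'.le
    have h₂ := hat_ne_zero (n := n) (k := l + 2) (by omega) (by omega)
    have h₃ := hat_ne_zero (n := n) (k := l + 2 + 1) (by omega) (by omega)
    obtain ⟨hg, hd, hk⟩ := L.eq_of_eq_or_neg (by positivity) (H.near hm he hP')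
      (by positivity) hφ
    have hg : g = i + j := by exact_mod_cast hg
    have hd : d = (m + 2) * (i + j) := by exact_mod_cast hd
    rw [← hg] at hd
    have key : g = 1 → k = 0 → (P = m + 2 ∧ q = 1 ∨ P = 3 * m + 2 ∧ q = 3) → False := by
      rintro h₁ rfl h₂
      obtain rfl : i = 0 := by omega
      obtain rfl : j = 1 := by omega
      have hP := hP'.eq
      have hq := hP'.eq'
      simp only [zero_mul, zero_add, one_mul] at hP hq
      subst hP hq
      exact h.false_of_low_den hm he hn (by omega) hl (by simpa using hk.symm) h₂
    rcases hL with hL | ⟨h₁, -, -, h₂, h₃, rfl⟩ | hL | ⟨h₁, hL⟩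
    · omega
    · subst h₂ h₃
      have hg : g = 1 := h₁.symm.eq_one_of_dvd (hd ▸ dvd_mul_left g (m + 2))
      subst hg
      exact key rfl rfl (Or.inl ⟨by simpa using hd, rfl⟩)
    · omega
    · obtain rfl : k = 0 := by omega
      have hg : g = 1 := by simpa using hL.coprime
      subst hg
      exact key rfl rfl (Or.inr ⟨by simpa using hL.eq, by simpa using hL.eq'⟩)

/-! ### The valuations with `τ = e ^ (i (π / ℓ + 1 / t))` and `K = e ^ t` -/

/-- `x` has a nonzero leading term of the given order. -/
def HasOrder (g h : ℤ) (x : ℝ → ℂ) : Prop := ∃ a ≠ 0, Lead g h a x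

lemma HasLead.hasOrder {g h : ℤ} {ν : ℝ} {x : ℝ → ℂ} (hx : HasLead g h ν x) (hν : ν ≠ 0) :
    HasOrder g h x := by
  obtain ⟨a, rfl, ha⟩ := hx
  exact ⟨a, norm_ne_zero_iff.1 hν, ha⟩

namespace HasOrder

variable {g h g' h' : ℤ} {x y : ℝ → ℂ}

lemma eq_of_eq_or_neg (hx : HasOrder g h x) (hy : HasOrder g' h' y)
    (hxy : ∀ᶠ t in atTop, x t = y t ∨ x t = -y t) : g = g' ∧ h = h' := by
  obtain ⟨a, ha, hx⟩ := hx
  obtain ⟨a', ha', hy⟩ := hy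
  have := hx.eq_of_eq_or_neg ha hy ha' hxy
  exact ⟨this.1, this.2.1⟩

lemma cast (hx : HasOrder g h x) (hg : g = g') (hh : h = h') : HasOrder g' h' x := by
  subst hg hh; exact hx

lemma mul (hx : HasOrder g h x) (hy : HasOrder g' h' y) :
    HasOrder (g + g') (h + h') fun t => x t * y t := by
  obtain ⟨a, ha, hx⟩ := hx
  obtain ⟨a', ha', hy⟩ := hy
  exact ⟨_, mul_ne_zero ha ha', hx.mul hy⟩

lemma const_mul (hx : HasOrder g h x) {b : ℂ} (hb : b ≠ 0) : HasOrder g h fun t => b * x t := by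
  obtain ⟨a, ha, hx⟩ := hx
  exact ⟨_, mul_ne_zero hb ha, hx.const_mul b⟩

lemma congr (hx : HasOrder g h x) (hxy : ∀ᶠ t in atTop, x t = y t) : HasOrder g h y := by
  obtain ⟨a, ha, hx⟩ := hx
  exact ⟨a, ha, hx.congr hxy⟩

lemma false_of_small (hx : HasOrder g h x) (hy : Lead g h 0 y)
    (hxy : ∀ᶠ t in atTop, x t = y t ∨ x t = -y t) : False := by
  obtain ⟨a, ha, hx⟩ := hx
  exact ha (by simpa using hx.norm_eq hy hxy)

end HasOrder

/-- The angles `π / ℓ + 1 / t`. -/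
noncomputable def angle (ℓ : ℕ) (t : ℝ) : ℝ := Real.pi / ℓ + t⁻¹

/-- The valuation of `2 i sin (k (π / ℓ + x))` at `x = 0`. -/
def val (ℓ k : ℕ) : ℤ := if ℓ ∣ k then 1 else 0

lemma val_of_lt {ℓ k : ℕ} (hk : 1 ≤ k) (hkl : k < ℓ) : val ℓ k = 0 :=
  if_neg (Nat.not_dvd_of_pos_of_lt hk hkl)

lemma val_self (ℓ : ℕ) : val ℓ ℓ = 1 := if_pos dvd_rfl

lemma val_nonneg (ℓ k : ℕ) : 0 ≤ val ℓ k := by unfold val; split_ifs <;> norm_num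

lemma val_le (ℓ k : ℕ) : val ℓ k ≤ 1 := by unfold val; split_ifs <;> norm_num

lemma tendsto_angle (ℓ k : ℕ) :
    Tendsto (fun t => k * angle ℓ t) atTop (𝓝 (k * (Real.pi / ℓ))) := by
  simpa [angle] using (tendsto_inv_atTop_zero.const_add (Real.pi / ℓ)).const_mul (k : ℝ)

lemma sin_order {ℓ k : ℕ} (hℓ : 1 ≤ ℓ) (hk : 1 ≤ k) :
    HasOrder 0 (-val ℓ k) fun t => (Real.sin (k * angle ℓ t) : ℂ) := by
  have hℓ' : (ℓ : ℝ) ≠ 0 := by positivity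
  unfold val
  split_ifs with h
  · obtain ⟨c, rfl⟩ := h
    have e : ((ℓ * c : ℕ) : ℝ) * (Real.pi / ℓ) = c * Real.pi := by
      push_cast; field_simp
    have hd : HasDerivAt (fun x => Real.sin ((ℓ * c : ℕ) * x))
        (Real.cos ((ℓ * c : ℕ) * (Real.pi / ℓ)) * ((ℓ * c : ℕ) * 1)) (Real.pi / ℓ) :=
      ((hasDerivAt_id _).const_mul _).sin
    have ht := hd.tendsto_slope_zero_right.comp tendsto_inv_atTop_nhdsGT_zero
    refine ⟨_, ?_, ((Complex.continuous_ofReal.tendsto _).comp ht).congr' ?_⟩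
    · rw [e, Real.cos_nat_mul_pi]
      norm_cast
      simp
      constructor <;> rintro rfl <;> simp at hk
    · filter_upwards [eventually_gt_atTop 0] with t ht
      have : (t : ℂ) ≠ 0 := by exact_mod_cast ht.ne'
      simp only [Function.comp_apply, smul_eq_mul, inv_inv, e, Real.sin_nat_mul_pi, sub_zero,
        scale, angle]
      push_cast
      simp
      field_simp
  · refine ⟨(Real.sin (k * (Real.pi / ℓ)) : ℝ), ?_, ?_⟩
    · rw [Complex.ofReal_ne_zero, Ne, Real.sin_eq_zero_iff]
      rintro ⟨c, hc⟩
      refine h (Int.natCast_dvd_natCast.1 ⟨c, ?_⟩)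
      have : (ℓ * c : ℝ) = k := by
        field_simp at hc
        rw [mul_comm]
        exact hc
      exact_mod_cast this.symm
    · have := (Complex.continuous_ofReal.tendsto _).comp
        ((Real.continuous_sin.tendsto _).comp (tendsto_angle ℓ k))
      simpa [Lead, scale, Function.comp_def] using this

/-- The values of `τ`. -/
noncomputable def unit (ℓ : ℕ) (t : ℝ) : ℂ := Complex.exp (angle ℓ t * Complex.I)

lemma tw_unit (ℓ : ℕ) (t : ℝ) (p : ℕ) : tw (unit ℓ t) p = 2 * Real.cos (p * angle ℓ t) := by
  rw [tw, unit, ← Complex.exp_neg, ← Complex.exp_nat_mul, ← Complex.exp_nat_mul,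
    Complex.ofReal_cos, Complex.two_cos]
  push_cast
  ring_nf

lemma tw_unit_sub (ℓ : ℕ) (t : ℝ) (p k : ℕ) : tw (unit ℓ t) (p + 2 * k) - tw (unit ℓ t) p =
    -4 * (Real.sin ((p + k : ℕ) * angle ℓ t) * Real.sin (k * angle ℓ t)) := by
  rw [tw_unit, tw_unit]
  have := Real.cos_sub_cos ((p + 2 * k : ℕ) * angle ℓ t) (p * angle ℓ t)
  rw [show ((p + 2 * k : ℕ) * angle ℓ t + p * angle ℓ t) / 2 = (p + k : ℕ) * angle ℓ t by
    push_cast; ring, show ((p + 2 * k : ℕ) * angle ℓ t - p * angle ℓ t) / 2 = k * angle ℓ t by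
    push_cast; ring] at this
  rw [← mul_sub, ← Complex.ofReal_sub, this]
  push_cast
  ring

lemma tw_unit_lead (ℓ p : ℕ) :
    Lead 0 0 (2 * Real.cos (p * (Real.pi / ℓ))) fun t => tw (unit ℓ t) p := by
  simp only [tw_unit]
  refine Lead.const_mul 2 ?_
  have := (Complex.continuous_ofReal.tendsto _).comp
    ((Real.continuous_cos.tendsto _).comp (tendsto_angle ℓ p))
  simpa [Lead, scale, Function.comp_def] using this

lemma tw_unit_sub_order {ℓ p k : ℕ} (hℓ : 1 ≤ ℓ) (hk : 1 ≤ k) :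
    HasOrder 0 (-val ℓ (p + k) - val ℓ k) fun t => tw (unit ℓ t) (p + 2 * k) - tw (unit ℓ t) p := by
  simp only [tw_unit_sub]
  exact (((sin_order hℓ (by omega)).mul (sin_order hℓ hk)).const_mul (by norm_num)).cast
    (by ring) (by ring)

lemma tw_unit_sub_two_order {ℓ k : ℕ} (hℓ : 1 ≤ ℓ) (hk : 1 ≤ k) :
    HasOrder 0 (-2 * val ℓ k) fun t => tw (unit ℓ t) (2 * k) - 2 := by
  have := tw_unit_sub_order (p := 0) hℓ hk
  simp only [zero_add] at this
  refine (this.cast rfl (by ring)).congr (Eventually.of_forall fun t => ?_)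
  norm_num [tw]

/-- Families with `τ = e ^ (i (π / ℓ + 1 / t))` and `K = e ^ t`. -/
abbrev RootFam (o e n ℓ : ℕ) (φ : ℝ → ℕ → ℕ → ℂ) : Prop :=
  Fam o e n (unit ℓ) (fun t => (Real.exp t : ℂ)) φ

lemma TraceEq.exists_rootFam {o e n P q P' q' : ℕ} (h : TraceEq o e n P q P' q') {ℓ : ℕ}
    (hℓ : 1 ≤ ℓ) (he : Even e) (he' : 1 ≤ e) : ∃ φ, RootFam o e n ℓ φ ∧
      ∀ᶠ t in atTop, φ t P q = φ t P' q' ∨ φ t P q = -φ t P' q' := by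
  refine h.exists_fam (Eventually.of_forall fun t => Complex.exp_ne_zero _)
    (Eventually.of_forall fun t => by exact_mod_cast (Real.exp_pos t).ne') ?_
  obtain ⟨k, rfl⟩ := even_iff_two_dvd.1 he
  obtain ⟨a, ha, h⟩ := tw_unit_sub_two_order (k := k) hℓ (by omega)
  exact (h.eventually_ne_zero ha).mono fun t ht => sub_ne_zero.1 ht

namespace RootFam

variable {o e n ℓ : ℕ} {φ : ℝ → ℕ → ℕ → ℂ}

lemma pivot_lead (hℓ : 1 ≤ ℓ) (he : Even e) (he' : 1 ≤ e) :
    Lead 0 3 0 fun t => pivot o e (relTrace n) (unit ℓ t) (Real.exp t : ℂ) := by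
  obtain ⟨k, rfl⟩ := even_iff_two_dvd.1 he
  obtain ⟨a, ha, h⟩ := tw_unit_sub_two_order (k := k) hℓ (by omega)
  have h₁ := ((tw_unit_lead ℓ o).sub (tw_unit_lead ℓ 1)).const_mul 2
  have h₂ := (((Lead.const (relTrace n)).add (tw_unit_lead ℓ 1)).div Lead.exp one_ne_zero).weaken
    (g' := 0) (h' := 0) (by omega)
  have h₃ : Lead 0 (-2 * val ℓ k) (-a) fun t => 2 - tw (unit ℓ t) (2 * k) :=
    h.neg.congr (Eventually.of_forall fun t => by ring)
  have := val_le ℓ k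
  exact ((h₁.add h₂).div h₃ (neg_ne_zero.2 ha)).weaken (by omega)

lemma smallSource (hℓ : 1 ≤ ℓ) (he : Even e) (he' : 1 ≤ e) {g h : ℤ} (hg : 2 ≤ g) :
    SmallSource o e n (unit ℓ) (fun t => (Real.exp t : ℂ)) g h := by
  have hp := pivot_lead (o := o) (n := n) hℓ he he'
  have h₁ := tw_unit_lead ℓ 1
  have ho := tw_unit_lead ℓ o
  refine smallSource_of_lead ?_ ?_
  · simp only [source, Even.zero, if_true]
    exact ((((Lead.const 4).weaken (by omega)).sub ((h₁.mul hp).weaken (by omega))).add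
      ((Lead.exp.mul ((h₁.mul ho).sub (Lead.const 4))).weaken (by omega))).cast rfl rfl (by ring)
  · simp only [source, Nat.not_even_one, if_false]
    exact ((((hp.const_mul 2).weaken (by omega)).sub ((h₁.const_mul 2).weaken (by omega))).sub
      (((Lead.exp.const_mul 2).mul (ho.sub h₁)).weaken (by omega))).cast rfl rfl (by ring)

lemma even (H : RootFam o e n ℓ φ) (hℓ : 1 ≤ ℓ) {p : ℕ} (hp : Even p) (hp' : 1 ≤ p) :
    HasOrder 1 (-2 * val ℓ (p / 2)) fun t => φ t p 1 := by
  obtain ⟨k, rfl⟩ := even_iff_two_dvd.1 hp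
  obtain ⟨a, ha, h⟩ := tw_unit_sub_two_order (k := k) hℓ (by omega)
  rw [Nat.mul_div_cancel_left _ two_pos]
  exact ⟨a, ha, H.lead_even hp (((Lead.const 2).weaken (by omega)).small_add
    ((Lead.exp.mul h).cast (by ring) (by ring) (by ring)))⟩

lemma odd_lt (H : RootFam o e n ℓ φ) (hℓ : 1 ≤ ℓ) (he : Even e) (he' : 1 ≤ e) {p k : ℕ}
    (hp : Odd p) (hk : 1 ≤ k) (ho : o = p + 2 * k) :
    HasOrder 1 (-val ℓ (p + k) - val ℓ k) fun t => φ t p 1 := by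
  subst ho
  obtain ⟨a, ha, h⟩ := tw_unit_sub_order (p := p) hℓ hk
  refine ⟨-a, neg_ne_zero.2 ha, H.lead_odd hp (((pivot_lead hℓ he he').weaken
    (by omega)).small_add (((Lead.exp.mul h).neg.congr (Eventually.of_forall fun t => ?_)).cast
      (by ring) (by ring) (by ring)))⟩
  ring

lemma odd_gt (H : RootFam o e n ℓ φ) (hℓ : 1 ≤ ℓ) (he : Even e) (he' : 1 ≤ e) {p k : ℕ}
    (hp : Odd p) (hk : 1 ≤ k) (ho : p = o + 2 * k) :
    HasOrder 1 (-val ℓ (o + k) - val ℓ k) fun t => φ t p 1 := by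
  subst ho
  obtain ⟨a, ha, h⟩ := tw_unit_sub_order (p := o) hℓ hk
  exact ⟨a, ha, H.lead_odd hp (((pivot_lead hℓ he he').weaken (by omega)).small_add
    ((Lead.exp.mul h).cast (by ring) (by ring) (by ring)))⟩

lemma large (H : RootFam o e n ℓ φ) (hℓ : 1 ≤ ℓ) (he : Even e) (he' : 1 ≤ e) {P Q i j p q : ℕ}
    (hL : IsLarge o P Q i j p q) {h₁ h₂ : ℤ} (L₁ : HasOrder 1 h₁ fun t => φ t P 1)
    (L₂ : HasOrder 1 h₂ fun t => φ t Q 1) :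
    HasOrder q (i * h₁ + j * h₂) fun t => φ t p q := by
  obtain ⟨a, ha, L₁⟩ := L₁
  obtain ⟨b, hb, L₂⟩ := L₂
  have := Fam.cone_large H hL (by omega) (by omega) L₁ L₂
    ((tw_unit_lead ℓ 1).weaken (by omega)) (smallSource hℓ he he' (by omega))
  refine (this.hasOrder ?_).cast ?_ rfl
  · have := norm_ne_zero_iff.2 ha
    have := norm_ne_zero_iff.2 hb
    positivity
  · rw [hL.eq']
    push_cast
    ring

end RootFam

/-- Slopes greater than `1 / m` are distinguished by their traces. -/
lemma TraceEq.large_large_of_le {o e n R Q i j P q R' Q' i' j' P' q' : ℕ}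
    (h : TraceEq o e n P q P' q') (ho : Odd o) (he : Even e) (he' : 1 ≤ e)
    (hP : IsLarge o R Q i j P q) (hP' : IsLarge o R' Q' i' j' P' q') (hQ : Q' ≤ Q) :
    P = P' ∧ q = q' := by
  obtain ⟨k, rfl⟩ : ∃ k, o = Q + 2 * k := by
    obtain ⟨a, rfl⟩ := ho
    obtain ⟨b, rfl⟩ := hP.odd
    have := hP.le'
    exact ⟨a - b, by omega⟩
  obtain ⟨k', hk'⟩ : ∃ k', Q + 2 * k = Q' + 2 * k' := by
    obtain ⟨a, ha⟩ := ho
    obtain ⟨b, rfl⟩ := hP'.odd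
    have := hP'.le'
    exact ⟨a - b, by omega⟩
  have hk : 1 ≤ k := by have := hP.le'; omega
  have hQ₁ := hP.odd.pos
  have hQ₁' := hP'.odd.pos
  have hR := hP.le
  have hR' := hP'.le
  have hRp := hP.pos
  have hRp' := hP'.pos
  have hV := h.exists_polyFam he'
  obtain ⟨φ, H, hφ⟩ := hV
  obtain ⟨hg, hd, -⟩ := (H.large he' hP).eq_of_eq_or_neg one_ne_zero (H.large he' hP')
    one_ne_zero hφ
  have hg : q = q' := by exact_mod_cast hg
  have hd : i * R + j * (Q + 2 * k) = i' * R' + j' * (Q + 2 * k) := by exact_mod_cast hd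
  refine ⟨?_, hg⟩
  obtain ⟨ψ, K, hψ⟩ := h.exists_rootFam (ℓ := Q + k) (by omega) he he'
  have hℓ : 1 ≤ Q + k := by omega
  have L₁ := (K.even hℓ hP.even hP.pos).cast rfl
    (by rw [val_of_lt (by have := hP.even; grind) (by omega), mul_zero])
  have L₁' := (K.even hℓ hP'.even hP'.pos).cast rfl
    (by rw [val_of_lt (by have := hP'.even; grind) (by omega), mul_zero])
  have L₂ := K.odd_lt hℓ he he' hP.odd hk rfl
  have L₂' := K.odd_lt hℓ he he' hP'.odd (by omega) hk'
  obtain ⟨-, hv⟩ := (K.large hℓ he he' hP L₁ L₂).eq_of_eq_or_neg (K.large hℓ he he' hP' L₁' L₂') hψ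
  rw [val_self, val_of_lt (k := k) hk (by omega), val_of_lt (k := k') (by omega) (by omega)] at hv
  have hi := hP.eq'
  have hi' := hP'.eq'
  rcases hQ.eq_or_lt with rfl | hQ
  · rw [show Q' + k' = Q' + k by omega, val_self] at hv
    obtain rfl : j = j' := by omega
    obtain rfl : i = i' := by omega
    rw [hP.eq, hP'.eq]
    omega
  · rw [val_of_lt (k := Q' + k') (by omega) (by omega)] at hv
    obtain rfl : j = 0 := by omega
    obtain rfl : i = 1 := by simpa using hP.coprime
    rw [hP.eq, hP'.eq]
    rcases (by omega : i' = 0 ∧ j' = 1 ∨ i' = 1 ∧ j' = 0) with ⟨rfl, rfl⟩ | ⟨rfl, rfl⟩ <;> omega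

theorem TraceEq.large_large {o e n R Q i j P q R' Q' i' j' P' q' : ℕ}
    (h : TraceEq o e n P q P' q') (ho : Odd o) (he : Even e) (he' : 1 ≤ e)
    (hP : IsLarge o R Q i j P q) (hP' : IsLarge o R' Q' i' j' P' q') : P = P' ∧ q = q' := by
  rcases le_total Q' Q with hQ | hQ
  · exact h.large_large_of_le ho he he' hP hP' hQ
  · exact (h.symm.large_large_of_le ho he he' hP' hP hQ).imp Eq.symm Eq.symm

/-! ### The case of odd `m`: the valuation with `τ = e ^ t` and `K = e ^ (-m t) / t` -/

/-- The slopes of at most `3 / (3 m + 2)` for odd `m`. -/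
inductive IsFlat (m : ℕ) : ℕ → ℕ → Prop
  | infinity : IsFlat m 1 0
  | small {P q : ℕ} (h : P.Coprime q) (hq : 1 ≤ q) (hle : (m + 1) * q ≤ P) : IsFlat m P q
  | middle {i j P q : ℕ} (h : IsMiddle m i j P q) : IsFlat m P q

/-- The slopes of at least `1 / m` for odd `m`. -/
inductive IsSteep (m : ℕ) : ℕ → ℕ → Prop
  | large {R Q i j P q : ℕ} (h : IsLarge m R Q i j P q) : IsSteep m P q
  | last {i j P q : ℕ} (hi : 1 ≤ i) (h : IsBetween (m - 1) i j P q) : IsSteep m P q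

lemma lt_div_add_one {a P q : ℕ} (hq : 1 ≤ q) (hle : (a + 1) * q ≤ P) : a < P / q :=
  (Nat.le_div_iff_mul_le hq).2 hle

namespace ExpFam

variable {m n : ℕ} {φ : ℝ → ℕ → ℕ → ℂ}

lemma self_of_odd (H : ExpFam m (m + 1) m n φ) (hm : 3 ≤ m) (ho : Odd m) :
    Lead 0 1 (-1) fun t => φ t m 1 :=
  (H.pivot (by omega) (by omega) (by omega) ho).cast (by push_cast; ring) rfl rfl

lemma succ_of_odd (H : ExpFam m (m + 1) m n φ) (hm : 3 ≤ m) :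
    Lead 1 (-1) 1 fun t => φ t (m + 1) 1 :=
  (H.gt (by omega) (by omega) (by ring) (by omega) (by omega) (by omega)).cast
    (by push_cast; ring) rfl rfl

lemma lead_source_of_odd (hm : 3 ≤ m) : Lead 1 1 1 fun t => source m (m + 1) (relTrace n)
    (Real.exp t : ℂ) ((Real.exp ((-m : ℤ) * t) : ℂ) * (t : ℂ)⁻¹) 0 :=
  (source_zero (by omega) (by omega) (by ring) (by omega) (by omega)).cast
    (by push_cast; ring) rfl rfl

lemma smallSource_of_odd (hm : 3 ≤ m) {g h : ℤ} (hgh : 1 < g ∨ 1 = g ∧ 1 < h) :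
    SmallSource m (m + 1) n (fun t => (Real.exp t : ℂ))
      (fun t => (Real.exp ((-m : ℤ) * t) : ℂ) * (t : ℂ)⁻¹) g h :=
  smallSource_of_lead ((lead_source_of_odd hm).weaken (by omega))
    ((source_one_of_gt (by omega)).weaken (by omega))

lemma three_of_odd (H : ExpFam m (m + 1) m n φ) (hm : 3 ≤ m) (ho : Odd m) :
    Lead 1 0 (-2) fun t => φ t (3 * m + 2) 3 :=
  (H.lead_three (by ring)
    (by simpa only [source_of_odd ho] using source_one_of_gt (by omega))
    ((H.self_of_odd hm ho).weaken (by omega))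
    ((H.succ_of_odd hm).weaken (by omega))).cast rfl rfl (by ring)

lemma den_one_of_odd (H : ExpFam m (m + 1) m n φ) (hm : 3 ≤ m) (ho : Odd m) :
    Lead 1 1 1 fun t => φ t (den m 1) (2 * 1 + 1) :=
  (H.lead_den_one (by ring)
    (by simpa only [source_of_even ho.add_one] using lead_source_of_odd hm)
    ((H.succ_of_odd hm).weaken (by omega))
    ((H.self_of_odd hm ho).weaken (by omega))).cast rfl rfl (by ring)

lemma den_of_odd (H : ExpFam m (m + 1) m n φ) (hm : 3 ≤ m) (ho : Odd m) (l : ℕ) :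
    Lead 1 1 (hat (relTrace n) (l + 1)) fun t => φ t (den m l) (2 * l + 1) := by
  have := H.lead_den (l := 0) (k := 1) (by ring) (by simpa using ho.add_one)
    (lead_source_of_odd hm) ((source_one_of_gt (by omega)).weaken (by omega))
    (((H.self_of_odd hm ho).weaken (by omega)).cast rfl rfl (by simp [hat]) |>.congr
      (Eventually.of_forall fun t => by simp [den]))
    ((H.den_one_of_odd hm ho).cast rfl rfl (by simp [hat])) l
  simpa using this

lemma small_of_odd (H : ExpFam m (m + 1) m n φ) (hm : 3 ≤ m) {P q : ℕ} (h : P.Coprime q)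
    (hq : 1 ≤ q) (hle : (m + 1) * q ≤ P) : HasLead (P - m * q) (-q) 1 fun t => φ t P q := by
  obtain ⟨i, j, -, hij, hP, hq'⟩ := exists_isBetween h hq
  have hp := lt_div_add_one hq hle
  generalize P / q = p at *
  refine (H.cone_integral hij hP hq' (by omega) (by omega)
    (H.gt (by omega) (by omega) (by ring) (by omega) (by omega) (by omega))
    (H.gt (by omega) (by omega) (by ring) (by omega) (by omega) (by omega))
    ((tw_lead le_rfl).weaken (by omega))
    (smallSource_of_odd hm (by omega))).cast ?_ ?_ (by simp)
  · conv_rhs => rw [hP, hq']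
    push_cast; ring
  · conv_rhs => rw [hq']
    push_cast; ring

lemma middle_of_odd (H : ExpFam m (m + 1) m n φ) (hm : 3 ≤ m) (ho : Odd m) {i j P q : ℕ}
    (h : IsMiddle m i j P q) : HasLead (i + j) (-i) (2 ^ j) fun t => φ t P q :=
  (H.cone_three (by ring) h.coprime h.eq h.eq' (by omega) (by omega) (H.succ_of_odd hm)
    (H.three_of_odd hm ho) (smallSource_of_odd hm (by omega))).cast
    (by ring) (by ring) (by simp)

lemma flat (H : ExpFam m (m + 1) m n φ) (hm : 3 ≤ m) (ho : Odd m) {P q : ℕ} (h : IsFlat m P q) :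
    ∃ (g d : ℤ) (k : ℕ), HasLead g d (2 ^ k) (fun t => φ t P q) ∧ d ≤ 0 ∧
      (k = 0 ∧ g = P - m * q ∧ d = -q ∨ ∃ i : ℕ, g = i + k ∧ d = -i ∧ IsMiddle m i k P q) := by
  rcases h with _ | ⟨h, hq, hle⟩ | @⟨i, j, _, _, h⟩
  · exact ⟨1, 0, 0, (H.lead_infinity (tw_lead le_rfl)).hasLead.cast (by simp) rfl (by simp),
      le_rfl, by simp⟩
  · exact ⟨P - m * q, -q, 0, (H.small_of_odd hm h hq hle).cast rfl rfl (by simp), by simp, by simp⟩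
  · exact ⟨i + j, -i, j, H.middle_of_odd hm ho h, by simp, Or.inr ⟨i, rfl, rfl, h⟩⟩

lemma near_zero_of_odd (H : ExpFam m (m + 1) m n φ) (hm : 3 ≤ m) (ho : Odd m) {i j P q : ℕ}
    (h : IsNear m n 0 i j P q) : HasLead i (i + j) 1 fun t => φ t P q :=
  (H.cone_den (by ring) h.coprime h.eq h.eq' (by omega) (by omega) (H.den_one_of_odd hm ho)
    ((H.self_of_odd hm ho).congr (Eventually.of_forall fun t => by simp [den]))
    (smallSource_of_odd hm (by omega))).cast (by ring) (by ring) (by simp)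

/-- The orders for the slopes in `IsNear`. -/
lemma near_of_odd (H : ExpFam m (m + 1) m n φ) (hm : 3 ≤ m) (ho : Odd m) {l i j P q : ℕ}
    (h : IsNear m n l i j P q) : ∃ g d : ℤ, 1 ≤ d ∧ HasOrder g d fun t => φ t P q := by
  have hj := h.pos
  have hl := h.le
  match l, h with
  | 0, h => exact ⟨_, _, by omega, (H.near_zero_of_odd hm ho h).hasOrder one_ne_zero⟩
  | l + 1, h =>
    have h₁ := hat_ne_zero (n := n) (k := l + 2) (by omega) (by omega)
    rcases (show l + 5 ≤ 2 * n ∨ l + 2 = 2 * n - 2 by omega) with hln | hln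
    · have h₂ := hat_ne_zero (n := n) (k := l + 3) (by omega) (by omega)
      have := H.cone_den (by ring) h.coprime h.eq h.eq' (by omega) (by omega)
        (H.den_of_odd hm ho _) (H.den_of_odd hm ho _) (smallSource_of_odd hm (by omega))
      exact ⟨_, _, by omega, this.hasOrder (by simp [h₁, h₂])⟩
    · have h₂ : Lead 1 0 (-2) fun t => φ t (den m (l + 1 + 1)) (2 * (l + 1 + 1) + 1) := by
        rw [show l + 1 + 1 = 2 * n - 2 from hln]
        exact (H.three_of_odd hm ho).congr
          ((H.den_last (by ring) (by omega)).mono fun t ht => ht.symm)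
      have := H.cone_den (by ring) h.coprime h.eq h.eq' (by omega) (by omega)
        h₂ (H.den_of_odd hm ho _) (smallSource_of_odd hm (by omega))
      exact ⟨_, _, by omega, this.hasOrder (by simp [h₁])⟩

end ExpFam

/-- Two slopes in `IsFlat` are distinguished by their traces. -/
theorem TraceEq.flat_flat {m n P q P' q' : ℕ} (h : TraceEq m (m + 1) n P q P' q')
    (hm : 3 ≤ m) (ho : Odd m) (hP : IsFlat m P q) (hP' : IsFlat m P' q') : P = P' ∧ q = q' := by
  obtain ⟨φ, H, hφ⟩ := h.exists_expFam (by omega) m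
  obtain ⟨g, d, k, L, -, hL⟩ := H.flat hm ho hP
  obtain ⟨g', d', k', L', -, hL'⟩ := H.flat hm ho hP'
  obtain ⟨rfl, rfl, hk⟩ := L.eq_of_eq_or_neg (by positivity) L' (by positivity) hφ
  obtain rfl := two_pow_injective hk
  rcases hL with ⟨hk, hg, hd⟩ | ⟨i, hg, hd, h₁⟩ <;>
    rcases hL' with ⟨hk', hg', hd'⟩ | ⟨i', hg', hd', h₂⟩
  · obtain rfl : q = q' := by omega
    exact ⟨by omega, rfl⟩
  · have := h₂.pos
    omega
  · have := h₁.pos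
    omega
  · obtain rfl : i = i' := by omega
    exact ⟨h₁.eq.trans h₂.eq.symm, h₁.eq'.trans h₂.eq'.symm⟩

/-- A slope in `IsFlat` and a slope in `IsNear` are distinguished by their traces. -/
theorem TraceEq.flat_near {m n l i j P q P' q' : ℕ} (h : TraceEq m (m + 1) n P q P' q')
    (hm : 3 ≤ m) (ho : Odd m) (hP : IsFlat m P q) (hP' : IsNear m n l i j P' q') : False := by
  obtain ⟨φ, H, hφ⟩ := h.exists_expFam (by omega) m
  obtain ⟨g, d, k, L, hd, -⟩ := H.flat hm ho hP
  obtain ⟨g', d', hd', L'⟩ := H.near_of_odd hm ho hP'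
  obtain ⟨-, h₁⟩ := (L.hasOrder (by positivity)).eq_of_eq_or_neg L' hφ
  omega

/-! ### The case of odd `m`: the other valuations -/

lemma IsTraceFun.den_one_of_odd {m n : ℕ} {τ K : ℂ} {φ : ℕ → ℕ → ℂ}
    (H : IsTraceFun m (m + 1) n τ K φ) (hτ : τ ≠ 0) (hm : 3 ≤ m) (ho : Odd m) :
    φ (den m 1) 3 =
      2 - tw τ 1 * φ m 1 + K * (tw τ (m - 1) - 2) - relTrace n * φ m 1 := by
  obtain ⟨p, rfl⟩ : ∃ p, m = p + 1 := ⟨m - 1, by omega⟩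
  have h₁ := H.integral (p + 1 + 1)
  have h₂ := H.integral (p + 1)
  rw [if_pos ho.add_one] at h₁
  rw [if_neg (Nat.not_even_iff_odd.2 ho), sub_self, mul_zero, add_zero] at h₂
  rw [H.den_one (by ring), h₁, source_of_even ho.add_one, source, if_pos Even.zero, h₂,
    Nat.add_sub_cancel]
  have := tw_mul hτ p
  simp only [relTrace]
  linear_combination K * this

namespace PolyFam

variable {m n : ℕ} {φ : ℝ → ℕ → ℕ → ℂ}

lemma self_of_odd (H : PolyFam m (m + 1) n φ) (hm : 3 ≤ m) (ho : Odd m) :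
    Lead 0 (-1) (-2) fun t => φ t m 1 :=
  (H.pivot (by omega) (by omega) ho).cast rfl (by push_cast; ring) rfl

lemma den_one_of_odd (H : PolyFam m (m + 1) n φ) (hm : 3 ≤ m) (ho : Odd m) :
    Lead 1 (m - 1) 1 fun t => φ t (Heckoid.den m 1) (2 * 1 + 1) := by
  have hf := H.self_of_odd hm ho
  have h₁ := ((tw_lead le_rfl).mul hf).weaken (g' := 1) (h' := m - 1) (by omega)
  have h₂ := Lead.exp.mul ((tw_lead (p := m - 1) (by omega)).sub_small
    ((Lead.const 2).weaken (by omega)))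
  have h₃ := (hf.const_mul (relTrace n)).weaken (g' := 1) (h' := m - 1) (by omega)
  have h₄ := ((((Lead.const 2).weaken (by omega)).sub h₁).cast rfl rfl (sub_zero 0)).small_add
    (h₂.cast (g' := 1) (h' := m - 1) (a' := 1) (by ring)
      (by push_cast [show 1 ≤ m by omega]; ring) (mul_one 1))
  refine (h₄.sub_small h₃).congr ?_
  filter_upwards [H, eventually_gt_atTop 0] with t ht ht'
  exact (ht.den_one_of_odd (by exact_mod_cast ht'.ne') hm ho).symm

lemma den_two_of_odd (H : PolyFam m (m + 1) n φ) (hm : 3 ≤ m) (ho : Odd m) :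
    Lead 1 m (-2) fun t => φ t (Heckoid.den m 2) (2 * 2 + 1) :=
  (H.lead_den_two (by ring)
    (by simpa only [source_of_odd ho] using source_one (by omega) (by omega))
    ((H.self_of_odd hm ho).weaken (by omega))
    ((H.den_one_of_odd hm ho).weaken (by omega))).cast rfl rfl (by ring)

lemma den_of_odd (H : PolyFam m (m + 1) n φ) (hm : 3 ≤ m) (ho : Odd m) (l : ℕ) :
    Lead 1 (m + 1) (hat (relTrace n) l)
      fun t => φ t (Heckoid.den m (l + 1)) (2 * (l + 1) + 1) := by
  have := H.lead_den (l := 1) (k := 0) (by ring) (by simpa using ho.add_one)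
    (source_zero (by omega) (by omega)) ((source_one (by omega) (by omega)).weaken (by omega))
    (((H.den_one_of_odd hm ho).weaken (by omega)).cast rfl rfl (by simp [hat]))
    (((H.den_two_of_odd hm ho).weaken (by omega)).cast rfl rfl (by simp [hat])) l
  simpa [add_comm 1] using this

lemma near_one_of_odd (H : PolyFam m (m + 1) n φ) (hm : 3 ≤ m) (ho : Odd m) {i j P q : ℕ}
    (h : IsNear m n 1 i j P q) :
    HasLead (i + j) (m * i + (m - 1) * j) (2 ^ i) fun t => φ t P q :=
  (H.cone_den (by ring) h.coprime h.eq h.eq' (by omega) (by omega) (H.den_two_of_odd hm ho)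
    (H.den_one_of_odd hm ho) (smallSource (by omega) (by omega) (by omega))).cast
    (by ring) (by ring) (by simp)

lemma near_two_of_odd (H : PolyFam m (m + 1) n φ) (hm : 3 ≤ m) (ho : Odd m) {i j P q : ℕ}
    (h : IsNear m n 2 i j P q) :
    HasLead (i + j) ((m + 1) * i + m * j) (2 ^ j) fun t => φ t P q :=
  (H.cone_den (by ring) h.coprime h.eq h.eq' (by omega) (by omega) (H.den_of_odd hm ho 2)
    (H.den_two_of_odd hm ho) (smallSource (by omega) (by omega) (by omega))).cast
    (by ring) (by ring) (by simp [hat])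

lemma near_of_odd (H : PolyFam m (m + 1) n φ) (hm : 3 ≤ m) (ho : Odd m) {l i j P q : ℕ}
    (h : IsNear m n (l + 1) i j P q) :
    HasLead (i + j) ((m + 1) * (i + j))
      (‖hat (relTrace n) (l + 1)‖ ^ i * ‖hat (relTrace n) l‖ ^ j) fun t => φ t P q :=
  (H.cone_den (by ring) h.coprime h.eq h.eq' (by omega) (by omega) (H.den_of_odd hm ho (l + 1))
    (H.den_of_odd hm ho l) (smallSource (by omega) (by omega) (by omega))).cast
    (by ring) (by ring) rfl

end PolyFam

lemma IsLarge.one_le {o R Q i j P q : ℕ} (hP : IsLarge o R Q i j P q) : 1 ≤ q := by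
  by_contra! hq
  have := hP.coprime
  rw [show i = 0 by have := hP.eq'; omega, show j = 0 by have := hP.eq'; omega] at this
  simp at this

namespace RootFam

variable {m n ℓ : ℕ} {φ : ℝ → ℕ → ℕ → ℂ}

lemma pivot_of_odd (hℓ : 2 ≤ ℓ) (hm : m + 1 = 2 * ℓ) : HasOrder 0 1
    fun t => Heckoid.pivot m (m + 1) (relTrace n) (unit ℓ t) (Real.exp t : ℂ) := by
  obtain ⟨k, rfl⟩ : ∃ k, ℓ = k + 1 := ⟨ℓ - 1, by omega⟩
  obtain rfl : m = 1 + 2 * k := by omega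
  obtain ⟨a, ha, h₁⟩ := (tw_unit_sub_order (ℓ := k + 1) (p := 1) (k := k) (by omega)
    (by omega)).cast (g' := 0) (h' := -1) rfl
    (by rw [add_comm 1 k, val_self, val_of_lt (k := k) (by omega) (by omega)]; ring)
  obtain ⟨b, hb, h₂⟩ := (tw_unit_sub_two_order (ℓ := k + 1) (k := k + 1) (by omega)
    (by omega)).cast (g' := 0) (h' := -2) rfl (by rw [val_self]; ring)
  have h₃ := (((Lead.const (relTrace n)).add (tw_unit_lead (k + 1) 1)).div Lead.exp
    one_ne_zero).weaken (g' := 0) (h' := -1) (by omega)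
  have h₄ : Lead 0 (-2) (-b) fun t => 2 - tw (unit (k + 1) t) (1 + 2 * k + 1) :=
    h₂.neg.congr (Eventually.of_forall fun t => by
      rw [show 1 + 2 * k + 1 = 2 * (k + 1) by ring]; ring)
  have h₅ := ((h₁.const_mul 2).add_small h₃).div h₄ (neg_ne_zero.2 hb)
  exact ⟨2 * a / -b, div_ne_zero (mul_ne_zero two_ne_zero ha) (neg_ne_zero.2 hb),
    h₅.cast rfl rfl rfl⟩

lemma self_of_odd (H : RootFam m (m + 1) n ℓ φ) (hℓ : 2 ≤ ℓ) (hm : m + 1 = 2 * ℓ) :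
    HasOrder 0 1 fun t => φ t m 1 := by
  obtain ⟨a, ha, h⟩ := pivot_of_odd (n := n) hℓ hm
  exact ⟨a, ha, H.lead_pivot (by grind) h⟩

lemma succ_of_odd (H : RootFam m (m + 1) n ℓ φ) (hℓ : 2 ≤ ℓ) (hm : m + 1 = 2 * ℓ) :
    HasOrder 1 (-2) fun t => φ t (m + 1) 1 :=
  (H.even (by omega) (by grind) (by omega)).cast rfl
    (by rw [show (m + 1) / 2 = ℓ by omega, val_self]; ring)

lemma pred_of_odd (H : RootFam m (m + 1) n ℓ φ) (hℓ : 2 ≤ ℓ) (hm : m + 1 = 2 * ℓ) {p : ℕ}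
    (hp : Even p) (hp' : 1 ≤ p) (hpm : p < m) : HasOrder 1 0 fun t => φ t p 1 :=
  (H.even (by omega) hp hp').cast rfl
    (by rw [val_of_lt (by grind) (by omega)]; ring)

lemma odd_lt_of_odd (H : RootFam m (m + 1) n ℓ φ) (hℓ : 2 ≤ ℓ) (hm : m + 1 = 2 * ℓ) {p : ℕ}
    (hp : Odd p) (hpm : p < m) :
    HasOrder 1 (if p = 1 then -1 else 0) fun t => φ t p 1 := by
  obtain ⟨k, hk⟩ : ∃ k, m = p + 2 * k := by
    obtain ⟨a, rfl⟩ := hp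
    exact ⟨ℓ - 1 - a, by omega⟩
  have := hp.pos
  refine (H.odd_lt (by omega) (by grind) (by omega) hp (k := k) (by omega) hk).cast rfl ?_
  rw [val_of_lt (k := k) (by omega) (by omega)]
  split_ifs with h
  · rw [show p + k = ℓ by omega, val_self]; ring
  · rw [val, if_neg]
    · ring
    · rintro ⟨c, hc⟩
      have : c < 2 := by
        by_contra! hc'
        nlinarith
      interval_cases c <;> omega

lemma gt_of_odd (H : RootFam m (m + 1) n ℓ φ) (hℓ : 2 ≤ ℓ) (hm : m + 1 = 2 * ℓ) {p : ℕ}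
    (hpm : m < p) : ∃ d ≤ 0, HasOrder 1 d fun t => φ t p 1 := by
  rcases Nat.even_or_odd p with hp | hp
  · exact ⟨_, by have := val_nonneg ℓ (p / 2); omega, H.even (by omega) hp (by omega)⟩
  · obtain ⟨k, hk⟩ : ∃ k, p = m + 2 * k := by
      obtain ⟨a, rfl⟩ := hp
      exact ⟨a + 1 - ℓ, by omega⟩
    exact ⟨_, by have := val_nonneg ℓ (m + k); have := val_nonneg ℓ k; omega,
      H.odd_gt (by omega) (by grind) (by omega) hp (k := k) (by omega) hk⟩

lemma lead_source_zero (hℓ : 2 ≤ ℓ) (hm : m + 1 = 2 * ℓ) : HasOrder 1 0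
    fun t => source m (m + 1) (relTrace n) (unit ℓ t) (Real.exp t : ℂ) 0 := by
  simp only [source, Even.zero, if_true]
  obtain ⟨a, -, hp⟩ := pivot_of_odd (n := n) hℓ hm
  have h₁ := tw_unit_lead ℓ 1
  have h₂ := tw_unit_lead ℓ m
  have h₃ := Lead.exp.mul ((h₁.mul h₂).sub (Lead.const 4))
  refine ⟨_, ?_, ((((Lead.const 4).weaken (by omega)).sub ((h₁.mul hp).weaken (by omega))).add
    (h₃.cast (by ring) (by ring) rfl))⟩
  have hℓ' : (ℓ : ℝ) ≠ 0 := by positivity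
  have hcos : Real.cos (m * (Real.pi / ℓ)) = Real.cos (Real.pi / ℓ) := by
    have : (m : ℝ) = 2 * ℓ - 1 := by
      rw [eq_sub_iff_add_eq]
      exact_mod_cast hm
    rw [this, sub_mul, one_mul, mul_assoc, mul_div_cancel₀ _ hℓ', Real.cos_two_pi_sub]
  have hsin : 0 < Real.sin (Real.pi / ℓ) :=
    Real.sin_pos_of_pos_of_lt_pi (by positivity)
      (div_lt_self Real.pi_pos (by exact_mod_cast hℓ))
  have := Real.sin_sq_add_cos_sq (Real.pi / ℓ)
  rw [hcos, sub_zero, zero_add, one_mul, Nat.cast_one, one_mul]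
  norm_cast
  nlinarith

lemma lead_source_one (hℓ : 2 ≤ ℓ) (hm : m + 1 = 2 * ℓ) : HasOrder 1 (-1)
    fun t => source m (m + 1) (relTrace n) (unit ℓ t) (Real.exp t : ℂ) 1 := by
  simp only [source, Nat.not_even_one, if_false]
  obtain ⟨a, -, hp⟩ := pivot_of_odd (n := n) hℓ hm
  obtain ⟨k, rfl⟩ : ∃ k, ℓ = k + 1 := ⟨ℓ - 1, by omega⟩
  obtain rfl : m = 1 + 2 * k := by omega
  obtain ⟨b, hb, h₁⟩ := (tw_unit_sub_order (ℓ := k + 1) (p := 1) (k := k) (by omega)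
    (by omega)).cast (g' := 0) (h' := -1) rfl
    (by rw [add_comm 1 k, val_self, val_of_lt (k := k) (by omega) (by omega)]; ring)
  have h₂ := ((hp.const_mul 2).weaken (by omega)).sub
    (((tw_unit_lead (k + 1) 1).const_mul 2).weaken (g' := 1) (h' := -1) (by omega))
  have h₃ := (Lead.exp.const_mul 2).mul h₁
  exact ⟨_, by simpa using hb, h₂.sub (h₃.cast (by ring) (by ring) rfl)⟩

lemma smallSource_of_odd (hℓ : 2 ≤ ℓ) (hm : m + 1 = 2 * ℓ) {g h : ℤ} (hgh : 1 < g ∨ 1 = g ∧ 0 < h) :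
    SmallSource m (m + 1) n (unit ℓ) (fun t => (Real.exp t : ℂ)) g h := by
  obtain ⟨a, -, h₁⟩ := lead_source_zero (n := n) hℓ hm
  obtain ⟨b, -, h₂⟩ := lead_source_one (n := n) hℓ hm
  exact smallSource_of_lead (h₁.weaken (by omega)) (h₂.weaken (by omega))

lemma three_of_odd (H : RootFam m (m + 1) n ℓ φ) (hℓ : 2 ≤ ℓ) (hm : m + 1 = 2 * ℓ) :
    HasOrder 1 (-1) fun t => φ t (3 * m + 2) 3 := by
  obtain ⟨a, ha, h₀⟩ := lead_source_one (n := n) hℓ hm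
  obtain ⟨b, -, h₁⟩ := H.self_of_odd hℓ hm
  obtain ⟨c, -, h₂⟩ := H.succ_of_odd hℓ hm
  exact ⟨a, ha, (H.lead_three (by ring)
    (by simpa only [source_of_odd (show Odd m by grind)] using h₀)
    (h₁.weaken (by omega)) (h₂.weaken (by omega))).cast rfl rfl (by ring)⟩

lemma den_of_odd (H : RootFam m (m + 1) n ℓ φ) (hℓ : 2 ≤ ℓ) (hm : m + 1 = 2 * ℓ) :
    ∃ κ : ℂ, κ ≠ 0 ∧ ∀ l, Lead 1 0 (κ * hat (relTrace n) (l + 1))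
      fun t => φ t (den m l) (2 * l + 1) := by
  obtain ⟨κ, hκ, h₀⟩ := lead_source_zero (n := n) hℓ hm
  obtain ⟨a, -, h₁⟩ := lead_source_one (n := n) hℓ hm
  obtain ⟨b, -, hf⟩ := H.self_of_odd hℓ hm
  obtain ⟨c, -, hs⟩ := H.succ_of_odd hℓ hm
  have hf := hf.weaken (g' := 1) (h' := 0) (by omega)
  have ho : Odd m := by grind
  refine ⟨κ, hκ, fun l => ?_⟩
  have := H.lead_den (l := 0) (k := 1) (by ring) (by simpa using ho.add_one) h₀
    (h₁.weaken (by omega))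
    ((hf.cast rfl rfl (by simp [hat])).congr (Eventually.of_forall fun t => by simp [den]))
    ((H.lead_den_one (by ring) (by simpa only [source_of_even ho.add_one] using h₀)
      (hs.weaken (by omega)) hf).cast rfl rfl (by simp [hat])) l
  simpa using this

end RootFam

/-! ### The case of odd `m`: comparison of traces -/

namespace RootFam

variable {m n ℓ : ℕ} {φ : ℝ → ℕ → ℕ → ℂ}

lemma large_of_odd (H : RootFam m (m + 1) n ℓ φ) (hℓ : 2 ≤ ℓ) (hm : m + 1 = 2 * ℓ)
    {R Q i j P q : ℕ} (h : IsLarge m R Q i j P q) :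
    HasOrder q (if Q = 1 then -j else 0) fun t => φ t P q := by
  have hR := h.le
  have hQ := h.le'
  refine (H.large (by omega) (by grind) (by omega) h
    (H.pred_of_odd hℓ hm h.even h.pos (by omega))
    (H.odd_lt_of_odd hℓ hm h.odd (by omega))).cast rfl ?_
  split_ifs <;> ring

lemma last_of_odd (H : RootFam m (m + 1) n ℓ φ) (hℓ : 2 ≤ ℓ) (hm : m + 1 = 2 * ℓ)
    {i j P q : ℕ} (h : IsBetween (m - 1) i j P q) : HasOrder j i fun t => φ t P q := by
  obtain ⟨a, ha, h₁⟩ := H.self_of_odd hℓ hm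
  obtain ⟨b, hb, h₂⟩ := H.pred_of_odd hℓ hm (p := m - 1) (by grind) (by omega) (by omega)
  have := H.cone_integral h.coprime h.eq h.eq' (by omega) (by omega)
    (h₁.congr (Eventually.of_forall fun t => by rw [Nat.sub_add_cancel (by omega)])) h₂
    ((tw_unit_lead ℓ 1).weaken (by omega)) (smallSource_of_odd hℓ hm (by omega))
  exact (this.hasOrder (by simp [ha, hb])).cast (by ring) (by ring)

lemma small_of_odd (H : RootFam m (m + 1) n ℓ φ) (hℓ : 2 ≤ ℓ) (hm : m + 1 = 2 * ℓ)
    {P q : ℕ} (h : P.Coprime q) (hq : 1 ≤ q) (hle : (m + 1) * q ≤ P) :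
    ∃ d ≤ 0, HasOrder q d fun t => φ t P q := by
  obtain ⟨i, j, -, hij⟩ := exists_isBetween h hq
  have hp := lt_div_add_one hq hle
  obtain ⟨d₁, hd₁, a, ha, h₁⟩ := H.gt_of_odd hℓ hm (p := P / q + 1) (by omega)
  obtain ⟨d₂, hd₂, b, hb, h₂⟩ := H.gt_of_odd hℓ hm hp
  have := H.cone_integral hij.coprime hij.eq hij.eq' (by omega) (by omega) h₁ h₂
    ((tw_unit_lead ℓ 1).weaken (by omega)) (smallSource_of_odd hℓ hm (by omega))
  refine ⟨_, ?_, (this.hasOrder (by simp [ha, hb])).cast ?_ rfl⟩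
  · have := mul_nonpos_of_nonneg_of_nonpos (Int.natCast_nonneg i) hd₁
    have := mul_nonpos_of_nonneg_of_nonpos (Int.natCast_nonneg j) hd₂
    omega
  · have := hij.eq'
    omega

lemma middle_of_odd (H : RootFam m (m + 1) n ℓ φ) (hℓ : 2 ≤ ℓ) (hm : m + 1 = 2 * ℓ)
    {i j P q : ℕ} (h : IsMiddle m i j P q) : HasOrder (i + j) (-2 * i - j) fun t => φ t P q := by
  obtain ⟨a, ha, h₁⟩ := H.succ_of_odd hℓ hm
  obtain ⟨b, hb, h₂⟩ := H.three_of_odd hℓ hm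
  have := H.cone_three (by ring) h.coprime h.eq h.eq' (by omega) (by omega) h₁ h₂
    (smallSource_of_odd hℓ hm (by omega))
  exact (this.hasOrder (by simp [ha, hb])).cast (by ring) (by ring)

lemma near_zero_of_odd (H : RootFam m (m + 1) n ℓ φ) (hℓ : 2 ≤ ℓ) (hm : m + 1 = 2 * ℓ)
    {i j P q : ℕ} (h : IsNear m n 0 i j P q) : HasOrder i j fun t => φ t P q := by
  obtain ⟨κ, hκ, hd⟩ := H.den_of_odd hℓ hm
  obtain ⟨a, ha, h₁⟩ := H.self_of_odd hℓ hm
  have hn := h.le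
  have h₂ := hat_ne_zero (n := n) (k := 2) le_rfl (by omega)
  have := H.cone_den (by ring) h.coprime h.eq h.eq' (by omega) (by omega) (hd 1)
    (h₁.congr (Eventually.of_forall fun t => by simp [den]))
    (smallSource_of_odd hℓ hm (by omega))
  exact (this.hasOrder (by simp [ha, hκ, h₂])).cast (by ring) (by ring)

lemma near_of_odd (H : RootFam m (m + 1) n ℓ φ) (hℓ : 2 ≤ ℓ) (hm : m + 1 = 2 * ℓ)
    {l i j P q : ℕ} (h : IsNear m n (l + 1) i j P q) :
    ∃ g : ℤ, ∃ d ≤ 0, HasOrder g d fun t => φ t P q := by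
  obtain ⟨κ, hκ, hd⟩ := H.den_of_odd hℓ hm
  have hn := h.le
  have h₁ := hat_ne_zero (n := n) (k := l + 1 + 1) (by omega) (by omega)
  rcases (show l + 5 ≤ 2 * n ∨ l + 1 + 1 = 2 * n - 2 by omega) with hln | hln
  · have h₂ := hat_ne_zero (n := n) (k := l + 1 + 1 + 1) (by omega) (by omega)
    have := H.cone_den (by ring) h.coprime h.eq h.eq' (by omega) (by omega) (hd _) (hd _)
      (smallSource_of_odd hℓ hm (by omega))
    exact ⟨_, _, by omega, this.hasOrder (by simp [hκ, h₁, h₂])⟩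
  · obtain ⟨a, ha, h₂⟩ := H.three_of_odd hℓ hm
    have := H.cone_den (by ring) h.coprime h.eq h.eq' (by omega) (by omega)
      (h₂.congr ((H.den_last (by ring) (by omega)).mono fun t ht => by rw [hln]; exact ht.symm))
      (hd _) (smallSource_of_odd hℓ hm (by omega))
    exact ⟨_, _, by omega, this.hasOrder (by simp [hκ, h₁, ha])⟩

end RootFam

lemma ExpFam.last_of_odd {m n i j P q : ℕ} {φ : ℝ → ℕ → ℕ → ℂ} (H : ExpFam m (m + 1) m n φ)
    (hm : 3 ≤ m) (ho : Odd m) (hj : 1 ≤ j) (h : IsBetween (m - 1) i j P q) :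
    Lead j (i + j) 0 fun t => φ t P q :=
  ((H.cone_integral h.coprime h.eq h.eq' (by omega) (by omega)
    ((H.self_of_odd hm ho).congr (Eventually.of_forall fun t => by
      rw [Nat.sub_add_cancel (by omega)]))
    ((H.even_le (by grind) (by omega) (by omega)).weaken (g' := 1) (h' := 1) (by omega))
    ((tw_lead le_rfl).weaken (by omega)) (smallSource_of_odd hm (by omega))).cast
    (g' := j) (h' := i + j) (by ring) (by ring) (by simp; omega)).lead_zero

/-- A slope greater than `1 / (m - 1)` and a slope in `IsFlat` are distinguished by their
traces. -/
lemma TraceEq.large_flat {m n R Q i j P q P' q' : ℕ} (h : TraceEq m (m + 1) n P q P' q')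
    (hm : 3 ≤ m) (ho : Odd m) (hP : IsLarge m R Q i j P q) (hP' : IsFlat m P' q') : False := by
  obtain ⟨ℓ, hℓ⟩ : ∃ ℓ, m + 1 = 2 * ℓ := by obtain ⟨a, rfl⟩ := ho; exact ⟨a + 1, by ring⟩
  have hq := hP.one_le
  have hqij := hP.eq'
  obtain ⟨ψ, K, hψ⟩ := h.exists_rootFam (ℓ := ℓ) (by omega) (by grind) (by omega)
  have L := K.large_of_odd (by omega) hℓ hP
  rcases hP' with _ | ⟨h', hq', hle⟩ | @⟨i', j', _, _, h'⟩
  · exact L.false_of_small ((K.lead_infinity (tw_unit_lead ℓ 1)).weaken (by omega)) hψ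
  · obtain ⟨φ, H, hφ⟩ := h.exists_polyFam (by omega)
    obtain ⟨hg, hd, -⟩ := (H.large (by omega) hP).eq_of_eq_or_neg one_ne_zero
      (H.small (by omega) (by omega) h' hq' hle) one_ne_zero hφ
    have hg : q = q' := by exact_mod_cast hg
    have hd : i * R + j * m = P' := by exact_mod_cast hd
    have := Nat.mul_le_mul_left i (show R ≤ m by have := hP.le; omega)
    subst hg
    nlinarith
  · have hj' := h'.pos
    obtain ⟨hg, hd⟩ := L.eq_of_eq_or_neg (K.middle_of_odd (by omega) hℓ h') hψ
    have hQ : Q = 1 := by by_contra hQ; rw [if_neg hQ] at hd; omega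
    rw [if_pos hQ] at hd
    obtain ⟨rfl, rfl, rfl⟩ : i = 0 ∧ i' = 0 ∧ j = j' := by omega
    obtain rfl : j = 1 := by simpa using hP.coprime
    obtain ⟨φ, H, hφ⟩ := h.exists_expFam (by omega) m
    have hL : Lead 0 1 (-1) fun t => φ t P q := by
      rw [hP.eq, hP.eq', hQ]
      simpa using H.odd_lt (by omega) (by omega) (by omega) (by ring) odd_one (by omega)
    have := hL.hasLead.eq_of_eq_or_neg (by simp) (H.middle_of_odd hm ho h') (by positivity) hφ
    simp at this

lemma TraceEq.last_flat {m n i j P q P' q' : ℕ} (h : TraceEq m (m + 1) n P q P' q')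
    (hm : 3 ≤ m) (ho : Odd m) (hi : 1 ≤ i) (hP : IsBetween (m - 1) i j P q)
    (hP' : IsFlat m P' q') : False := by
  obtain ⟨ℓ, hℓ⟩ : ∃ ℓ, m + 1 = 2 * ℓ := by obtain ⟨a, rfl⟩ := ho; exact ⟨a + 1, by ring⟩
  obtain ⟨ψ, K, hψ⟩ := h.exists_rootFam (ℓ := ℓ) (by omega) (by grind) (by omega)
  have L := K.last_of_odd (by omega) hℓ hP
  rcases hP' with _ | ⟨h', hq', hle⟩ | @⟨i', j', _, _, h'⟩
  · exact L.false_of_small ((K.lead_infinity (tw_unit_lead ℓ 1)).weaken (by omega)) hψ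
  · obtain ⟨d, hd, L'⟩ := K.small_of_odd (by omega) hℓ h' hq' hle
    have := (L.eq_of_eq_or_neg L' hψ).2
    omega
  · have := (L.eq_of_eq_or_neg (K.middle_of_odd (by omega) hℓ h') hψ).2
    omega

/-- A slope in `IsSteep` and a slope in `IsFlat` are distinguished by their traces. -/
theorem TraceEq.steep_flat {m n P q P' q' : ℕ} (h : TraceEq m (m + 1) n P q P' q')
    (hm : 3 ≤ m) (ho : Odd m) (hP : IsSteep m P q) (hP' : IsFlat m P' q') : False := by
  rcases hP with hP | ⟨hi, hP⟩
  · exact h.large_flat hm ho hP hP'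
  · exact h.last_flat hm ho hi hP hP'

lemma TraceEq.large_near_of_odd {m n R Q i j l i' j' P q P' q' : ℕ}
    (h : TraceEq m (m + 1) n P q P' q') (hm : 3 ≤ m) (ho : Odd m)
    (hP : IsLarge m R Q i j P q) (hP' : IsNear m n l i' j' P' q') : False := by
  have hj' := hP'.pos
  obtain ⟨φ, H, hφ⟩ := h.exists_polyFam (by omega)
  have L := H.large (by omega) hP
  match l, hP' with
  | 0, hP' =>
    obtain ⟨ℓ, hℓ⟩ : ∃ ℓ, m + 1 = 2 * ℓ := by obtain ⟨a, rfl⟩ := ho; exact ⟨a + 1, by ring⟩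
    obtain ⟨ψ, K, hψ⟩ := h.exists_rootFam (ℓ := ℓ) (by omega) (by grind) (by omega)
    have := ((K.large_of_odd (by omega) hℓ hP).eq_of_eq_or_neg
      (K.near_zero_of_odd (by omega) hℓ hP') hψ).2
    split_ifs at this <;> omega
  | 1, hP' =>
    obtain ⟨hg, hd, h₁⟩ := L.eq_of_eq_or_neg one_ne_zero (H.near_one_of_odd hm ho hP')
      (by positivity) hφ
    obtain rfl := two_pow_eq_one h₁.symm
    obtain rfl : j' = 1 := by simpa using hP'.coprime
    have hq := hP.eq'
    have hR := hP.le
    rcases (show i = 0 ∧ j = 1 ∨ i = 1 ∧ j = 0 by omega) with ⟨rfl, rfl⟩ | ⟨rfl, rfl⟩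
    · omega
    obtain ⟨ψ, K, hψ⟩ := h.exists_expFam (by omega) m
    have hL : Lead 0 0 2 fun t => ψ t P q := by
      rw [hP.eq, hP.eq']
      simpa using K.even_le hP.even hP.pos (by omega)
    have hL' : Lead 1 1 1 fun t => ψ t P' q' := by
      rw [hP'.eq, hP'.eq']
      simpa using K.den_one_of_odd hm ho
    have := (hL.eq_of_eq_or_neg two_ne_zero hL' one_ne_zero hψ).1
    omega
  | 2, hP' =>
    obtain ⟨-, -, h₁⟩ := L.eq_of_eq_or_neg one_ne_zero (H.near_two_of_odd hm ho hP')
      (by positivity) hφ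
    have := two_pow_eq_one h₁.symm
    omega
  | l + 3, hP' =>
    have hl := hP'.le
    have h₂ := hat_ne_zero (n := n) (k := l + 2) (by omega) (by omega)
    have h₃ := hat_ne_zero (n := n) (k := l + 2 + 1) (by omega) (by omega)
    obtain ⟨hg, hd, -⟩ := L.eq_of_eq_or_neg one_ne_zero (H.near_of_odd hm ho hP')
      (by positivity) hφ
    have hg : q = i' + j' := by exact_mod_cast hg
    have hd : i * R + j * m = (m + 1) * (i' + j') := by exact_mod_cast hd
    rw [← hg, hP.eq'] at hd
    have := Nat.mul_le_mul_left i (show R ≤ m by have := hP.le; omega)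
    have := hP.eq'
    nlinarith

lemma TraceEq.last_near {m n i j l i' j' P q P' q' : ℕ} (h : TraceEq m (m + 1) n P q P' q')
    (hm : 3 ≤ m) (ho : Odd m) (hi : 1 ≤ i) (hP : IsBetween (m - 1) i j P q)
    (hP' : IsNear m n l i' j' P' q') : False := by
  obtain ⟨ℓ, hℓ⟩ : ∃ ℓ, m + 1 = 2 * ℓ := by obtain ⟨a, rfl⟩ := ho; exact ⟨a + 1, by ring⟩
  obtain ⟨ψ, K, hψ⟩ := h.exists_rootFam (ℓ := ℓ) (by omega) (by grind) (by omega)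
  have L := K.last_of_odd (by omega) hℓ hP
  match l, hP' with
  | 0, hP' =>
    obtain ⟨hg, hd⟩ := L.eq_of_eq_or_neg (K.near_zero_of_odd (by omega) hℓ hP') hψ
    obtain rfl : j = i' := by exact_mod_cast hg
    obtain rfl : i = j' := by exact_mod_cast hd
    obtain ⟨φ, H, hφ⟩ := h.symm.exists_expFam (by omega) m
    exact ((H.near_zero_of_odd hm ho hP').hasOrder one_ne_zero).false_of_small
      ((H.last_of_odd hm ho (hP'.pos' rfl) hP).cast rfl (add_comm _ _) rfl) hφ
  | l + 1, hP' =>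
    obtain ⟨g, d, hd, L'⟩ := K.near_of_odd (by omega) hℓ hP'
    have := (L.eq_of_eq_or_neg L' hψ).2
    omega

/-- A slope in `IsSteep` and a slope in `IsNear` are distinguished by their traces. -/
theorem TraceEq.steep_near {m n l i j P q P' q' : ℕ} (h : TraceEq m (m + 1) n P q P' q')
    (hm : 3 ≤ m) (ho : Odd m) (hP : IsSteep m P q) (hP' : IsNear m n l i j P' q') : False := by
  rcases hP with hP | ⟨hi, hP⟩
  · exact h.large_near_of_odd hm ho hP hP'
  · exact h.last_near hm ho hi hP hP'

lemma TraceEq.large_last {m n R Q i j i' j' P q P' q' : ℕ}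
    (h : TraceEq m (m + 1) n P q P' q') (hm : 3 ≤ m) (ho : Odd m)
    (hP : IsLarge m R Q i j P q) (hi : 1 ≤ i') (hP' : IsBetween (m - 1) i' j' P' q') : False := by
  obtain ⟨ℓ, hℓ⟩ : ∃ ℓ, m + 1 = 2 * ℓ := by obtain ⟨a, rfl⟩ := ho; exact ⟨a + 1, by ring⟩
  obtain ⟨ψ, K, hψ⟩ := h.exists_rootFam (ℓ := ℓ) (by omega) (by grind) (by omega)
  have := ((K.large_of_odd (by omega) hℓ hP).eq_of_eq_or_neg
    (K.last_of_odd (by omega) hℓ hP') hψ).2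
  split_ifs at this <;> omega

/-- Two slopes in `IsSteep` are distinguished by their traces. -/
theorem TraceEq.steep_steep {m n P q P' q' : ℕ} (h : TraceEq m (m + 1) n P q P' q')
    (hm : 3 ≤ m) (ho : Odd m) (hP : IsSteep m P q) (hP' : IsSteep m P' q') : P = P' ∧ q = q' := by
  rcases hP with hP | ⟨hi, hP⟩ <;> rcases hP' with hP' | ⟨hi', hP'⟩
  · exact h.large_large ho ho.add_one (by omega) hP hP'
  · exact (h.large_last hm ho hP hi' hP').elim
  · exact (h.symm.large_last hm ho hP' hi hP).elim
  · obtain ⟨ℓ, hℓ⟩ : ∃ ℓ, m + 1 = 2 * ℓ := by obtain ⟨a, rfl⟩ := ho; exact ⟨a + 1, by ring⟩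
    obtain ⟨ψ, K, hψ⟩ := h.exists_rootFam (ℓ := ℓ) (by omega) (by grind) (by omega)
    obtain ⟨hg, hd⟩ := (K.last_of_odd (by omega) hℓ hP).eq_of_eq_or_neg
      (K.last_of_odd (by omega) hℓ hP') hψ
    norm_cast at hg hd
    exact ⟨by rw [hP.eq, hP'.eq, hg, hd], by rw [hP.eq', hP'.eq', hg, hd]⟩

/-! ### Classification of the slopes -/

lemma coprime_of_combination {i j a b c d P q : ℕ} (h : P.Coprime q) (hP : P = i * a + j * b)
    (hq : q = i * c + j * d) : i.Coprime j := by
  have hi := Nat.gcd_dvd_left i j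
  have hj := Nat.gcd_dvd_right i j
  refine Nat.eq_one_of_dvd_coprimes h ?_ ?_
  · rw [hP]; exact dvd_add (hi.mul_right _) (hj.mul_right _)
  · rw [hq]; exact dvd_add (hi.mul_right _) (hj.mul_right _)

lemma exists_isMiddle {m P q : ℕ} (h : P.Coprime q) (hlt : P < (m + 1) * q)
    (hle : (3 * m + 2) * q ≤ 3 * P) : ∃ i j, IsMiddle m i j P q := by
  obtain ⟨j, hj⟩ := exists_add_of_le hlt.le
  obtain ⟨i, hi⟩ := exists_add_of_le hle
  have hq : q = i * 1 + j * 3 := by linarith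
  have hP : P = i * (m + 1) + j * (3 * m + 2) := by rw [hq] at hj; linarith
  exact ⟨i, j, coprime_of_combination h hP hq, by omega, hP, by omega⟩

lemma exists_isNear {m k P q : ℕ} (h : P.Coprime q) (hlt : m * q < P)
    (hP : (4 * k + 5) * P < q * ((4 * k + 5) * m + (2 * k + 2))) :
    ∃ l i j, IsNear m (k + 2) l i j P q := by
  obtain ⟨f, hf⟩ := exists_add_of_le hlt.le
  have hf₀ : 1 ≤ f := by omega
  have hfq : (4 * k + 5) * f < q * (2 * k + 2) := by subst hf; nlinarith
  obtain ⟨g, hg⟩ : ∃ g, q = 2 * f + g := exists_add_of_le (by nlinarith)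
  have hfg : f < (2 * k + 2) * g := by subst hg; nlinarith
  have hg₀ : 1 ≤ g := by
    rcases Nat.eq_zero_or_pos g with rfl | h₀
    · omega
    · exact h₀
  have hcop : f.Coprime g := by
    refine coprime_of_combination (a := 2 * m + 1) (b := m) (c := 2) (d := 1) h ?_ (by omega)
    rw [hf, hg]; ring
  obtain ⟨i, j, hj, hij⟩ := exists_isBetween hcop hg₀
  have hl : f / g < 2 * k + 2 := (Nat.div_lt_iff_lt_mul hg₀).2 hfg
  have h₁ := hij.eq
  have h₂ := hij.eq'
  refine ⟨f / g, i, j, hij.coprime, hj, fun h₀ => ?_, by omega, ?_, ?_⟩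
  · rw [h₀] at h₁
    omega
  · generalize f / g = l at *
    rw [den, den, hf, hg, h₁, h₂]; ring
  · generalize f / g = l at *
    rw [hg, h₁, h₂]; ring

lemma exists_isLarge {N P q : ℕ} (h : P.Coprime q) (hN : Even N) (hq : 1 ≤ q) (hle : q ≤ P)
    (hle' : P ≤ N * q) : ∃ R Q i j, IsLarge (N + 1) R Q i j P q := by
  rcases hle'.eq_or_lt with rfl | hlt
  · obtain rfl : q = 1 := Nat.Coprime.eq_one_of_dvd h.symm (Dvd.intro_left N rfl)
    have hN' : 2 ≤ N := by obtain ⟨k, rfl⟩ := hN; omega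
    exact ⟨N, N - 1, 1, 0, hN, by grind, by omega, by omega, by omega, by omega, by simp,
      by simp, by simp⟩
  · obtain ⟨i, j, -, hij, h₁, h₂⟩ := exists_isBetween h hq
    have hd : P / q < N := (Nat.div_lt_iff_lt_mul hq).2 hlt
    have hd' : 1 ≤ P / q := (Nat.one_le_div_iff hq).2 hle
    generalize P / q = d at *
    rcases Nat.even_or_odd d with hd₂ | hd₂
    · exact ⟨d, d + 1, j, i, hd₂, hd₂.add_one, hd', by omega, by omega, by grind, hij.symm,
        by rw [h₁]; ring, by omega⟩
    · exact ⟨d + 1, d, i, j, hd₂.add_one, hd₂, by omega, by omega, by omega, by grind, hij,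
        h₁, h₂⟩

lemma exists_isLow {m P q : ℕ} (h : P.Coprime q) (hle : (3 * m + 2) * q ≤ 3 * P) :
    IsLow m P q := by
  rcases Nat.eq_zero_or_pos q with rfl | hq
  · obtain rfl : P = 1 := by simpa using h
    exact .infinity
  by_cases h₁ : (m + 2) * q ≤ P
  · exact .small h hq h₁
  by_cases h₂ : (m + 1) * q ≤ P
  · obtain ⟨i, j, hj, hij⟩ := exists_isBetween h hq
    have : P / q = m + 1 := Nat.div_eq_of_lt_le h₂ (by simpa using h₁)
    exact .between hj (this ▸ hij)
  · obtain ⟨i, j, hij⟩ := exists_isMiddle h (not_le.1 h₂) hle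
    exact .middle hij

lemma exists_isFlat {m P q : ℕ} (h : P.Coprime q) (hle : (3 * m + 2) * q ≤ 3 * P) :
    IsFlat m P q := by
  rcases Nat.eq_zero_or_pos q with rfl | hq
  · obtain rfl : P = 1 := by simpa using h
    exact .infinity
  by_cases h₁ : (m + 1) * q ≤ P
  · exact .small h hq h₁
  · obtain ⟨i, j, hij⟩ := exists_isMiddle h (not_le.1 h₁) hle
    exact .middle hij

lemma exists_isSteep {m P q : ℕ} (h : P.Coprime q) (hm : Odd m) (hq : 1 ≤ q) (hle : q ≤ P)
    (hle' : P ≤ m * q) : IsSteep m P q := by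
  obtain ⟨N, rfl⟩ : ∃ N, m = N + 1 := ⟨m - 1, by grind⟩
  by_cases h₁ : P ≤ N * q
  · obtain ⟨R, Q, i, j, hij⟩ := exists_isLarge h (by grind) hq hle h₁
    exact .large hij
  · obtain ⟨i, hi⟩ := exists_add_of_le (not_le.1 h₁).le
    obtain ⟨j, hj⟩ := exists_add_of_le hle'
    have hq' : q = i * 1 + j * 1 := by linarith
    have hP : P = i * (N + 1) + j * N := by rw [hq'] at hj; linarith
    exact .last (i := i) (j := j) (by omega)
      ⟨coprime_of_combination h hP hq', by simpa using hP, by omega⟩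

/-- The slopes in `I₁(r; n) ∪ I₂(r)`. -/
def IsOuter (m P q : ℕ) : Prop :=
  (3 * m + 2) * q ≤ 3 * P ∨ 1 ≤ q ∧ q ≤ P ∧ P ≤ m * q

theorem TraceEq.of_even {m n P q P' q' : ℕ} (h : TraceEq (m + 1) m n P q P' q') (hm : 2 ≤ m)
    (he : Even m) (hP : P.Coprime q) (hP' : P'.Coprime q') (ho : IsOuter m P q)
    (ho' : IsOuter m P' q') : P = P' ∧ q = q' := by
  rcases ho with h₁ | ⟨h₁, h₂, h₃⟩ <;> rcases ho' with h₄ | ⟨h₄, h₅, h₆⟩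
  · exact h.low_low hm he (exists_isLow hP h₁) (exists_isLow hP' h₄)
  · obtain ⟨R, Q, i, j, L⟩ := exists_isLarge hP' he h₄ h₅ h₆
    exact (h.symm.large_low hm he L (exists_isLow hP h₁)).elim
  · obtain ⟨R, Q, i, j, L⟩ := exists_isLarge hP he h₁ h₂ h₃
    exact (h.large_low hm he L (exists_isLow hP' h₄)).elim
  · obtain ⟨R, Q, i, j, L⟩ := exists_isLarge hP he h₁ h₂ h₃
    obtain ⟨R', Q', i', j', L'⟩ := exists_isLarge hP' he h₄ h₅ h₆
    exact h.large_large he.add_one he (by omega) L L'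

theorem TraceEq.of_odd {m n P q P' q' : ℕ} (h : TraceEq m (m + 1) n P q P' q') (hm : 3 ≤ m)
    (ho : Odd m) (hP : P.Coprime q) (hP' : P'.Coprime q') (hI : IsOuter m P q)
    (hI' : IsOuter m P' q') : P = P' ∧ q = q' := by
  rcases hI with h₁ | ⟨h₁, h₂, h₃⟩ <;> rcases hI' with h₄ | ⟨h₄, h₅, h₆⟩
  · exact h.flat_flat hm ho (exists_isFlat hP h₁) (exists_isFlat hP' h₄)
  · exact (h.symm.steep_flat hm ho (exists_isSteep hP' ho h₄ h₅ h₆) (exists_isFlat hP h₁)).elim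
  · exact (h.steep_flat hm ho (exists_isSteep hP ho h₁ h₂ h₃) (exists_isFlat hP' h₄)).elim
  · exact h.steep_steep hm ho (exists_isSteep hP ho h₁ h₂ h₃) (exists_isSteep hP' ho h₄ h₅ h₆)

theorem TraceEq.outer_near_of_even {m n l i j P q P' q' : ℕ}
    (h : TraceEq (m + 1) m n P q P' q') (hm : 2 ≤ m) (he : Even m) (hn : 2 ≤ n)
    (hP : P.Coprime q) (ho : IsOuter m P q) (hP' : IsNear m n l i j P' q') : False := by
  rcases ho with h₁ | ⟨h₁, h₂, h₃⟩
  · exact h.low_near hm he hn (exists_isLow hP h₁) hP'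
  · obtain ⟨R, Q, i, j, L⟩ := exists_isLarge hP he h₁ h₂ h₃
    exact h.large_near hm he L hP'

theorem TraceEq.outer_near_of_odd {m n l i j P q P' q' : ℕ}
    (h : TraceEq m (m + 1) n P q P' q') (hm : 3 ≤ m) (ho : Odd m)
    (hP : P.Coprime q) (hI : IsOuter m P q) (hP' : IsNear m n l i j P' q') : False := by
  rcases hI with h₁ | ⟨h₁, h₂, h₃⟩
  · exact h.flat_near hm ho (exists_isFlat hP h₁) hP'
  · exact h.steep_near hm ho (exists_isSteep hP ho h₁ h₂ h₃) hP'

/-! ### Conjugate loops -/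

lemma coprime_den_num {s : ℚ} (hs : 0 ≤ s) : s.den.Coprime s.num.toNat := by
  have h := s.reduced
  rwa [Nat.coprime_comm, show s.num.natAbs = s.num.toNat by
    have := Rat.num_nonneg.2 hs; omega] at h

lemma eq_toNat_div_den {s : ℚ} (hs : 0 ≤ s) : s = (s.num.toNat : ℚ) / s.den := by
  conv_lhs => rw [← Rat.num_div_den s]
  rw [← Int.cast_natCast s.num.toNat, Int.toNat_of_nonneg (Rat.num_nonneg.2 hs)]

lemma eq_of_den_eq {s s' : ℚ} (hs : 0 ≤ s) (hs' : 0 ≤ s')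
    (h : s.den = s'.den ∧ s.num.toNat = s'.num.toNat) : s = s' := by
  rw [eq_toNat_div_den hs, eq_toNat_div_den hs', h.1, h.2]

/-- The slopes in `I₂(r; n) ∖ I₂(r)`. -/
def IsInner (m k : ℕ) (s : ℚ) : Prop :=
  m * s.num.toNat < s.den ∧
    (4 * k + 5) * s.den < s.num.toNat * ((4 * k + 5) * m + (2 * k + 2))

lemma traceEq_of_isConj {o e n : ℕ} (hn : 2 ≤ n) (ho : Odd o) (he : Even e)
    (hoe : e = o + 1 ∨ o = e + 1) {s s' : ℚ} (hs : 0 ≤ s) (hs' : 0 ≤ s')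
    (h : IsConj (heckQ (2 / (o + e)) n (uWord s)) (heckQ (2 / (o + e)) n (uWord s')) ∨
      IsConj (heckQ (2 / (o + e)) n (uWord s)) (heckQ (2 / (o + e)) n (uWord s'))⁻¹) :
    TraceEq o e n s.den s.num.toNat s'.den s'.num.toNat := fun τ K hτ hK hT => by
  obtain ⟨φ, hφ, H⟩ := exists_isTraceFun hn ho he hoe hτ hK hT
  exact ⟨φ, hφ, H s s' hs hs' h⟩

lemma isInner_of_isConj {m k : ℕ} (hm : 2 ≤ m) {s s' : ℚ} (hs : 0 ≤ s) (hs' : 0 ≤ s')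
    (hne : s ≠ s') (h₁ : IsOuter m s.den s.num.toNat ∨ IsInner m k s)
    (h₂ : IsOuter m s'.den s'.num.toNat ∨ IsInner m k s')
    (h : IsConj (heckQ (2 / (2 * m + 1)) (k + 2) (uWord s))
        (heckQ (2 / (2 * m + 1)) (k + 2) (uWord s')) ∨
      IsConj (heckQ (2 / (2 * m + 1)) (k + 2) (uWord s))
        (heckQ (2 / (2 * m + 1)) (k + 2) (uWord s'))⁻¹) :
    IsInner m k s ∧ IsInner m k s' := by
  have hP := coprime_den_num hs
  have hP' := coprime_den_num hs'
  rcases Nat.even_or_odd m with he | ho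
  · have T : TraceEq (m + 1) m (k + 2) s.den s.num.toNat s'.den s'.num.toNat := by
      refine traceEq_of_isConj (by omega) he.add_one he (by omega) hs hs' ?_
      rwa [show (2 / (((m + 1 : ℕ) : ℚ) + m)) = 2 / (2 * m + 1) by push_cast; ring_nf]
    rcases h₁ with h₁ | h₁ <;> rcases h₂ with h₂ | h₂
    · exact absurd (eq_of_den_eq hs hs' (T.of_even hm he hP hP' h₁ h₂)) hne
    · obtain ⟨l, i, j, hN⟩ := exists_isNear hP' h₂.1 h₂.2
      exact (T.outer_near_of_even hm he (by omega) hP h₁ hN).elim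
    · obtain ⟨l, i, j, hN⟩ := exists_isNear hP h₁.1 h₁.2
      exact (T.symm.outer_near_of_even hm he (by omega) hP' h₂ hN).elim
    · exact ⟨h₁, h₂⟩
  · have hm' : 3 ≤ m := by obtain ⟨a, rfl⟩ := ho; omega
    have T : TraceEq m (m + 1) (k + 2) s.den s.num.toNat s'.den s'.num.toNat := by
      refine traceEq_of_isConj (by omega) ho ho.add_one (by omega) hs hs' ?_
      rwa [show (2 / ((m : ℚ) + (m + 1 : ℕ))) = 2 / (2 * m + 1) by push_cast; ring_nf]
    rcases h₁ with h₁ | h₁ <;> rcases h₂ with h₂ | h₂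
    · exact absurd (eq_of_den_eq hs hs' (T.of_odd hm' ho hP hP' h₁ h₂)) hne
    · obtain ⟨l, i, j, hN⟩ := exists_isNear hP' h₂.1 h₂.2
      exact (T.outer_near_of_odd hm' ho hP h₁ hN).elim
    · obtain ⟨l, i, j, hN⟩ := exists_isNear hP h₁.1 h₁.2
      exact (T.symm.outer_near_of_odd hm' ho hP' h₂ hN).elim
    · exact ⟨h₁, h₂⟩

/-! ### The intervals -/

lemma memI1_iff {m n : ℕ} {s : ℚ} :
    memI1 [m, 2] n s ↔ 0 ≤ s ∧ s ≤ 3 / (3 * m + 2) := by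
  have : (0 : ℚ) ≤ m := m.cast_nonneg
  have h : 1 / ((m : ℚ) + 1 / (1 + 1 / 2)) = 3 / (3 * m + 2) := by
    field_simp; norm_num; ring
  simp [memI1, cfQ, ← h, List.getLast!]

lemma memI2_iff {m k : ℕ} {s : ℚ} : memI2 [m, 2] (k + 2) s ↔
    (4 * k + 5) / ((4 * k + 5) * m + (2 * k + 2)) < s ∧ s ≤ 1 := by
  have : (0 : ℚ) ≤ m := m.cast_nonneg
  have : (0 : ℚ) ≤ k := k.cast_nonneg
  have h : 1 / ((m : ℚ) + 1 / (2 + 1 / ((2 * (k + 2) - 2 : ℕ) : ℚ))) =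
      (4 * k + 5) / ((4 * k + 5) * m + (2 * k + 2)) := by
    rw [show 2 * (k + 2) - 2 = 2 * k + 2 by omega]
    push_cast
    field_simp
    ring
  simp [memI2, cfQ, ← h]

lemma memI2hat_iff {m : ℕ} {s : ℚ} : memI2hat [m, 2] s ↔ 1 / m ≤ s ∧ s ≤ 1 := by
  simp [memI2hat, cfQ]

lemma nonneg_of_mem {m k : ℕ} {s : ℚ} (h : memI1 [m, 2] (k + 2) s ∨ memI2 [m, 2] (k + 2) s) :
    0 ≤ s := by
  rcases h with h | h
  · exact (memI1_iff.1 h).1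
  · exact (lt_of_le_of_lt (by positivity) (memI2_iff.1 h).1).le

lemma isOuter_or_isInner {m k : ℕ} {s : ℚ} (hm : 2 ≤ m)
    (h : memI1 [m, 2] (k + 2) s ∨ memI2 [m, 2] (k + 2) s) :
    IsOuter m s.den s.num.toNat ∨ IsInner m k s := by
  have hs := eq_toNat_div_den (nonneg_of_mem h)
  have hden : (0 : ℚ) < s.den := by exact_mod_cast s.den_pos
  simp only [memI1_iff, memI2_iff] at h
  rw [hs] at h
  rw [IsOuter, IsInner]
  generalize s.num.toNat = q at *
  generalize s.den = P at *
  rw [div_le_div_iff₀ hden (by positivity), div_lt_div_iff₀ (by positivity) hden,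
    div_le_one hden] at h
  norm_cast at h hden
  rcases h with ⟨-, h⟩ | ⟨h, h'⟩
  · left; left; linarith
  · rcases lt_or_ge (m * q) P with h₁ | h₁
    · exact Or.inr ⟨h₁, h⟩
    · refine Or.inl (Or.inr ⟨?_, h', h₁⟩)
      by_contra hq
      simp_all

lemma IsInner.mem {m k : ℕ} {s : ℚ} (hm : 2 ≤ m) (hs : 0 ≤ s) (h : IsInner m k s) :
    ¬memI1 [m, 2] (k + 2) s ∧ memI2 [m, 2] (k + 2) s ∧ ¬memI2hat [m, 2] s := by
  have hs' := eq_toNat_div_den hs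
  have hden : (0 : ℚ) < s.den := by exact_mod_cast s.den_pos
  have hm' : (0 : ℚ) < m := by positivity
  rw [memI1_iff, memI2_iff, memI2hat_iff]
  rw [hs']
  rw [IsInner] at h
  generalize s.num.toNat = q at *
  generalize s.den = P at *
  rw [div_le_div_iff₀ hden (by positivity), div_lt_div_iff₀ (by positivity) hden,
    div_le_one hden, div_le_div_iff₀ hm' hden]
  norm_cast at *
  obtain ⟨h₁, h₂⟩ := h
  refine ⟨fun h => ?_, ⟨h₂, by nlinarith⟩, fun h => ?_⟩
  · nlinarith [h.2]
  · linarith [h.1]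

end

/-- Claim in Lemma 3.6: if `r = [m,2]` with `m ≥ 2` and `s ≠ s'` in
`I₁(r;n) ∪ I₂(r;n)` are such that `u_s` is conjugate in `Heck(r;n)` to
`u_{s'}^{±1}`, then neither `s` nor `s'` lies in `I₁(r;n) ∖ I₁(r)`; that is,
both lie in `I₂(r;n) ∖ I₂(r)`. -/
theorem statement12
    (M : List ℕ) (m n : ℕ) (r : ℚ)
    (hMlen : 2 ≤ M.length) (hMpos : ∀ x ∈ M, 0 < x) (hMlast : 2 ≤ M.getLast!)
    (hm : M.head? = some m) (hn : 2 ≤ n) (hr : r = cfQ M)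
    (hm2 : 2 ≤ m) (hM : M = [m, 2])
    (s s' : ℚ) (hss' : s ≠ s')
    (hs : memI1 M n s ∨ memI2 M n s) (hs' : memI1 M n s' ∨ memI2 M n s')
    (hconj : IsConj (heckQ r n (uWord s)) (heckQ r n (uWord s')) ∨
      IsConj (heckQ r n (uWord s)) ((heckQ r n (uWord s'))⁻¹)) :
    ¬ (memI1 M n s ∧ ¬ memI1hat M s) ∧ ¬ (memI1 M n s' ∧ ¬ memI1hat M s') ∧
    (memI2 M n s ∧ ¬ memI2hat M s) ∧ (memI2 M n s' ∧ ¬ memI2hat M s') := by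
  subst hM
  obtain ⟨k, rfl⟩ : ∃ k, n = k + 2 := ⟨n - 2, by omega⟩
  obtain rfl : r = 2 / (2 * m + 1) := by
    rw [hr]
    simp only [cfQ]
    field_simp
    push_cast
    ring
  have h₀ := nonneg_of_mem hs
  have h₀' := nonneg_of_mem hs'
  obtain ⟨h₁, h₂⟩ := isInner_of_isConj hm2 h₀ h₀' hss' (isOuter_or_isInner hm2 hs)
    (isOuter_or_isInner hm2 hs') hconj
  obtain ⟨h₃, h₄⟩ := h₁.mem hm2 h₀
  obtain ⟨h₅, h₆⟩ := h₂.mem hm2 h₀'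
  exact ⟨fun h => h₃ h.1, fun h => h₅ h.1, h₄, h₆⟩

end Heckoid
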